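/- Let P(u,v) be a non-degenerate 3×n transportation polytope and let k be the number of critical edges of P(u,v). Then the graph diameter of P(u,v) is at most n + 2 − k, which is the Hirsch bound (number of facets minus dimension) for this polytope. -/

import Mathlib

open scoped Classical

/-- The m×n transportation polytope with margins u, v. -/
def TP (m n : ℕ) (u : Fin m → ℝ) (v : Fin n → ℝ) : Set (Matrix (Fin m) (Fin n) ℝ) :=
  {y | (∀ i j, 0 ≤ y i j) ∧ (∀ i, ∑ j, y i j = u i) ∧ (∀ j, ∑ i, y i j = v j)}

/-- The support of a matrix: the set of positions with positive entry. -/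
noncomputable def suppF (m n : ℕ) (y : Matrix (Fin m) (Fin n) ℝ) : Finset (Fin m × Fin n) :=
  Finset.univ.filter (fun p => 0 < y p.1 p.2)

/-- Non-degeneracy: every vertex has exactly m + n − 1 positive entries. -/
def NonDeg (m n : ℕ) (u : Fin m → ℝ) (v : Fin n → ℝ) : Prop :=
  ∀ y ∈ Set.extremePoints ℝ (TP m n u v), (suppF m n y).card = m + n - 1

/-- The number of critical edges: pairs (i,j) with y i j > 0 for every y in P. -/
noncomputable def criticalCount (m n : ℕ) (u : Fin m → ℝ) (v : Fin n → ℝ) : ℕ :=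
  (Finset.univ.filter
    (fun p : Fin m × Fin n => ∀ y ∈ TP m n u v, 0 < y p.1 p.2)).card

/-- Two distinct vertices are adjacent if the segment between them is extreme in P. -/
def AdjVert (m n : ℕ) (u : Fin m → ℝ) (v : Fin n → ℝ)
    (y z : Matrix (Fin m) (Fin n) ℝ) : Prop :=
  y ≠ z ∧ y ∈ Set.extremePoints ℝ (TP m n u v) ∧ z ∈ Set.extremePoints ℝ (TP m n u v) ∧
    IsExtreme ℝ (TP m n u v) (segment ℝ y z)

set_option linter.unusedSimpArgs false

namespace G3

section pivot

variable {n : ℕ} {u : Fin 3 → ℝ} {v : Fin n → ℝ}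

theorem indep {y : Matrix (Fin 3) (Fin n) ℝ} (hy : y ∈ Set.extremePoints ℝ (TP 3 n u v))
    (D : Matrix (Fin 3) (Fin n) ℝ) (hr : ∀ i, ∑ j, D i j = 0) (hc : ∀ j, ∑ i, D i j = 0)
    (hs : ∀ i j, y i j = 0 → D i j = 0) : D = 0 := by
  rw [mem_extremePoints] at hy
  obtain ⟨⟨h0, h1, h2⟩, hex⟩ := hy
  obtain ⟨ε, hε, hb⟩ : ∃ ε : ℝ, 0 < ε ∧ ∀ i j, ε * |D i j| ≤ y i j := by
    have : ∀ p : Fin 3 × Fin n, ∃ ε : ℝ, 0 < ε ∧ ε * |D p.1 p.2| ≤ y p.1 p.2 := by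
      intro p
      rcases (h0 p.1 p.2).eq_or_lt with h | h
      · exact ⟨1, one_pos, by rw [hs _ _ h.symm]; simp [← h]⟩
      · refine ⟨y p.1 p.2 / (|D p.1 p.2| + 1), by positivity, ?_⟩
        rw [div_mul_eq_mul_div, div_le_iff₀ (by positivity)]
        nlinarith [abs_nonneg (D p.1 p.2)]
    choose e he1 he2 using this
    by_cases hn : Nonempty (Fin 3 × Fin n)
    · refine ⟨Finset.univ.inf' (Finset.univ_nonempty) e, ?_, ?_⟩
      · rw [Finset.lt_inf'_iff]; intro p _; exact he1 p
      · intro i j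
        refine le_trans (mul_le_mul_of_nonneg_right (Finset.inf'_le e (Finset.mem_univ (i, j)))
          (abs_nonneg _)) (he2 (i, j))
    · exact ⟨1, one_pos, fun i j => (hn ⟨(i, j)⟩).elim⟩
  have key : ∀ c : ℝ, |c| = ε → y + c • D ∈ TP 3 n u v := by
    intro c hcε
    refine ⟨fun i j => ?_, fun i => ?_, fun j => ?_⟩
    · have h3 := hb i j
      have h4 : |c * D i j| ≤ y i j := by rw [abs_mul, hcε]; exact h3
      have := (abs_le.1 h4).1
      simp only [Matrix.add_apply, Matrix.smul_apply, smul_eq_mul]; linarith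
    · simp only [Matrix.add_apply, Matrix.smul_apply, smul_eq_mul, Finset.sum_add_distrib,
        ← Finset.mul_sum, hr, h1]; simp
    · simp only [Matrix.add_apply, Matrix.smul_apply, smul_eq_mul, Finset.sum_add_distrib,
        ← Finset.mul_sum, hc, h2]; simp
  have h5 := hex _ (key ε (abs_of_pos hε)) _ (key (-ε) (by rw [abs_neg, abs_of_pos hε]))
    ⟨1/2, 1/2, by norm_num, by norm_num, by norm_num, by
      ext i j
      simp only [Matrix.add_apply, Matrix.smul_apply, smul_eq_mul]; ring⟩
  have h6 : ε • D = 0 := by simpa using h5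
  rcases smul_eq_zero.1 h6 with h | h
  · exact absurd h hε.ne'
  · exact h

theorem extr_of_indep {y : Matrix (Fin 3) (Fin n) ℝ} (hy : y ∈ TP 3 n u v)
    (h : ∀ D : Matrix (Fin 3) (Fin n) ℝ, (∀ i, ∑ j, D i j = 0) → (∀ j, ∑ i, D i j = 0) →
      (∀ i j, y i j = 0 → D i j = 0) → D = 0) : y ∈ Set.extremePoints ℝ (TP 3 n u v) := by
  refine ⟨hy, ?_⟩
  rintro x1 hx1 x2 hx2 ⟨a, b, ha, hb, hab, rfl⟩
  have hD := h (x1 - (a • x1 + b • x2)) (fun i => by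
      have e1 := hx1.2.1 i
      have e2 := hy.2.1 i
      simp only [Matrix.sub_apply, Finset.sum_sub_distrib] at e2 ⊢
      rw [e1, e2]; ring) (fun j => by
      have e1 := hx1.2.2 j
      have e2 := hy.2.2 j
      simp only [Matrix.sub_apply, Finset.sum_sub_distrib] at e2 ⊢
      rw [e1, e2]; ring) (fun i j hz => by
      have p1 := hx1.1 i j
      have p2 := hx2.1 i j
      have hz' : a * x1 i j + b * x2 i j = 0 := hz
      have : a * x1 i j = 0 := by nlinarith [mul_nonneg ha.le p1, mul_nonneg hb.le p2]
      have h1 : x1 i j = 0 := by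
        rcases mul_eq_zero.1 this with h | h
        · exact absurd h ha.ne'
        · exact h
      rw [Matrix.sub_apply, h1, hz]; ring)
  exact sub_eq_zero.1 hD

/-- the circuit given by moving column `j` from row `a j` to row `b j` -/
noncomputable def circ (a b : Fin n → Fin 3) : Matrix (Fin 3) (Fin n) ℝ :=
  fun i j => (if i = b j then 1 else 0) - (if i = a j then 1 else 0)

theorem circ_col (a b : Fin n → Fin 3) (j) : ∑ i, circ a b i j = 0 := by
  simp [circ]

theorem circ_zero {a b : Fin n → Fin 3} {i j} (h : a j = b j) : circ a b i j = 0 := by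
  simp [circ, h]

theorem pivot (hnd : NonDeg 3 n u v) {y : Matrix (Fin 3) (Fin n) ℝ}
    (hy : y ∈ Set.extremePoints ℝ (TP 3 n u v)) (a b : Fin n → Fin 3) (j0 : Fin n)
    (hr : ∀ i, ∑ j, circ a b i j = 0) (hj : a j0 ≠ b j0) (hf : y (b j0) j0 = 0)
    (ha : ∀ j, a j ≠ b j → 0 < y (a j) j) (hb : ∀ j, j ≠ j0 → a j ≠ b j → 0 < y (b j) j) :
    ∃ z, AdjVert 3 n u v y z ∧ ∃ g, a g ≠ b g ∧ ∀ i j, (0 < z i j ↔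
      (0 < y i j ∨ (i = b j0 ∧ j = j0)) ∧ ¬ (i = a g ∧ j = g)) := by
  have hyT : y ∈ TP 3 n u v := hy.1
  obtain ⟨g, hg, hmin⟩ := Finset.exists_min_image
    (Finset.univ.filter (fun j => a j ≠ b j)) (fun j => y (a j) j) ⟨j0, by simp [hj]⟩
  simp only [Finset.mem_filter, Finset.mem_univ, true_and] at hg hmin
  set θ := y (a g) g with hθ
  have hθ0 : 0 < θ := ha g hg
  have cf : circ a b (b j0) j0 = 1 := by simp [circ, hj.symm]
  have cg : circ a b (a g) g = -1 := by simp [circ, hg]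
  -- the circuit vanishes outside the support of `y` and the new edge
  have cz : ∀ i j, y i j = 0 → ¬ (i = b j0 ∧ j = j0) → circ a b i j = 0 := by
    intro i j h1 h2
    by_cases hab : a j = b j
    · exact circ_zero hab
    have h3 : i ≠ a j := fun h => by have := ha j hab; rw [← h, h1] at this; exact lt_irrefl _ this
    have h4 : i ≠ b j := fun h => by
      by_cases hjj : j = j0
      · exact h2 ⟨by rw [h, hjj], hjj⟩
      · have := hb j hjj hab; rw [← h, h1] at this; exact lt_irrefl _ this
    simp [circ, h3, h4]
  -- the kernel on the extended support is one-dimensional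
  have ker : ∀ D : Matrix (Fin 3) (Fin n) ℝ, (∀ i, ∑ j, D i j = 0) → (∀ j, ∑ i, D i j = 0) →
      (∀ i j, y i j = 0 → ¬ (i = b j0 ∧ j = j0) → D i j = 0) →
      D = D (b j0) j0 • circ a b := by
    intro D h1 h2 h3
    have := indep hy (D - D (b j0) j0 • circ a b) (fun i => by
      simp [Finset.sum_sub_distrib, ← Finset.mul_sum, h1, hr]) (fun j => by
      simp only [Matrix.sub_apply, Matrix.smul_apply, smul_eq_mul, Finset.sum_sub_distrib,
        ← Finset.mul_sum, h2, circ_col]; simp) (fun i j h => by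
      by_cases hh : i = b j0 ∧ j = j0
      · rw [hh.1, hh.2]; simp [cf]
      · simp [h3 i j h hh, cz i j h hh])
    exact sub_eq_zero.1 this
  have cge : ∀ i j, 0 ≤ y i j + θ * circ a b i j := by
    intro i j
    have h0 := hyT.1 i j
    by_cases hab : a j = b j
    · rw [circ_zero hab]; simpa using h0
    · by_cases hi : i = a j
      · have := hmin j hab
        have hc : circ a b i j = -1 := by simp [circ, hi, hab]
        rw [hc, hi]; linarith
      · have hc : 0 ≤ circ a b i j := by
          simp only [circ, hi, if_false]; split_ifs <;> norm_num
        have := mul_nonneg hθ0.le hc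
        linarith
  have hzT : y + θ • circ a b ∈ TP 3 n u v := by
    refine ⟨fun i j => ?_, fun i => ?_, fun j => ?_⟩
    · simpa using cge i j
    · simp only [Matrix.add_apply, Matrix.smul_apply, smul_eq_mul, Finset.sum_add_distrib,
        ← Finset.mul_sum, hr, hyT.2.1]; simp
    · simp only [Matrix.add_apply, Matrix.smul_apply, smul_eq_mul, Finset.sum_add_distrib,
        ← Finset.mul_sum, circ_col, hyT.2.2]; simp
  have hzg : (y + θ • circ a b) (a g) g = 0 := by simp [cg, hθ]
  have hzf : (y + θ • circ a b) (b j0) j0 = θ := by simp [cf, hf]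
  have hz : y + θ • circ a b ∈ Set.extremePoints ℝ (TP 3 n u v) := by
    refine extr_of_indep hzT ?_
    intro D h1 h2 h3
    have h4 := ker D h1 h2 (fun i j h5 h6 => h3 i j (by simp [h5, cz i j h5 h6]))
    have h5 := h3 _ _ hzg
    rw [h4] at h5
    simp only [Matrix.smul_apply, smul_eq_mul, cg] at h5
    rw [h4, show D (b j0) j0 = 0 by linarith, zero_smul]
  have hsub : suppF 3 n (y + θ • circ a b) ⊆
      (insert (b j0, j0) (suppF 3 n y)).erase (a g, g) := by
    rintro ⟨i, j⟩ hp
    simp only [suppF, Finset.mem_filter, Finset.mem_univ, true_and] at hp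
    simp only [Finset.mem_erase, Finset.mem_insert, suppF, Finset.mem_filter, Finset.mem_univ,
      true_and, Prod.mk.injEq, ne_eq]
    refine ⟨fun h => ?_, ?_⟩
    · rw [h.1, h.2, hzg] at hp; exact lt_irrefl _ hp
    · by_contra hcon
      push Not at hcon
      have h0 : y i j = 0 := le_antisymm hcon.2 (hyT.1 i j)
      have := cz i j h0 (fun h => hcon.1 h.1 h.2)
      rw [Matrix.add_apply, Matrix.smul_apply, h0, this] at hp
      simp at hp
  have hgf : ¬ (a g = b j0 ∧ g = j0) := by
    rintro ⟨h1, h2⟩; subst h2; exact hg h1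
  have hcard : ((insert (b j0, j0) (suppF 3 n y)).erase (a g, g)).card
      ≤ (suppF 3 n (y + θ • circ a b)).card := by
    rw [hnd _ hz, Finset.card_erase_of_mem, Finset.card_insert_of_notMem, hnd _ hy]
    · simp
    · simp [suppF, hf]
    · refine Finset.mem_insert_of_mem ?_
      simp [suppF]; exact hθ0
  have heq := Finset.eq_of_subset_of_card_le hsub hcard
  refine ⟨_, ⟨fun h => ?_, hy, hz, ?_⟩, g, hg, fun i j => ?_⟩
  · rw [← h, hf] at hzf; exact hθ0.ne hzf
  · have hconv : Convex ℝ (TP 3 n u v) := by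
      rintro x hx w hw p q hp hq hpq
      refine ⟨fun i j => ?_, fun i => ?_, fun j => ?_⟩
      · have := hx.1 i j; have := hw.1 i j
        simp only [Matrix.add_apply, Matrix.smul_apply, smul_eq_mul]; positivity
      · simp only [Matrix.add_apply, Matrix.smul_apply, smul_eq_mul, Finset.sum_add_distrib,
          ← Finset.mul_sum, hx.2.1, hw.2.1]; rw [← add_mul, hpq, one_mul]
      · simp only [Matrix.add_apply, Matrix.smul_apply, smul_eq_mul, Finset.sum_add_distrib,
          ← Finset.mul_sum, hx.2.2, hw.2.2]; rw [← add_mul, hpq, one_mul]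
    refine ⟨hconv.segment_subset hyT hzT, ?_⟩
    rintro x1 hx1 x2 hx2 x hx ⟨p, q, hp, hq, hpq, rfl⟩
    have hx1z : ∀ i j, y i j = 0 → ¬ (i = b j0 ∧ j = j0) → x1 i j = 0 := by
      intro i j h1 h2
      obtain ⟨p', q', hp', hq', hpq', he⟩ := hx
      have e1 := congrFun (congrFun he i) j
      simp only [Matrix.add_apply, Matrix.smul_apply, smul_eq_mul, h1, cz i j h1 h2] at e1
      have p1 := hx1.1 i j
      have p2 := hx2.1 i j
      have : p * x1 i j = 0 := by nlinarith [mul_nonneg hp.le p1, mul_nonneg hq.le p2]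
      rcases mul_eq_zero.1 this with h | h
      · exact absurd h hp.ne'
      · exact h
    have h4 := ker (x1 - y) (fun i => by
      simp [Finset.sum_sub_distrib, hx1.2.1 i, hyT.2.1 i]) (fun j => by
      simp only [Matrix.sub_apply, Finset.sum_sub_distrib, hx1.2.2 j, hyT.2.2 j]; simp)
      (fun i j h1 h2 => by simp [hx1z i j h1 h2, h1])
    have hl : (x1 - y) (b j0) j0 = x1 (b j0) j0 := by simp [hf]
    rw [hl] at h4
    have hl0 := hx1.1 (b j0) j0
    set l := x1 (b j0) j0
    have h5 : x1 = y + l • circ a b := by rw [← h4]; abel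
    have h6 := hx1.1 (a g) g
    rw [h5] at h6
    simp only [Matrix.add_apply, Matrix.smul_apply, smul_eq_mul, cg] at h6
    refine ⟨1 - l / θ, l / θ, ?_, by positivity, by ring, ?_⟩
    · rw [sub_nonneg, div_le_one hθ0]; linarith
    · rw [h5]
      ext i j
      simp only [Matrix.add_apply, Matrix.smul_apply, smul_eq_mul]
      field_simp
      ring
  · have := congrArg (fun s => (i, j) ∈ s) heq
    simp only [Finset.mem_erase, Finset.mem_insert, suppF, Finset.mem_filter, Finset.mem_univ,
      true_and, Prod.mk.injEq, ne_eq, eq_iff_iff] at this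
    rw [this]; tauto

end pivot
end G3

namespace G3

/-- Search trees: keys are encoded game states, values are encoded moves. -/
inductive Tr where
  | e : Tr
  | n (l : Tr) (k v : Nat) (r : Tr) : Tr

open Tr

/-- bit test, kernel friendly -/
def tb (m i : Nat) : Bool := Nat.beq (Nat.land (Nat.shiftRight m i) 1) 1

def isz (a : Nat) : Bool := Nat.beq a 0

def look : Tr → Nat → Option Nat
  | e, _ => none
  | n l k v r, x => bif Nat.beq x k then some v else bif Nat.ble x k then look l x else look r x

/-- support mask of the node with code `c` -/
def sup (pA pB c : Nat) : Nat :=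
  bif isz c then pA else bif Nat.beq c 1 then pB else Nat.div c 3

def present (T c : Nat) : Bool := isz c || Nat.beq c 1 || tb T c

def gE (p F x : Nat) : Bool := !(tb F x) || Nat.beq p (Nat.pow 2 x)
def gS (p F x : Nat) : Bool :=
  (tb p x && !(tb F x)) || (Nat.beq p (Nat.pow 2 x) && !(Nat.beq F (Nat.pow 2 x)))

/-- no other node wants to enter `x` -/
def noIn (T x : Nat) : Bool := isz (Nat.land T (Nat.shiftLeft 2396744 x))

def outMask (x : Nat) : Nat :=
  bif isz x then 12782640 else bif Nat.beq x 1 then 11799360 else 7188480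

def noOut (T x : Nat) : Bool := isz (Nat.land T (outMask x))

def infeasX (FA FB pA pB T x : Nat) : Bool :=
  (noIn T x && (gE pA FA x && (gE pB FB x && (gS pA FA x || gS pB FB x)))) ||
  (noOut T x && (gE FA pA x && (gE FB pB x && (gS FA pA x || gS FB pB x))))

def infeas (FA FB pA pB T : Nat) : Bool :=
  infeasX FA FB pA pB T 0 || (infeasX FA FB pA pB T 1 || infeasX FA FB pA pB T 2)

def final (FA FB pA pB T : Nat) : Bool := isz T && (Nat.beq pA FA && Nat.beq pB FB)

def key (pA pB MA MB T : Nat) : Nat :=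
  Nat.add pA (Nat.add (Nat.mul 8 pB) (Nat.add (Nat.mul 64 MA)
    (Nat.add (Nat.mul 512 MB) (Nat.mul 4096 T))))

def good (tab : Tr) (FA FB pA pB MA MB T : Nat) : Bool :=
  (isz MA && isz MB) || (final FA FB pA pB T || (look tab (key pA pB MA MB T)).isSome)

/-- codes of other nodes which already are as in the target -/
def done (c : Nat) : Bool := Nat.beq c 3 || (Nat.beq c 7 || Nat.beq c 14)

def addC (T c : Nat) : Nat := bif done c then T else Nat.lor T (Nat.pow 2 c)

def newc (c S : Nat) : Nat := Nat.add (Nat.mul 3 S) (Nat.mod c 3)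

/-- change the support of node `c` to `S`; the new value of `T` -/
def setT (T c S : Nat) (keep : Bool) : Nat :=
  bif Nat.ble c 1 then T
  else addC (bif keep then T else Nat.xor T (Nat.pow 2 c)) (newc c S)

def setA (pA c S : Nat) : Nat := bif isz c then S else pA
def setB (pB c S : Nat) : Nat := bif Nat.beq c 1 then S else pB

def single (S : Nat) : Bool := Nat.beq S 1 || (Nat.beq S 2 || Nat.beq S 4)

/-- protected edges -/
def prot (MA MB c x : Nat) : Bool :=
  bif isz c then tb MA x else bif Nat.beq c 1 then tb MB x else Nat.beq (Nat.mod c 3) x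

structure Mv where
  c0 : Nat
  s : Nat
  t : Nat
  c1 : Nat
  z : Nat
  c2 : Nat

def decMv (m : Nat) : Mv :=
  ⟨Nat.land m 31, Nat.land (Nat.shiftRight m 5) 3, Nat.land (Nat.shiftRight m 7) 3,
   Nat.land (Nat.shiftRight m 9) 31, Nat.land (Nat.shiftRight m 14) 3, Nat.shiftRight m 16⟩

def valid (FA FB pA pB T : Nat) (m : Mv) : Bool :=
  present T m.c0 && (present T m.c1 && (!(Nat.beq m.c0 m.c1) &&
  (Nat.ble m.s 2 && (Nat.ble m.t 2 && (Nat.ble m.z 2 && 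
  (!(Nat.beq m.t m.z) && 
  (tb (sup pA pB m.c0) m.s && (!(tb (sup pA pB m.c0) m.t) &&
  ((bif isz m.c0 then tb FA m.t else bif Nat.beq m.c0 1 then tb FB m.t
    else Nat.beq (Nat.mod m.c0 3) m.t) &&
  (tb (sup pA pB m.c1) m.t && (tb (sup pA pB m.c1) m.z &&
  (Nat.beq m.z m.s ||
    (present T m.c2 && (!(Nat.beq m.c0 m.c2) && (!(Nat.beq m.c1 m.c2) &&
     (tb (sup pA pB m.c2) m.z && tb (sup pA pB m.c2) m.s))))))))))))))))

/-- is the outcome fine: it is infeasible, or the deleted edge is unprotected and the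
new state is good -/
def okOut (tab : Tr) (FA FB MA MB : Nat) (pr : Bool) (pA pB T : Nat) : Bool :=
  infeas FA FB pA pB T || (!pr && good tab FA FB pA pB MA MB T)

/-- mover `c` gets support `S`: both options for `T` -/
def okMover (tab : Tr) (FA FB pA pB MA MB T : Nat) (pr : Bool) (c S : Nat) (sg : Bool) : Bool :=
  okOut tab FA FB MA MB pr (setA pA c S) (setB pB c S) (setT T c S false) &&
  (!sg || okOut tab FA FB MA MB pr (setA pA c S) (setB pB c S) (setT T c S true))

/-- compensating node `c` loses `x` and mover `c0` gets support `S` -/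
def okComp (tab : Tr) (FA FB pA pB MA MB T c x : Nat) (c0 S : Nat) (sg : Bool) : Bool :=
  okMover tab FA FB (setA pA c (Nat.xor (sup pA pB c) (Nat.pow 2 x)))
    (setB pB c (Nat.xor (sup pA pB c) (Nat.pow 2 x))) MA MB
    (setT T c (Nat.xor (sup pA pB c) (Nat.pow 2 x)) false) (prot MA MB c x) c0 S sg

def okAll (tab : Tr) (FA FB pA pB MA MB T : Nat) (m : Mv) : Bool :=
  okMover tab FA FB pA pB MA MB T (prot MA MB m.c0 m.s) m.c0
    (Nat.xor (Nat.lor (sup pA pB m.c0) (Nat.pow 2 m.t)) (Nat.pow 2 m.s))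
    (single (sup pA pB m.c0)) &&
  (okComp tab FA FB pA pB MA MB T m.c1 m.t m.c0
    (Nat.lor (sup pA pB m.c0) (Nat.pow 2 m.t)) (single (sup pA pB m.c0)) &&
  (Nat.beq m.z m.s || okComp tab FA FB pA pB MA MB T m.c2 m.z m.c0
    (Nat.lor (sup pA pB m.c0) (Nat.pow 2 m.t)) (single (sup pA pB m.c0))))

def memA (MA c t : Nat) : Nat := bif isz c then Nat.lor MA (Nat.pow 2 t) else MA
def memB (MB c t : Nat) : Nat := bif Nat.beq c 1 then Nat.lor MB (Nat.pow 2 t) else MB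

/-- the move `m` is fine in the given state -/
def okMove (tab : Tr) (FA FB pA pB MA MB T : Nat) (m : Mv) : Bool :=
  valid FA FB pA pB T m &&
  okAll tab FA FB pA pB (memA MA m.c0 m.t) (memB MB m.c0 m.t) T m

def okEntry (tab : Tr) (FA FB k v : Nat) : Bool :=
  okMove tab FA FB (Nat.land k 7) (Nat.land (Nat.shiftRight k 3) 7)
    (Nat.land (Nat.shiftRight k 6) 7) (Nat.land (Nat.shiftRight k 9) 7)
    (Nat.shiftRight k 12) (decMv v)

def okTab (tab : Tr) (FA FB : Nat) : Tr → Bool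
  | e => true
  | n l k v r => okEntry tab FA FB k v && (okTab tab FA FB l && okTab tab FA FB r)

/-! The states without memory. -/

/-- a valid move of an other node that decreases no protected edge -/
def safeMv (FA FB pA pB T : Nat) (m : Mv) : Bool :=
  !(Nat.ble m.c0 1) && (valid FA FB pA pB T m && (!(prot 0 0 m.c1 m.t) &&
    (Nat.beq m.z m.s || !(prot 0 0 m.c2 m.z))))

def third (s t : Nat) : Nat := Nat.sub 3 (Nat.add s t)

def mixedCodes : List Nat := [9, 10, 11, 15, 16, 17, 18, 19, 20, 21, 22, 23]
def leafCodes : List Nat := [4, 5, 6, 8, 12, 13]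

/-- search for a safe move of node `c` along `s → t`, using compensators from `cs` -/
def safeST (FA FB pA pB T : Nat) (cs : List Nat) (c s t : Nat) : Bool :=
  cs.any (fun c1 => safeMv FA FB pA pB T ⟨c, s, t, c1, s, 0⟩ ||
    (tb (sup pA pB c1) t && cs.any (fun c2 =>
      safeMv FA FB pA pB T ⟨c, s, t, c1, third s t, c2⟩)))

/-- search for a safe move of node `c` -/
def safeC (FA FB pA pB T : Nat) (cs : List Nat) (c : Nat) : Bool :=
  [0, 1, 2].any (fun s => tb (Nat.div c 3) s && safeST FA FB pA pB T cs c s (Nat.mod c 3))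

def treeW (tab : Tr) (FA FB pA pB T0 : Nat) (cs : List Nat) : List Nat → Nat → Bool
  | [], T => infeas FA FB pA pB T || (final FA FB pA pB T || (look tab (key pA pB 0 0 T)).isSome)
  | d :: ds, T =>
    (safeC FA FB pA pB (Nat.lor T (Nat.pow 2 d)) cs d ||
      treeW tab FA FB pA pB T0 cs ds (Nat.lor T (Nat.pow 2 d))) &&
    treeW tab FA FB pA pB T0 cs ds T

def mulI (S : Nat) : Bool := Nat.beq S 3 || (Nat.beq S 5 || (Nat.beq S 6 || Nat.beq S 7))

/-- two different nodes cannot share two supplies -/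
def confl (S S' : Nat) : Bool := mulI (Nat.land S S')

def exc (S : Nat) : Nat := Nat.sub (Nat.add (bif tb S 0 then 1 else 0)
  (Nat.add (bif tb S 1 then 1 else 0) (bif tb S 2 then 1 else 0))) 1

def sumExc : List Nat → Nat
  | [] => 0
  | c :: cs => Nat.add (exc (Nat.div c 3)) (sumExc cs)

/-- `cs` is the list of codes of mixed other nodes chosen so far -/
def treeX (tab : Tr) (FA FB pA pB : Nat) : List Nat → List Nat → Nat → Bool
  | [], cs, T =>
    !(Nat.beq (Nat.add (Nat.add (exc pA) (exc pB)) (sumExc cs)) 2) ||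
    (cs.any (safeC FA FB pA pB T (0 :: 1 :: cs)) ||
    treeW tab FA FB pA pB T (0 :: 1 :: cs) leafCodes T)
  | d :: ds, cs, T =>
    (confl pA (Nat.div d 3) || (confl pB (Nat.div d 3) ||
      (cs.any (fun c => confl (Nat.div c 3) (Nat.div d 3)) ||
       treeX tab FA FB pA pB ds (d :: cs) (Nat.lor T (Nat.pow 2 d))))) &&
    treeX tab FA FB pA pB ds cs T

def okZero (tab : Tr) (FA FB : Nat) : Bool :=
  [1, 2, 3, 4, 5, 6, 7].all (fun pA => [1, 2, 3, 4, 5, 6, 7].all (fun pB =>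
    confl pA pB || treeX tab FA FB pA pB mixedCodes [] 0))


def tabL0000 : Tr :=
  (n (n (n (n (n (n (n (n e 15 257 e) 23 16673 e) 29 257 (n e 30 16928 e)) 43 129 (n (n e 46 33344
    e) 53 33472 (n e 58 16928 e))) 60 33344 (n (n (n (n e 79 257 e) 87 16673 e) 93 257 (n e 107 129
    e)) 117 33472 (n (n e 143 257 e) 151 16673 (n e 158 16673 e)))) 207 257 (n (n (n (n (n e 215
    16673 e) 1054 16928 e) 1082 16928 (n e 1111 16673 e)) 1117 257 (n (n e 1141 33472 e) 1239 16673
    (n e 2091 129 e))) 2094 33344 (n (n (n (n e 2101 33472 e) 2106 16928 e) 2108 33344 (n e 2155 129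
    e)) 2165 33472 (n (n e 2219 129 e) 2222 33344 (n e 2234 16928 e))))) 2283 129 (n (n (n (n (n (n
    e 3130 16928 e) 3132 33344 e) 3189 33472 (n e 3258 16928 e)) 65615 132 (n (n e 65623 16673 e)
    65643 132 (n e 65651 132 e))) 65653 33412 (n (n (n (n e 65743 132 e) 65751 16673 e) 66675 132 (n
    e 67637 33412 e)) 67691 132 (n (n e 67699 132 e) 67701 33412 (n e 67763 132 e)))) 67827 132 (n
    (n (n (n (n e 131151 261 e) 131159 261 e) 131165 261 (n e 131175 261 e)) 131187 17157 (n (n e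
    131189 261 e) 131230 16673 (n e 131279 261 e))) 131287 261 (n (n (n e 131303 261 e) 132147 17157
    (n e 132211 17157 e)) 132275 17157 (n (n e 132339 17157 e) 133237 261 (n e 133291 773 e))))))
    133294 33344 (n (n (n (n (n (n (n e 133306 773 e) 133351 261 e) 133355 773 (n e 134323 17157 e))
    134330 773 (n (n e 134387 17157 e) 196687 132 (n e 196695 261 e))) 196711 132 (n (n (n (n e
    196723 132 e) 196725 33412 e) 197747 132 (n e 198773 261 e)) 262287 257 (n (n e 262295 16422 e)
    262323 16422 (n e 262359 16422 e)))) 263198 16934 (n (n (n (n (n e 263225 16934 e) 263226 16934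
    e) 263261 257 (n e 263283 16422 e)) 263285 33472 (n (n e 263289 16934 e) 263347 16422 (n e
    263383 16422 e))) 263411 16422 (n (n (n e 264238 33344 e) 264299 129 (n e 264307 16422 e))
    264363 16422 (n (n e 264366 33318 e) 264371 16422 (n e 264435 16422 e))))) 265273 16934 (n (n (n
    (n (n (n e 265331 16422 e) 265333 33472 e) 265337 16934 (n e 265395 16422 e)) 265402 16934 (n (n
    e 265459 16422 e) 328797 257 (n e 328819 132 e))) 328821 33412 (n (n (n (n e 329835 129 e)
    329843 132 e) 329907 16422 (n e 330867 132 e)) 330869 33412 (n (n e 330873 16934 e) 393431 261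
    (n e 394355 17157 e)))) 459891 17157 (n (n (n (n (n e 1048669 257 e) 1048719 16680 e) 1048727
    16680 (n e 1048734 16680 e)) 1048743 16680 (n (n e 1048791 16673 e) 1048807 16680 (n e 1049651
    17192 e))) 1049658 17192 (n (n (n e 1049660 33344 e) 1049693 65832 (n e 1049715 17192 e))
    1049717 17192 (n (n e 1049779 17192 e) 1049815 16680 (n e 1049843 17192 e)))))))

def tabL0001 : Tr :=
  (n (n (n (n (n (n (n (n e 1050795 129 e) 1050803 17192 e) 1050855 16680 (n e 1050867 17192 e))
    1051706 17192 (n (n e 1051827 17192 e) 1051834 17192 (n e 1051891 17192 e))) 1114319 16680 (n (n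
    (n (n e 1114327 16680 e) 1179741 261 e) 1179806 16680 (n e 1180723 17157 e)) 1180787 17192 (n (n
    e 1180851 17157 e) 1181867 773 (n e 1182899 17157 e)))) 1310863 16680 (n (n (n (n (n e 1310871
    16422 e) 1310887 16422 e) 1310935 16422 (n e 1310951 16422 e)) 1311801 17192 (n (n e 1311802
    16934 e) 1311804 16934 (n e 1311837 65832 e))) 1311865 17192 (n (n (n (n e 1311959 16422 e)
    1312999 16422 e) 1313849 17192 (n e 1313850 16934 e)) 1313913 17192 (n (n e 1377373 65832 e)
    1377397 17192 (n e 2097165 4736 e))))) 2097166 4737 (n (n (n (n (n (n e 2097173 4736 e) 2097193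
    4737 e) 2097194 4737 (n e 2097196 33344 e)) 2097201 4736 (n (n e 2097237 4736 e) 2097257 4737 (n
    e 2097294 606465 e))) 2098225 4736 (n (n (n (n e 2098289 4736 e) 2099241 4736 e) 2099305 4737 (n
    e 2099313 4736 e)) 2099370 4737 (n (n e 2100273 4736 e) 2100337 4736 (n e 2162773 4740 e))))
    2163761 4740 (n (n (n (n (n e 2163825 4740 e) 2164777 4740 e) 2164841 4737 (n e 2164849 4740 e))
    2164914 4740 (n (n e 2165873 4740 e) 2228366 606469 (n e 2228374 606469 e))) 2228390 606469 (n
    (n (n e 2229297 606981 e) 2229298 606981 (n e 2229361 606981 e)) 2229426 606981 (n (n e 2294833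
    606981 e) 2294897 606981 (n e 2359309 4736 e)))))) 2359310 4737 (n (n (n (n (n (n (n e 2359317
    4736 e) 2359337 4737 e) 2359338 4737 (n e 2359340 33344 e)) 2359345 4736 (n (n e 2359381 4736 e)
    2359401 4737 (n e 2359438 606465 e))) 2360369 4736 (n (n (n (n e 2360433 4736 e) 2361385 4736 e)
    2361449 4737 (n e 2361457 4736 e)) 2361514 4737 (n (n e 2362417 4736 e) 2362481 4736 (n e
    2424917 4740 e)))) 2425905 4740 (n (n (n (n (n e 2425969 4740 e) 2426921 4740 e) 2426985 4737 (n
    e 2426993 4740 e)) 2427058 4740 (n (n e 2428017 4740 e) 2490510 606469 (n e 2490518 606469 e)))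
    2490534 606469 (n (n (n e 2491441 606981 e) 2491442 606981 (n e 2491505 606981 e)) 2491570
    606981 (n (n e 2556977 606981 e) 2557041 606981 (n e 3145741 4736 e))))) 3145749 4736 (n (n (n
    (n (n (n e 3145765 4736 e) 3145769 4737 e) 3145770 4737 (n e 3145772 4737 e)) 3145805 4737 (n (n
    e 3145813 4736 e) 3145829 4736 (n e 3145870 16680 e))) 3146801 17192 (n (n (n (n e 3146837 4736
    e) 3146865 17192 e) 3276877 261 (n e 3276885 261 e)) 3276901 261 (n (n e 3276942 16680 e)
    3276950 16680 (n e 3276966 16680 e)))) 3277874 606981 (n (n (n (n (n e 3277937 606981 e) 3278002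
    17192 e) 3407885 4736 (n e 3407893 4736 e)) 3407909 4736 (n (n e 3407913 4737 e) 3407914 4737 (n
    e 3407916 4737 e))) 3407949 4737 (n (n (n e 3407957 4736 e) 3407973 4736 (n e 3408014 16680 e))
    3408945 17192 (n (n e 3408981 4736 e) 3409009 17192 (n e 3539021 261 e)))))))

def tabL000 : Tr := n tabL0000 1050741 33472 tabL0001

def tabL0010 : Tr :=
  (n (n (n (n (n (n (n (n e 3539045 261 e) 3539086 16680 e) 3539094 16680 (n e 3539110 16680 e))
    3540017 606981 (n (n e 3540018 606981 e) 3540081 606981 (n e 3540146 17192 e))) 4194318 21536 (n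
    (n (n (n e 4194325 655649 e) 4194326 21536 e) 4194346 21536 (n e 4194354 21536 e)) 4194356 87104
    (n (n e 4194389 655649 e) 4196402 21536 (n e 4196404 87104 e)))) 4196530 21536 (n (n (n (n (n e
    4259854 21536 e) 4259861 655649 e) 4259862 21536 (n e 4259882 21536 e)) 4259890 21536 (n (n e
    4259892 87104 e) 4259925 655649 (n e 4261938 21536 e))) 4261940 87104 (n (n (n (n e 4262066
    21536 e) 4325390 21536 e) 4325398 21536 (n e 4325414 21536 e)) 4325426 21536 (n (n e 4325428
    87104 e) 4325461 261 (n e 4327476 87104 e))))) 4390926 21536 (n (n (n (n (n (n e 4390934 21536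
    e) 4390950 21536 e) 4390962 21536 (n e 4390964 87104 e)) 4390997 261 (n (n e 4393012 87104 e)
    4456533 21542 (n e 4457521 21542 e))) 4457557 655649 (n (n (n (n e 4457585 21542 e) 4458537
    21542 e) 4458546 21542 (n e 4458609 21542 e)) 4458674 21542 (n (n e 4459633 21542 e) 4522069
    21542 (n e 4523057 21542 e)))) 4523093 655649 (n (n (n (n (n e 4523121 21542 e) 4524073 21542 e)
    4524082 21536 (n e 4524145 21542 e)) 4524210 21542 (n (n e 4525169 21542 e) 5242957 655656 (n e
    5242965 655656 e))) 5242981 655656 (n (n (n e 5308493 655656 e) 5308501 655656 (n e 5308517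
    655656 e)) 5374029 655656 (n (n e 5374037 655656 e) 5374053 261 (n e 5439565 655656 e))))))
    5439573 655656 (n (n (n (n (n (n (n e 5439589 261 e) 5505109 655656 e) 5506133 655656 (n e
    5570645 655656 e)) 5571669 655656 (n (n e 8388685 267 e) 8388693 267 (n e 8388709 267 e)))
    8519757 267 (n (n (n (n e 8519765 267 e) 8519781 267 e) 9437261 267 (n e 9437269 267 e)) 9437285
    267 (n (n e 9568333 267 e) 9568341 267 (n e 9568357 267 e)))) 16777395 81996 (n (n (n (n (n e
    16777431 32844 e) 16778270 16928 e) 16778327 32844 (n e 16778333 257 e)) 16779307 33356 (n (n e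
    16779310 33356 e) 16779315 81996 (n e 16779321 33356 e))) 16779322 16928 (n (n (n e 16779324
    33356 e) 16779379 81996 (n e 16779381 32844 e)) 16779385 33356 (n (n e 16779435 33356 e)
    16779443 81996 (n e 16779507 81996 e))))) 16780346 33356 (n (n (n (n (n (n e 16780348 33344 e)
    16780403 81996 e) 16780405 32844 (n e 16780409 33356 e)) 16780474 33356 (n (n e 16780531 81996
    e) 16844979 81996 (n e 16908503 261 e))) 16908519 261 (n (n (n (n e 16910453 261 e) 16910507
    33356 e) 16910510 33356 (n e 16911481 33356 e)) 16911546 33356 (n (n e 16975989 33412 e)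
    17039539 16422 (n e 17040414 16934 e)))) 17041454 33356 (n (n (n (n (n e 17041587 16422 e)
    17107123 81996 e) 17172654 33318 (n e 17173690 16934 e)) 17828011 33356 (n (n e 17829050 33356
    e) 17959083 33356 (n e 18874382 4737 e))) 18874417 4736 (n (n (n e 18876457 33356 e) 19005582
    606465 (n e 19005590 606469 e)) 19005606 606469 (n (n e 19006514 606981 e) 19006642 606981 (n e
    19007654 606469 e)))))))

def tabL0011 : Tr :=
  (n (n (n (n (n (n (n (n e 19008690 606981 e) 19136526 4737 e) 19136561 4736 (n e 19138601 33356
    e)) 19267726 606465 (n (n e 19267734 606469 e) 19267750 606469 (n e 19268658 606981 e)))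
    19268786 606981 (n (n (n (n e 19269798 606469 e) 19269802 4737 e) 19270834 606981 (n e 20054158
    16680 e)) 20054166 16680 (n (n e 20054182 16680 e) 20055090 17192 (n e 20055218 17192 e))))
    20316302 16680 (n (n (n (n (n e 20316310 16680 e) 20316326 16680 e) 20317234 17192 (n e 20317362
    17192 e)) 20973617 87116 (n (n e 20973618 87116 e) 20973620 33472 (n e 20973681 87116 e)))
    20973746 87116 (n (n (n (n e 21039153 87116 e) 21039154 87116 e) 21039156 33472 (n e 21039282
    87116 e)) 21104689 87116 (n (n e 21104692 87104 e) 21104753 87116 (n e 21170225 87116 e)))))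
    21170228 87104 (n (n (n (n (n (n e 21170289 87116 e) 21235762 87116 e) 21235890 87116 (n e
    21301298 87116 e)) 21301426 87116 (n (n e 33554539 65741 e) 33556523 65741 (n e 33556531 33485
    e))) 33556533 33485 (n (n (n (n e 33556538 16928 e) 33556540 33485 e) 33556587 65741 (n e
    33556595 33485 e)) 33556597 33485 (n (n e 33556659 33485 e) 33557564 33485 (n e 33557619 33485
    e)))) 33557690 16928 (n (n (n (n (n e 33557747 33485 e) 33620075 132 e) 33622069 33412 (n e
    33622123 132 e)) 33622133 33485 (n (n e 33818731 65741 e) 33884267 65741 (n e 34605173 33485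
    e))) 34605227 65741 (n (n (n e 34605235 33485 e) 34670709 33412 (n e 35653673 70349 e)) 35653737
    70349 (n (n e 35719209 70349 e) 35719273 70349 (n e 35915817 70349 e)))))) 35915881 70349 (n (n
    (n (n (n (n (n e 35981353 70349 e) 35981417 70349 e) 37748757 655649 (n e 37748778 21536 e))
    37748821 655649 (n (n e 37750836 87104 e) 37814293 655649 (n e 37814314 21536 e))) 37814357
    655649 (n (n (n (n e 37816370 33485 e) 37816372 87104 e) 37879893 261 (n e 37881908 33485 e))
    37945429 261 (n (n e 37947444 33485 e) 38797389 257 (n e 38797397 655649 e)))) 38797413 655656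
    (n (n (n (n (n e 38799461 655656 e) 38862925 257 e) 38862933 655649 (n e 38862949 655656 e))
    38864997 655656 (n (n e 38928461 261 e) 38928469 261 (n e 38928485 261 e))) 38993997 261 (n (n
    (n e 38994005 261 e) 38994021 261 (n e 50333739 33356 e)) 50333747 81996 (n (n e 50333753 33485
    e) 50333754 16928 (n e 50333756 33356 e))))) 50333811 81996 (n (n (n (n (n (n e 50333817 33485
    e) 50333875 33485 e) 50334780 33485 (n e 50334835 81996 e)) 50334841 33485 (n (n e 50334906
    33356 e) 50334963 81996 (n e 50465913 33485 e))) 51382443 33356 (n (n (n (n e 51382451 81996 e)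
    52430889 33356 e) 52693033 33356 (n e 54528049 87116 e)) 54528052 87116 (n (n e 54528113 33485
    e) 54593585 87116 (n e 54593586 33485 e)))) 54593588 87116 (n (n (n (n (n e 54659121 33485 e)
    54659124 33485 e) 54659185 33485 (n e 54724657 33485 e)) 54724660 33485 (n (n e 54724721 33485
    e) 134217739 7937 (n e 134217742 7937 e))) 134217747 7969 (n (n (n e 134217753 7937 e) 134217754
    7937 (n e 134217756 7937 e)) 134217777 1016448 (n (n e 134217803 7937 e) 134217811 7969 (n e
    134217867 7937 e)))))))

def tabL001 : Tr := n tabL0010 19007658 4737 tabL0011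

def tabL00 : Tr := n tabL000 3539029 261 tabL001

def tabL0100 : Tr :=
  (n (n (n (n (n (n (n (n e 134217939 7969 e) 134218778 7937 e) 134218780 7937 (n e 134218835 7969
    e)) 134218906 7937 (n (n e 134219825 1016448 e) 134219889 1016448 (n e 134220913 1016448 e)))
    134283339 7937 (n (n (n (n e 134285361 1016452 e) 134285362 1016452 e) 134285364 33472 (n e
    134285490 1016452 e)) 134348883 7941 (n (n e 134348899 7941 e) 134348939 7937 (n e 134348947
    7941 e)))) 134348963 7941 (n (n (n (n (n e 134349011 7941 e) 134349027 7941 e) 134349850 7941 (n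
    e 134349874 7941 e)) 134349907 7941 (n (n e 134349978 7937 e) 134350002 7941 (n e 134350897 7941
    e))) 134350961 7941 (n (n (n (n e 134351011 7941 e) 134351014 7941 e) 134351985 7941 (n e
    134352050 7941 e)) 134416433 1016452 (n (n e 134416497 1016452 e) 134479886 7937 (n e 134479921
    1016448 e))))) 134480019 16422 (n (n (n (n (n (n e 134480922 16934 e) 134480924 16934 e)
    134481969 1016448 (n e 134547505 1016448 e)) 134547506 1016452 (n (n e 134547508 33472 e)
    134547634 1016452 (n e 135266443 7937 e))) 135266451 7976 (n (n (n (n e 135266467 7976 e)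
    135267354 73512 e) 135267356 73512 (n e 135267482 7937 e)) 135268515 7976 (n (n e 135397515 7937
    e) 135397523 7941 (n e 135397539 7941 e)))) 135398426 73512 (n (n (n (n (n e 135398554 73512 e)
    135398578 17192 e) 135399587 7941 (n e 135528587 16422 e)) 135528595 16422 (n (n e 135528611
    16422 e) 135529498 16934 (n e 135529500 16934 e))) 135529626 16934 (n (n (n e 135530659 16422 e)
    136314889 7937 (n e 136314890 4737 e)) 136314892 4737 (n (n e 136314897 4736 e) 136577033 7937
    (n e 136577034 4737 e)))))) 136577036 4737 (n (n (n (n (n (n (n e 136577041 4736 e) 137363465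
    4736 e) 137363466 4737 (n e 137363468 4737 e)) 137363473 4736 (n (n e 137363489 4736 e)
    137363594 4737 (n e 137625609 4736 e))) 137625610 4737 (n (n (n (n e 137625612 4737 e) 137625617
    4736 e) 137625633 4736 (n e 137625738 4737 e)) 138412042 21536 (n (n e 138412049 663329 e)
    138412050 663329 (n e 138412052 663329 e)))) 138477578 21536 (n (n (n (n (n e 138477585 663329
    e) 138477586 663329 e) 138477588 663329 (n e 150994955 7937 e)) 150994958 7937 (n (n e 150994963
    7969 e) 150994969 7937 (n e 150994970 7937 e))) 150994972 7937 (n (n (n e 150994993 1016448 e)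
    150995019 129 (n e 150995027 7969 e)) 150995083 7937 (n (n e 150995091 7969 e) 150995155 7969 (n
    e 150995994 7937 e))))) 150995996 7937 (n (n (n (n (n (n e 150996051 7969 e) 150996057 7937 e)
    150996122 7937 (n e 150997041 1016448 e)) 150997105 1016448 (n (n e 150998129 1016448 e)
    151060555 132 (n e 151062577 1016448 e))) 151062578 1016452 (n (n (n (n e 151062580 33472 e)
    151062706 1016452 e) 151126099 7941 (n e 151126115 7941 e)) 151126155 7937 (n (n e 151126163
    7941 e) 151126179 7941 (n e 151126227 7941 e)))) 151126243 7941 (n (n (n (n (n e 151127066 16928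
    e) 151127090 7941 e) 151127123 7941 (n e 151127129 7937 e)) 151127194 7937 (n (n e 151127218
    7941 e) 151128113 7941 (n e 151128177 7941 e))) 151128227 7941 (n (n (n e 151128230 7941 e)
    151129201 7941 (n e 151129266 7941 e)) 151193649 1016452 (n (n e 151193713 1016452 e) 151257102
    7937 (n e 151257137 1016448 e)))))))

def tabL0101 : Tr :=
  (n (n (n (n (n (n (n (n e 151258138 16934 e) 151258140 16934 e) 151259185 1016448 (n e 151324721
    1016448 e)) 151324722 1016452 (n (n e 151324724 33472 e) 151324850 1016452 (n e 152043659 7937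
    e))) 152043667 7976 (n (n (n (n e 152043683 7976 e) 152044570 73512 e) 152044572 73512 (n e
    152044698 7937 e)) 152045731 7976 (n (n e 152174731 7937 e) 152174739 7941 (n e 152174755 7941
    e)))) 152175642 73512 (n (n (n (n (n e 152175770 73512 e) 152175794 17192 e) 152176803 7941 (n e
    152305803 16422 e)) 152305811 16422 (n (n e 152305827 16422 e) 152306714 16934 (n e 152306716
    16934 e))) 152306842 16934 (n (n (n (n e 152307875 16422 e) 153092105 7937 e) 153092106 4737 (n
    e 153092108 4737 e)) 153092113 4736 (n (n e 153354249 7937 e) 153354250 4737 (n e 153354252 4737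
    e))))) 153354257 4736 (n (n (n (n (n (n e 154140681 4736 e) 154140682 4737 e) 154140684 4737 (n
    e 154140689 4736 e)) 154140705 4736 (n (n e 154140810 4737 e) 154402825 4736 (n e 154402826 4737
    e))) 154402828 4737 (n (n (n (n e 154402833 4736 e) 154402849 4736 e) 154402954 4737 (n e
    155189258 21536 e)) 155189265 663329 (n (n e 155189266 663329 e) 155189268 663329 (n e 155254794
    21536 e)))) 155254801 663329 (n (n (n (n (n e 155254802 663329 e) 155254804 663329 e) 167772171
    7937 (n e 167772179 7969 e)) 167772185 7937 (n (n e 167772186 7937 e) 167772188 7937 (n e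
    167772235 7937 e))) 167772243 7969 (n (n (n e 167772307 7969 e) 167773210 16928 (n e 167773212
    7937 e)) 167773267 7969 (n (n e 167773273 7937 e) 167773338 7937 (n e 167773395 7969 e))))))
    167774257 33485 (n (n (n (n (n (n (n e 167774321 33485 e) 167775345 33485 e) 167837771 7937 (n e
    167839793 1016452 e)) 167839794 33485 (n (n e 167839796 33485 e) 167903315 7941 (n e 167903331
    7941 e))) 167904339 7941 (n (n (n (n e 168034451 16422 e) 168035354 16934 e) 168035356 16934 (n
    e 168036401 33485 e)) 168101937 33485 (n (n e 168101938 33485 e) 168101940 33485 (n e 168820875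
    7937 e)))) 168820883 7969 (n (n (n (n (n e 168820899 7976 e) 168821786 16928 e) 168821788 73512
    (n e 168821843 7976 e)) 168821849 73512 (n (n e 168821914 73512 e) 168821971 7976 (n e 168822947
    7976 e))) 169083019 16422 (n (n (n e 169083027 16422 e) 169083043 16422 (n e 169083930 16934 e))
    169083932 16934 (n (n e 169084058 16934 e) 169869321 7937 (n e 169869322 4737 e))))) 169869324
    4737 (n (n (n (n (n (n e 169869329 4736 e) 170131465 7937 e) 170131466 4737 (n e 170131468 4737
    e)) 170131473 4736 (n (n e 170917897 4736 e) 170917898 4737 (n e 170917900 4737 e))) 170917905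
    4736 (n (n (n (n e 170917921 4736 e) 170918026 4737 e) 171180041 4736 (n e 171180042 4737 e))
    171180044 4737 (n (n e 171180049 4736 e) 171180065 4736 (n e 171180170 4737 e)))) 171966474
    21536 (n (n (n (n (n e 171966481 663329 e) 171966482 21536 e) 171966484 663329 (n e 171966545
    663329 e)) 172032010 21536 (n (n e 172032017 663329 e) 172032018 663329 (n e 172032020 663329
    e))) 184549387 7937 (n (n (n e 184549395 7969 e) 184549401 7937 (n e 184549402 7937 e))
    184549404 7937 (n (n e 184549451 129 e) 184549459 7969 (n e 184549523 7969 e)))))))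

def tabL010 : Tr := n tabL0100 151257235 16422 tabL0101

def tabL0110 : Tr :=
  (n (n (n (n (n (n (n (n e 184550428 7937 e) 184550483 7969 e) 184550489 7937 (n e 184550554 7937
    e)) 184550611 7969 (n (n e 184551473 33485 e) 184551537 33485 (n e 184552561 33485 e)))
    184614987 132 (n (n (n (n e 184617009 33485 e) 184617010 33485 e) 184617012 33485 (n e 184680531
    7941 e)) 184680547 7941 (n (n e 184681555 7941 e) 184811667 16422 (n e 184812570 16934 e))))
    184812572 16934 (n (n (n (n (n e 184813617 33485 e) 184879153 33485 e) 184879154 33485 (n e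
    184879156 33485 e)) 185598091 7937 (n (n e 185598099 7969 e) 185598115 7976 (n e 185599002 16928
    e))) 185599004 73512 (n (n (n (n e 185599059 7976 e) 185599065 73512 e) 185599130 73512 (n e
    185599187 7976 e)) 185600163 7976 (n (n e 185860235 16422 e) 185860243 16422 (n e 185860259
    16422 e))))) 185861146 16934 (n (n (n (n (n (n e 185861148 16934 e) 185861274 16934 e) 186646537
    7937 (n e 186646538 4737 e)) 186646540 4737 (n (n e 186646545 4736 e) 186908681 7937 (n e
    186908682 4737 e))) 186908684 4737 (n (n (n (n e 186908689 4736 e) 187695113 4736 e) 187695114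
    4737 (n e 187695116 4737 e)) 187695121 4736 (n (n e 187695137 4736 e) 187695242 4737 (n e
    187957257 4736 e)))) 187957258 4737 (n (n (n (n (n e 187957260 4737 e) 187957265 4736 e)
    187957281 4736 (n e 187957386 4737 e)) 188743690 21536 (n (n e 188743697 663329 e) 188743698
    21536 (n e 188743700 663329 e))) 188743761 663329 (n (n (n e 188809226 21536 e) 188809233 663329
    (n e 188809234 663329 e)) 188809236 663329 (n (n e 268435531 144 e) 268435539 144 (n e 268501067
    144 e)))))) 268501075 144 (n (n (n (n (n (n (n e 272629770 21536 e) 272629778 21536 e) 272629780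
    41024 (n e 272695306 21536 e)) 272695314 21536 (n (n e 272695316 41024 e) 301989963 144 (n e
    301989971 144 e))) 302055499 144 (n (n (n (n e 302055507 144 e) 306184202 21536 e) 306184210
    21536 (n e 306184212 41024 e)) 306249738 21536 (n (n e 306249746 21536 e) 306249748 41024 (n e
    536870926 41536 e)))) 536870934 41536 (n (n (n (n (n e 536870940 41536 e) 536870947 1114305 e)
    536870950 41536 (n e 536870962 107040 e)) 536870964 41536 (n (n e 536871011 1114305 e) 536871054
    41536 (n e 536871062 41536 e))) 536871075 1114305 (n (n (n e 536871078 41536 e) 536871139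
    1114305 (n e 536871986 107040 e)) 536872114 107040 (n (n e 536873123 1114305 e) 536873126 41536
    (n e 536873187 1114305 e))))) 536874162 107040 (n (n (n (n (n (n e 536936462 41536 e) 536936470
    41536 e) 536936486 41536 (n e 536936498 107040 e)) 536936500 41536 (n (n e 536936547 132 e)
    536937522 107040 (n e 537001998 41536 e))) 537002006 41536 (n (n (n (n e 537002012 41536 e)
    537002019 1114305 e) 537002022 41536 (n e 537002034 107040 e)) 537002036 41536 (n (n e 537002083
    1114305 e) 537002126 41536 (n e 537002134 41536 e)))) 537002147 1114305 (n (n (n (n (n e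
    537002150 41536 e) 537002211 1114305 e) 537003058 107040 (n e 537003186 107040 e)) 537004195
    1114305 (n (n e 537004198 41536 e) 537004259 1114305 (n e 537005234 107040 e))) 537067534 41536
    (n (n (n e 537067542 41536 e) 537067558 41536 (n e 537067570 107040 e)) 537067572 41536 (n (n e
    537067619 132 e) 537068594 107040 (n e 537133198 41510 e)))))))

def tabL0111 : Tr :=
  (n (n (n (n (n (n (n (n e 537133222 41510 e) 537134129 107046 e) 537134130 107040 (n e 537134193
    107046 e)) 537134258 107046 (n (n e 537199665 107046 e) 537199666 107040 (n e 537199729 107046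
    e))) 537264270 41510 (n (n (n (n e 537264278 41536 e) 537264294 41510 e) 537265201 107046 (n e
    537265202 107040 e)) 537265265 107046 (n (n e 537265330 107046 e) 537330737 107046 (n e
    537330738 107040 e)))) 537330801 107046 (n (n (n (n (n e 537919516 41536 e) 537919523 1114305 e)
    537919587 1114305 (n e 537919651 1114305 e)) 537920562 107040 (n (n e 537921699 1114305 e)
    537985123 132 (n e 537986098 17192 e))) 538050588 41536 (n (n (n e 538050595 1114305 e)
    538050659 1114305 (n e 538050723 1114305 e)) 538051634 107040 (n (n e 538051762 17192 e)
    538052771 1114305 (n e 538116195 132 e))))) 538117170 17192 (n (n (n (n (n (n e 538182705 107046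
    e) 538182706 107046 e) 538182769 17192 (n e 538248241 17192 e)) 538248242 17192 (n (n e
    538248305 17192 e) 538313777 17192 (n e 538313778 17192 e))) 538313841 17192 (n (n (n (n e
    538379313 17192 e) 538379314 17192 e) 538379377 17192 (n e 538968076 1118912 e)) 538968084 41536
    (n (n e 538968097 4736 e) 538968098 1118913 (n e 538968100 1118912 e)))) 538968226 1118913 (n (n
    (n (n (n e 539099148 1118912 e) 539099156 1118912 e) 539099169 4736 (n e 539099170 1118913 e))
    539099172 1118912 (n (n e 539099298 1118913 e) 539230220 1118912 (n e 539230228 41536 e)))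
    539230241 1118913 (n (n (n e 539230242 1118913 e) 539230244 1118912 (n e 539230370 1118913 e))
    539361292 1118912 (n (n e 539361300 1118912 e) 539361313 1118913 (n e 539361314 1118913 e))))))
    539361316 1118912 (n (n (n (n (n (n (n e 539361442 1118913 e) 540016652 41536 e) 540016660 41536
    (n e 540016673 1118913 e)) 540016674 1118913 (n (n e 540016676 41536 e) 540016737 1118913 (n e
    540147724 41536 e))) 540147732 41536 (n (n (n (n e 540147745 4736 e) 540147746 1118913 e)
    540147748 41536 (n e 540147809 1118913 e)) 540147874 1118913 (n (n e 540278796 41536 e)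
    540278804 41536 (n e 540278817 1118913 e)))) 540278818 1118913 (n (n (n (n (n e 540278820 41536
    e) 540278881 1118913 e) 540409868 41536 (n e 540409876 41536 e)) 540409889 1118913 (n (n e
    540409890 1118913 e) 540409892 41536 (n e 540409953 1118913 e))) 541065236 41536 (n (n (n e
    541065250 21536 e) 541130772 41536 (n e 541130786 21536 e)) 541196308 41536 (n (n e 541196322
    21536 e) 541261844 41536 (n e 541261858 21536 e))))) 542113804 41536 (n (n (n (n (n (n e
    542113812 41536 e) 542113826 21536 e) 542113828 41536 (n e 542179340 41536 e)) 542179348 41536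
    (n (n e 542179362 21536 e) 542179364 41536 (n e 542244876 41536 e))) 542244884 41536 (n (n (n (n
    e 542244898 21536 e) 542244900 41536 e) 542310412 41536 (n e 542310420 41536 e)) 542310434 21536
    (n (n e 542310436 41536 e) 545259532 41536 (n e 545259540 41536 e)))) 545259554 22048 (n (n (n
    (n (n e 545259556 41536 e) 545390604 41536 e) 545390612 41536 (n e 545390626 22048 e)) 545390628
    41536 (n (n e 546308108 41536 e) 546308116 41536 (n e 546308130 22048 e))) 546308132 41536 (n (n
    (n e 546439180 41536 e) 546439188 41536 (n e 546439202 22048 e)) 546439204 41536 (n (n e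
    553648211 41548 e) 553648227 41548 (n e 553648275 41548 e)))))))

def tabL011 : Tr := n tabL0110 537133206 41536 tabL0111

def tabL01 : Tr := n tabL010 184550426 16928 tabL011

def tabL0 : Tr := n tabL00 134217875 7969 tabL01

def tabL1000 : Tr :=
  (n (n (n (n (n (n (n (n e 553648291 41548 e) 553648294 41536 e) 553648339 41548 (n e 553648355
    41548 e)) 553649202 41548 (n (n e 553649235 41548 e) 553649330 41548 (n e 553650225 41548 e)))
    553650289 41548 (n (n (n (n e 553650339 41548 e) 553650342 41548 e) 553651313 41548 (n e
    553651378 41548 e)) 553779283 41548 (n (n e 553779299 41548 e) 553779347 41548 (n e 553779350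
    41536 e)))) 553779363 41548 (n (n (n (n (n e 553779366 41536 e) 553779411 41548 e) 553779427
    41548 (n e 553780274 41548 e)) 553780307 41548 (n (n e 553780402 41548 e) 553781297 41548 (n e
    553781361 41548 e))) 553781411 41548 (n (n (n (n e 553781414 41548 e) 553782385 41548 e)
    553782450 41548 (n e 553910422 41510 e)) 553910438 41510 (n (n e 553911346 107046 e) 553911474
    107046 (n e 553912486 41510 e))))) 553913522 107046 (n (n (n (n (n (n e 554041494 41510 e)
    554041510 41510 e) 554042418 107046 (n e 554042546 107046 e)) 554043558 41510 (n (n e 554044594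
    107046 e) 554696851 41548 (n e 554696867 41548 e))) 554698915 41548 (n (n (n (n e 554827923
    41548 e) 554827939 41548 e) 554829987 41548 (n e 555745442 41548 e)) 555747490 1118913 (n (n e
    555876514 1118913 e) 555878562 1118913 (n e 556007586 1118913 e)))) 556009634 1118913 (n (n (n
    (n (n e 556138658 1118913 e) 556140706 1118913 e) 570425419 1114317 (n e 570425427 1114317 e))
    570425443 1114317 (n (n e 570426451 1114317 e) 570490955 1114317 (n e 570490963 132 e)))
    570490979 132 (n (n (n e 570556491 129 e) 570556499 1114317 (n e 570556515 1114317 e)) 570557523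
    1114317 (n (n e 570622027 132 e) 570622035 132 (n e 570622051 132 e)))))) 571473995 129 (n (n (n
    (n (n (n (n e 571474003 1114317 e) 571474019 1114317 e) 571475027 1114317 (n e 571539531 132 e))
    571539539 132 (n (n e 571539555 132 e) 571605067 129 (n e 571605075 1114317 e))) 571605091
    1114317 (n (n (n (n e 571606099 1114317 e) 571670603 132 e) 571670611 132 (n e 571670627 132 e))
    574619658 21536 (n (n e 574619666 21536 e) 574619668 41536 (n e 574619682 21536 e)))) 574685194
    21536 (n (n (n (n (n e 574685202 21536 e) 574685204 41536 e) 574685218 21536 (n e 574750730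
    21536 e)) 574750738 21536 (n (n e 574750740 41536 e) 574750754 21536 (n e 574816266 21536 e)))
    574816274 21536 (n (n (n e 574816276 41536 e) 574816290 21536 (n e 575668234 21536 e)) 575668236
    41536 (n (n e 575668242 21536 e) 575668244 41536 (n e 575668258 21536 e))))) 575668260 41536 (n
    (n (n (n (n (n e 575733770 21536 e) 575733772 41536 e) 575733778 21536 (n e 575733780 41536 e))
    575733794 21536 (n (n e 575733796 41536 e) 575799306 21536 (n e 575799308 41536 e))) 575799314
    21536 (n (n (n (n e 575799316 41536 e) 575799330 21536 e) 575799332 41536 (n e 575864842 21536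
    e)) 575864844 41536 (n (n e 575864850 21536 e) 575864852 41536 (n e 575864866 21536 e))))
    575864868 41536 (n (n (n (n (n e 587202643 41548 e) 587202659 41548 e) 587203667 41548 (n e
    587204721 33485 e)) 587205745 33485 (n (n e 587333715 41548 e) 587333731 41548 (n e 587334739
    41548 e))) 587335793 33485 (n (n (n e 587336817 33485 e) 1073741971 16434 (n e 1073742874 16946
    e)) 1073742876 16946 (n (n e 1073743913 33362 e) 1074004115 16434 (n e 1074005018 16946 e)))))))

def tabL1001 : Tr :=
  (n (n (n (n (n (n (n (n e 1074006057 33362 e) 1075838985 615681 e) 1075838986 4737 (n e 1075838988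
    4737 e)) 1075838993 4736 (n (n e 1076101129 615681 e) 1076101130 4737 (n e 1076101132 4737 e)))
    1076101137 4736 (n (n (n (n e 1090519187 16434 e) 1090520090 16946 e) 1090520092 16946 (n e
    1090521129 33362 e)) 1090781331 16434 (n (n e 1090782234 16946 e) 1090782236 16946 (n e
    1090783273 33362 e)))) 1092616201 615681 (n (n (n (n (n e 1092616202 4737 e) 1092616204 4737 e)
    1092616209 4736 (n e 1092878345 615681 e)) 1092878346 4737 (n (n e 1092878348 4737 e) 1092878353
    4736 (n e 1207959561 7937 e))) 1207959562 1025153 (n (n (n (n e 1207959564 1025153 e) 1207959569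
    25889 e) 1208221705 7937 (n e 1208221706 1025153 e)) 1208221708 1025153 (n (n e 1208221713 25889
    e) 1224736777 7937 (n e 1224736778 1025153 e))))) 1224736780 1025153 (n (n (n (n (n (n e
    1224736785 25889 e) 1224998921 7937 e) 1224998922 1025153 (n e 1224998924 1025153 e)) 1224998929
    25889 (n (n e 2147483659 26369 e) 2147483667 26401 (n e 2147483669 26401 e))) 2147483674 16928
    (n (n (n (n e 2147483676 26401 e) 2147483690 1278496 e) 2147483723 26369 (n e 2147483731 26401
    e)) 2147483733 26401 (n (n e 2147483795 26401 e) 2147484698 16928 (n e 2147484700 26401 e))))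
    2147484755 26401 (n (n (n (n (n e 2147484883 26401 e) 2147485738 1278496 e) 2147549205 26401 (n
    e 2147549226 1278496 e)) 2147549259 132 (n (n e 2147549267 132 e) 2147549269 26401 (n e
    2147551274 1278496 e))) 2147614795 26373 (n (n (n e 2147614803 26373 e) 2147614805 261 (n e
    2147614819 26373 e)) 2147615827 26373 (n (n e 2147680331 26373 e) 2147680339 132 (n e 2147680341
    261 e)))))) 2147680355 132 (n (n (n (n (n (n (n e 2147745939 26401 e) 2147746842 16934 e)
    2147746844 16934 (n e 2147747881 1278502 e)) 2147747882 1278496 (n (n e 2147747884 33344 e)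
    2147747945 1278502 (n e 2147813417 1278502 e))) 2147813418 1278496 (n (n (n (n e 2147813420
    33344 e) 2147813481 1278502 e) 2148532307 26408 (n e 2148532323 26408 e)) 2148532325 26408 (n (n
    e 2148532387 26408 e) 2148533276 26408 (n e 2148533331 26408 e)))) 2148533459 26408 (n (n (n (n
    (n e 2148534373 26408 e) 2148534435 26408 e) 2148663379 26373 (n e 2148663395 26373 e))
    2148664403 26373 (n (n e 2149580809 616193 e) 2149580810 4737 (n e 2149580812 4737 e)))
    2149580817 4736 (n (n (n e 2149842953 616193 e) 2149842954 4737 (n e 2149842956 4737 e))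
    2149842961 4736 (n (n e 2151677962 21536 e) 2151677970 21536 (n e 2151677972 26401 e)))))
    2151743498 21536 (n (n (n (n (n (n e 2151743506 21536 e) 2151743508 26401 e) 2151809034 21536 (n
    e 2151809042 21536 e)) 2151809044 26401 (n (n e 2151809058 21536 e) 2151874570 21536 (n e
    2151874578 21536 e))) 2151874580 26401 (n (n (n (n e 2151874594 21536 e) 2164260875 26369 e)
    2164260883 26401 (n e 2164260889 26401 e)) 2164260890 16928 (n (n e 2164260892 26401 e)
    2164260939 129 (n e 2164260947 26401 e)))) 2164260953 26401 (n (n (n (n (n e 2164261011 26401 e)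
    2164261914 16928 e) 2164261916 26401 (n e 2164261971 26401 e)) 2164261977 26401 (n (n e
    2164262954 33356 e) 2164326475 132 (n e 2164328490 33356 e))) 2164392011 129 (n (n (n e
    2164392019 26373 e) 2164392035 26373 (n e 2164393043 26373 e)) 2164393049 26401 (n (n e
    2164457547 132 e) 2164457555 132 (n e 2164457571 132 e)))))))

def tabL100 : Tr := n tabL1000 1074005020 16946 tabL1001

def tabL1010 : Tr :=
  (n (n (n (n (n (n (n (n e 2164524058 16934 e) 2164524060 16934 e) 2164525097 1278502 (n e
    2164525098 33356 e)) 2164525100 33356 (n (n e 2164590633 33356 e) 2164590634 33356 (n e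
    2164590636 33356 e))) 2166358025 616193 (n (n (n (n e 2166358026 4737 e) 2166358028 4737 e)
    2166358033 4736 (n e 2166620169 616193 e)) 2166620170 4737 (n (n e 2166620172 4737 e) 2166620177
    4736 (n e 2168455178 21536 e)))) 2168455185 26401 (n (n (n (n (n e 2168455186 26401 e)
    2168455188 26401 e) 2168520714 21536 (n e 2168520721 26401 e)) 2168520722 26401 (n (n e
    2168520724 26401 e) 2168586250 21536 (n e 2168586257 26401 e))) 2168586258 21536 (n (n (n (n e
    2168586260 26401 e) 2168586274 21536 e) 2168586321 26401 (n e 2168651786 21536 e)) 2168651793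
    26401 (n (n e 2168651794 21536 e) 2168651796 26401 (n e 2168651810 21536 e))))) 2168651857 26401
    (n (n (n (n (n (n e 2181038091 26369 e) 2181038099 26401 e) 2181038101 26401 (n e 2181038106
    16928 e)) 2181038108 26401 (n (n e 2181038122 1278496 e) 2181038155 129 (n e 2181038163 26401
    e))) 2181038165 26401 (n (n (n (n e 2181038227 26401 e) 2181039130 16928 e) 2181039132 26401 (n
    e 2181039187 26401 e)) 2181039315 26401 (n (n e 2181040170 1278496 e) 2181103637 26401 (n e
    2181103658 1278496 e)))) 2181103691 132 (n (n (n (n (n e 2181103699 132 e) 2181103701 26401 e)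
    2181105706 1278496 (n e 2181169227 129 e)) 2181169235 26373 (n (n e 2181169237 261 e) 2181169251
    26373 (n e 2181170259 26373 e))) 2181234763 132 (n (n (n e 2181234771 132 e) 2181234773 261 (n e
    2181234787 132 e)) 2181300371 16422 (n (n e 2181301274 16934 e) 2181301276 16934 (n e 2181302313
    1278502 e)))))) 2181302314 1278496 (n (n (n (n (n (n (n e 2181302316 33344 e) 2181302377 1278502
    e) 2181367849 1278502 (n e 2181367850 1278496 e)) 2181367852 33344 (n (n e 2181367913 1278502 e)
    2182086739 26408 (n e 2182086755 26408 e))) 2182086757 26408 (n (n (n (n e 2182086819 26408 e)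
    2182087708 26408 e) 2182087763 26408 (n e 2182087891 26408 e)) 2182088805 26408 (n (n e
    2182088867 26408 e) 2182217811 26373 (n e 2182217827 26373 e)))) 2182218835 26373 (n (n (n (n (n
    e 2183135241 616193 e) 2183135242 4737 e) 2183135244 4737 (n e 2183135249 4736 e)) 2183397385
    616193 (n (n e 2183397386 4737 e) 2183397388 4737 (n e 2183397393 4736 e))) 2185232394 21536 (n
    (n (n e 2185232402 21536 e) 2185232404 26401 (n e 2185297930 21536 e)) 2185297938 21536 (n (n e
    2185297940 26401 e) 2185363466 21536 (n e 2185363474 21536 e))))) 2185363476 26401 (n (n (n (n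
    (n (n e 2185363490 21536 e) 2185429002 21536 e) 2185429010 21536 (n e 2185429012 26401 e))
    2185429026 21536 (n (n e 2197815307 26369 e) 2197815315 26401 (n e 2197815321 26401 e)))
    2197815322 16928 (n (n (n (n e 2197815324 26401 e) 2197815371 129 e) 2197815379 26401 (n e
    2197815385 26401 e)) 2197815443 26401 (n (n e 2197816346 16928 e) 2197816348 26401 (n e
    2197816403 26401 e)))) 2197816409 26401 (n (n (n (n (n e 2197817386 33356 e) 2197880907 132 e)
    2197882922 33356 (n e 2197946443 129 e)) 2197946451 26373 (n (n e 2197946467 26373 e) 2197947475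
    26373 (n e 2197947481 26401 e))) 2198011979 132 (n (n (n e 2198011987 132 e) 2198012003 132 (n e
    2198077587 16422 e)) 2198078490 16934 (n (n e 2198078492 16934 e) 2198079529 33356 (n e
    2198079530 33356 e)))))))

def tabL1011 : Tr :=
  (n (n (n (n (n (n (n (n e 2198145065 33356 e) 2198145066 33356 e) 2198145068 33356 (n e 2199912457
    616193 e)) 2199912458 4737 (n (n e 2199912460 4737 e) 2199912465 4736 (n e 2200174601 616193
    e))) 2200174602 4737 (n (n (n (n e 2200174604 4737 e) 2200174609 4736 e) 2202009610 21536 (n e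
    2202009617 26401 e)) 2202009618 21536 (n (n e 2202009620 26401 e) 2202009681 26401 (n e
    2202075146 21536 e)))) 2202075153 26401 (n (n (n (n (n e 2202075154 26401 e) 2202075156 26401 e)
    2202140682 21536 (n e 2202140689 26401 e)) 2202140690 21536 (n (n e 2202140692 26401 e)
    2202140706 21536 (n e 2202140753 26401 e))) 2202206218 21536 (n (n (n (n e 2202206225 26401 e)
    2202206226 21536 e) 2202206228 26401 (n e 2202206242 21536 e)) 2202206289 26401 (n (n e
    2281701386 7937 e) 2281701393 26401 (n e 2281766922 7937 e))))) 2281766929 26401 (n (n (n (n (n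
    (n e 2281766930 26401 e) 2281766932 26401 e) 2281963529 7937 (n e 2281963530 7937 e)) 2281963532
    7937 (n (n e 2281963537 26401 e) 2282029065 7937 (n e 2282029066 7937 e))) 2282029068 7937 (n (n
    (n (n e 2282029073 26401 e) 2282029074 26401 e) 2282029076 26401 (n e 2298478602 7937 e))
    2298478609 26401 (n (n e 2298544138 7937 e) 2298544145 26401 (n e 2298544146 26401 e))))
    2298544148 26401 (n (n (n (n (n e 2298740745 7937 e) 2298740746 7937 e) 2298740748 7937 (n e
    2298740753 26401 e)) 2298806281 7937 (n (n e 2298806282 7937 e) 2298806284 7937 (n e 2298806289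
    26401 e))) 2298806290 26401 (n (n (n e 2298806292 26401 e) 2315255818 7937 (n e 2315255825 26401
    e)) 2315321354 7937 (n (n e 2315321361 26401 e) 2315321362 26401 (n e 2315321364 26401 e))))))
    2315517961 7937 (n (n (n (n (n (n (n e 2315517962 7937 e) 2315517964 7937 e) 2315517969 26401 (n
    e 2315583497 7937 e)) 2315583498 7937 (n (n e 2315583500 7937 e) 2315583505 26401 (n e
    2315583506 26401 e))) 2315583508 26401 (n (n (n (n e 2332033034 7937 e) 2332033041 26401 e)
    2332098570 7937 (n e 2332098577 26401 e)) 2332098578 26401 (n (n e 2332098580 26401 e)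
    2332295177 7937 (n e 2332295178 7937 e)))) 2332295180 7937 (n (n (n (n (n e 2332295185 26401 e)
    2332360713 7937 e) 2332360714 7937 (n e 2332360716 7937 e)) 2332360721 26401 (n (n e 2332360722
    26401 e) 2332360724 26401 (n e 2415919114 1286176 e))) 2415919122 1286176 (n (n (n e 2415919124
    41024 e) 2415984650 1286176 (n e 2415984658 1286176 e)) 2415984660 41024 (n (n e 2449473546
    1286176 e) 2449473554 1286176 (n e 2449473556 41024 e))))) 2449539082 1286176 (n (n (n (n (n (n
    e 2449539090 1286176 e) 2449539092 41024 e) 2684354570 1286688 (n e 2684354578 1286688 e))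
    2684354580 41536 (n (n e 2684354594 1286688 e) 2684420106 1286688 (n e 2684420114 1286688 e)))
    2684420116 41536 (n (n (n (n e 2684420130 1286688 e) 2684485642 1286688 e) 2684485650 1286688 (n
    e 2684485652 41536 e)) 2684485666 1286688 (n (n e 2684551178 1286688 e) 2684551186 1286688 (n e
    2684551188 41536 e)))) 2684551202 1286688 (n (n (n (n (n e 2701131857 26401 e) 2701132881 26401
    e) 2701262929 26401 (n e 2701263953 26401 e)) 2717909002 1286688 (n (n e 2717909010 1286688 e)
    2717909012 41536 (n e 2717909026 1286688 e))) 2717974538 1286688 (n (n (n e 2717974546 1286688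
    e) 2717974548 41536 (n e 2717974562 1286688 e)) 2718040074 1286688 (n (n e 2718040082 1286688 e)
    2718040084 41536 (n e 2718040098 1286688 e)))))))

def tabL101 : Tr := n tabL1010 2198079532 33356 tabL1011

def tabL10 : Tr := n tabL100 2164523155 26401 tabL101

def tabL1100 : Tr :=
  (n (n (n (n (n (n (n (n e 2718105618 1286688 e) 2718105620 41536 e) 2718105634 1286688 (n e
    2734686289 26401 e)) 2734687313 26401 (n (n e 2734817361 26401 e) 2734818385 26401 (n e
    4294967309 43200 e))) 4294967317 43200 (n (n (n (n e 4294967324 43200 e) 4294967331 43201 e)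
    4294967333 43200 (n e 4294967338 43201 e)) 4294967340 33344 (n (n e 4294967373 43137 e)
    4294967381 43200 (n e 4294967395 43201 e)))) 4294967397 43200 (n (n (n (n (n e 4294967459 43201
    e) 4294967523 43201 e) 4294968348 1327680 (n e 4294968405 43200 e)) 4294969445 43200 (n (n e
    4294969507 43201 e) 4294969514 43201 (n e 4294969571 43201 e))) 4295032909 43140 (n (n (n (n e
    4295032917 43140 e) 4295032931 132 e) 4295032933 43140 (n e 4295098396 43200 e)) 4295098403
    43201 (n (n e 4295098445 261 e) 4295098453 261 (n e 4295098467 43201 e))))) 4295098469 261 (n (n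
    (n (n (n (n e 4295098531 43201 e) 4295163981 43140 e) 4295163989 43140 (n e 4295164003 132 e))
    4295164005 43140 (n (n e 4295229453 43200 e) 4295229461 43200 (n e 4295229477 43200 e)))
    4295229481 43201 (n (n (n (n e 4295229482 43201 e) 4295229484 33344 e) 4295229517 43137 (n e
    4295229525 43200 e)) 4295229541 43200 (n (n e 4295229545 43201 e) 4295229603 16422 (n e
    4295229667 16422 e)))) 4295230492 16934 (n (n (n (n (n e 4295230549 43200 e) 4295231529 43201 e)
    4295231651 16422 (n e 4295295053 43137 e)) 4295295061 43140 (n (n e 4295295077 43201 e)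
    4295296085 43140 (n e 4295360589 261 e))) 4295360597 261 (n (n (n e 4295360613 261 e) 4295426125
    261 (n e 4295426133 261 e)) 4295426149 261 (n (n e 4296015885 43200 e) 4296015893 43200 (n e
    4296015900 43200 e)))))) 4296015907 43201 (n (n (n (n (n (n (n e 4296015909 43200 e) 4296015914
    43201 e) 4296015916 33344 (n e 4296015949 257 e)) 4296015957 43200 (n (n e 4296015971 43201 e)
    4296015973 43200 (n e 4296016035 43201 e))) 4296016099 43201 (n (n (n (n e 4296016924 1327680 e)
    4296016981 43200 e) 4296017962 43201 (n e 4296017964 33344 e)) 4296018021 43200 (n (n e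
    4296018083 43201 e) 4296018090 43201 (n e 4296018147 43201 e)))) 4296081485 43200 (n (n (n (n (n
    e 4296081493 43200 e) 4296081507 132 e) 4296081509 43140 (n e 4296146972 43200 e)) 4296146979
    43201 (n (n e 4296147021 261 e) 4296147029 261 (n e 4296147043 43201 e))) 4296147045 261 (n (n
    (n e 4296147107 43201 e) 4296212557 261 (n e 4296212565 261 e)) 4296212579 132 (n (n e
    4296212581 261 e) 4296278029 43200 (n e 4296278037 43200 e))))) 4296278053 43200 (n (n (n (n (n
    (n e 4296278057 43201 e) 4296278058 43201 e) 4296278060 33344 (n e 4296278093 43137 e))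
    4296278101 43200 (n (n e 4296278117 43200 e) 4296278121 43201 (n e 4296278179 16422 e)))
    4296278243 16422 (n (n (n (n e 4296279125 43200 e) 4296280105 43201 e) 4296280106 43201 (n e
    4296280108 33344 e)) 4296280165 43200 (n (n e 4296280169 43201 e) 4296280227 16422 (n e
    4296280291 16422 e)))) 4296343629 43137 (n (n (n (n (n e 4296343637 43140 e) 4296343653 43201 e)
    4296344661 43140 (n e 4296409165 261 e)) 4296409173 261 (n (n e 4296409189 261 e) 4296409251
    16422 (n e 4296474701 261 e))) 4296474709 261 (n (n (n e 4296474725 261 e) 4297064460 43200 (n e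
    4297064481 4736 e)) 4297195532 43200 (n (n e 4297195540 43200 e) 4297195553 4736 (n e 4297195554
    43201 e)))))))

def tabL1101 : Tr :=
  (n (n (n (n (n (n (n (n e 4297195682 43201 e) 4297326604 43200 e) 4297326625 4736 (n e 4297457676
    43200 e)) 4297457684 43200 (n (n e 4297457697 43201 e) 4297457698 43201 (n e 4297457700 43200
    e))) 4297457826 43201 (n (n (n (n e 4298113036 43200 e) 4298113057 4736 e) 4298244108 43200 (n e
    4298244116 43200 e)) 4298244129 4736 (n (n e 4298244130 43201 e) 4298244132 43200 (n e
    4298244258 43201 e)))) 4298375180 43200 (n (n (n (n (n e 4298375201 4736 e) 4298506252 43200 e)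
    4298506260 43200 (n e 4298506273 4736 e)) 4298506274 43201 (n (n e 4298506276 43200 e)
    4298506402 43201 (n e 4299161612 1332288 e))) 4299161620 1332288 (n (n (n (n e 4299161634 21536
    e) 4299161636 1332288 e) 4299227148 1332288 (n e 4299227156 1332288 e)) 4299227170 21536 (n (n e
    4299227172 1332288 e) 4299292684 1332288 (n e 4299292692 1332288 e))))) 4299292706 21536 (n (n
    (n (n (n (n e 4299292708 1332288 e) 4299358220 1332288 e) 4299358228 1332288 (n e 4299358242
    21536 e)) 4299358244 1332288 (n (n e 4300210188 1332288 e) 4300210196 1332288 (n e 4300210210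
    21536 e))) 4300210212 1332288 (n (n (n (n e 4300275724 1332288 e) 4300275732 1332288 e)
    4300275746 21536 (n e 4300275748 1332288 e)) 4300341260 1332288 (n (n e 4300341268 1332288 e)
    4300341282 21536 (n e 4300341284 1332288 e)))) 4300406796 1332288 (n (n (n (n (n e 4300406804
    1332288 e) 4300406818 21536 e) 4300406820 1332288 (n e 4303355916 1332800 e)) 4303355924 1332800
    (n (n e 4303355938 22048 e) 4303355940 1332800 (n e 4303486988 1332800 e))) 4303486996 1332800
    (n (n (n e 4303487010 22048 e) 4303487012 1332800 (n e 4304404492 1332800 e)) 4304404500 1332800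
    (n (n e 4304404514 22048 e) 4304404516 1332800 (n e 4304535564 1332800 e)))))) 4304535572
    1332800 (n (n (n (n (n (n (n e 4304535586 22048 e) 4304535588 1332800 e) 4311744651 1327180 (n e
    4311744659 1327180 e)) 4311744675 1327180 (n (n e 4311745562 1327692 e) 4311745564 1327692 (n e
    4311745690 1327692 e))) 4311746601 33356 (n (n (n (n e 4311746723 1327180 e) 4311746730 33356 e)
    4311875723 1327180 (n e 4311875731 1327180 e)) 4311875747 1327180 (n (n e 4311876634 1327692 e)
    4311876762 1327692 (n e 4312006795 16422 e)))) 4312006803 16422 (n (n (n (n (n e 4312006819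
    16422 e) 4312007706 1327692 e) 4312007708 16934 (n e 4312007834 16934 e)) 4312008745 33356 (n (n
    e 4312008867 16422 e) 4312137867 16422 (n e 4312137875 16422 e))) 4312137891 16422 (n (n (n e
    4312138778 16934 e) 4312138906 16934 (n e 4312793227 1327180 e)) 4312793235 1327180 (n (n e
    4312793251 1327180 e) 4312794138 1327692 (n e 4312794140 1327692 e))))) 4312794266 1327692 (n (n
    (n (n (n (n e 4312795177 33356 e) 4312795178 33356 e) 4312795180 33356 (n e 4312795299 1327180
    e)) 4312795306 33356 (n (n e 4312924299 1327180 e) 4312924307 1327180 (n e 4312924323 1327180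
    e))) 4312925210 1327692 (n (n (n (n e 4312925338 1327692 e) 4313055371 16422 e) 4313055379 16422
    (n e 4313055395 16422 e)) 4313056282 16934 (n (n e 4313056284 16934 e) 4313056410 16934 (n e
    4313057321 33356 e)))) 4313057322 33356 (n (n (n (n (n e 4313057324 33356 e) 4313057443 1327180
    e) 4313186443 16422 (n e 4313186451 16422 e)) 4313186467 16422 (n (n e 4313187354 16934 e)
    4313187482 16934 (n e 4313841673 4736 e))) 4313841674 4737 (n (n (n e 4313841676 4737 e)
    4313841681 4736 (n e 4313841697 4736 e)) 4313841802 4737 (n (n e 4313972745 4736 e) 4313972746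
    4737 (n e 4313972748 43200 e)))))))

def tabL110 : Tr := n tabL1100 4297195556 43200 tabL1101

def tabL1110 : Tr :=
  (n (n (n (n (n (n (n (n e 4313972756 43200 e) 4313972769 4736 e) 4313972770 43201 (n e 4313972772
    43200 e)) 4313972874 4737 (n (n e 4313972898 43201 e) 4314103817 4736 (n e 4314103818 4737 e)))
    4314103820 4737 (n (n (n (n e 4314103825 4736 e) 4314103841 4736 e) 4314103946 4737 (n e
    4314234889 4736 e)) 4314234890 4737 (n (n e 4314234892 43200 e) 4314234897 4736 (n e 4314234900
    43200 e)))) 4314234913 4736 (n (n (n (n (n e 4314234914 43201 e) 4314234916 43200 e) 4314235018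
    4737 (n e 4314235042 43201 e)) 4314890249 4736 (n (n e 4314890250 4737 e) 4314890252 4737 (n e
    4314890257 4736 e))) 4314890273 4736 (n (n (n (n e 4314890378 4737 e) 4315021321 4736 e)
    4315021322 4737 (n e 4315021324 43200 e)) 4315021329 4736 (n (n e 4315021332 43200 e) 4315021345
    4736 (n e 4315021346 43201 e))))) 4315021348 43200 (n (n (n (n (n (n e 4315021450 4737 e)
    4315021474 43201 e) 4315152393 4736 (n e 4315152394 4737 e)) 4315152396 4737 (n (n e 4315152401
    4736 e) 4315152417 4736 (n e 4315152522 4737 e))) 4315283465 4736 (n (n (n (n e 4315283466 4737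
    e) 4315283468 43200 e) 4315283473 4736 (n e 4315283476 43200 e)) 4315283489 4736 (n (n e
    4315283490 43201 e) 4315283492 43200 (n e 4315283594 4737 e)))) 4315283618 43201 (n (n (n (n (n
    e 4328521811 43213 e) 4328521827 43213 e) 4328521829 43213 (n e 4328521891 43213 e)) 4328522780
    43213 (n (n e 4328522835 43213 e) 4328522906 16928 (n e 4328522963 43213 e))) 4328523877 43213
    (n (n (n e 4328523939 43213 e) 4328587365 43140 (n e 4328589413 43140 e)) 4329570387 43213 (n (n
    e 4329570403 43213 e) 4329570405 43213 (n e 4329570467 43213 e)))))) 4329571356 43213 (n (n (n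
    (n (n (n (n e 4329571411 43213 e) 4329571482 16928 e) 4329571539 43213 (n e 4329572453 43213 e))
    4329572515 43213 (n (n e 4329635941 43140 e) 4329637989 43140 (n e 4345299107 1327180 e)))
    4345299996 1327692 (n (n (n (n e 4345300051 1327180 e) 4345300057 1327692 e) 4345300122 1327692
    (n e 4345300179 1327180 e)) 4345301155 1327180 (n (n e 4346347683 1327180 e) 4346348572 1327692
    (n e 4346348627 1327180 e)))) 4346348633 1327692 (n (n (n (n (n e 4346348698 1327692 e)
    4346348755 1327180 e) 4346349731 1327180 (n e 4429185033 7937 e)) 4429185034 1026177 (n (n e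
    4429185036 1026177 e) 4429185041 1026176 (n e 4429185057 1026176 e))) 4429185162 7937 (n (n (n e
    4429187105 1026176 e) 4429316234 1026177 (n e 4429316258 43201 e)) 4429447177 7937 (n (n e
    4429447178 1026177 e) 4429447180 1026177 (n e 4429447185 1026176 e))))) 4429447201 1026176 (n (n
    (n (n (n (n e 4429449249 1026176 e) 4430233609 7937 e) 4430233610 7937 (n e 4430233612 7937 e))
    4430233617 1026176 (n (n e 4430233633 1026176 e) 4430233738 7937 (n e 4430235681 1026176 e)))
    4430364810 1026177 (n (n (n (n e 4430364834 43201 e) 4430495753 7937 e) 4430495754 7937 (n e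
    4430495756 7937 e)) 4430495761 1026176 (n (n e 4430495777 1026176 e) 4430497825 1026176 (n e
    4445962249 7937 e)))) 4445962250 1026177 (n (n (n (n (n e 4445962252 1026177 e) 4445962257
    1026176 e) 4445962273 1026176 (n e 4445962378 7937 e)) 4445964321 1026176 (n (n e 4446093450
    1026177 e) 4446093474 43201 (n e 4446224393 7937 e))) 4446224394 1026177 (n (n (n e 4446224396
    1026177 e) 4446224401 1026176 (n e 4446224417 1026176 e)) 4446226465 1026176 (n (n e 4447010825
    7937 e) 4447010826 7937 (n e 4447010828 7937 e)))))))

def tabL1111 : Tr :=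
  (n (n (n (n (n (n (n (n e 4447010849 1026176 e) 4447010954 7937 e) 4447012897 1026176 (n e
    4447142026 1026177 e)) 4447142050 43201 (n (n e 4447272969 7937 e) 4447272970 7937 (n e
    4447272972 7937 e))) 4447272977 1026176 (n (n (n (n e 4447272993 1026176 e) 4447275041 1026176
    e) 4462740561 1026176 (n e 4463789137 1026176 e)) 4479517777 1026176 (n (n e 4480566353 1026176
    e) 4831838220 41536 (n e 4831838228 41536 e)))) 4831838242 43201 (n (n (n (n (n e 4831838244
    41536 e) 4831903756 41536 e) 4831903764 41536 (n e 4831903778 43201 e)) 4831903780 41536 (n (n e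
    4831969292 41536 e) 4831969300 41536 (n e 4831969314 43201 e))) 4831969316 41536 (n (n (n e
    4832034828 41536 e) 4832034836 41536 (n e 4832034850 43201 e)) 4832034852 41536 (n (n e
    4832100364 41536 e) 4832100372 41536 (n e 4832100385 43201 e))))) 4832100386 43201 (n (n (n (n
    (n (n e 4832100388 41536 e) 4832100449 43201 e) 4832165900 41536 (n e 4832165908 41536 e))
    4832165921 43201 (n (n e 4832165922 43201 e) 4832165924 41536 (n e 4832165985 43201 e)))
    4832231436 41536 (n (n (n (n e 4832231444 41536 e) 4832231457 43201 e) 4832231458 43201 (n e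
    4832231460 41536 e)) 4832231521 43201 (n (n e 4832296972 41536 e) 4832296980 41536 (n e
    4832296993 43201 e)))) 4832296994 43201 (n (n (n (n (n e 4832296996 41536 e) 4832297057 43201 e)
    4832886796 41536 (n e 4832886804 41536 e)) 4832886818 43201 (n (n e 4832886820 41536 e)
    4832952332 41536 (n e 4832952340 41536 e))) 4832952354 43201 (n (n (n e 4832952356 41536 e)
    4833017868 41536 (n e 4833017876 41536 e)) 4833017890 43201 (n (n e 4833017892 41536 e)
    4833083404 41536 (n e 4833083412 41536 e)))))) 4833083426 43201 (n (n (n (n (n (n (n e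
    4833083428 41536 e) 4833148940 41536 e) 4833148948 41536 (n e 4833148961 43201 e)) 4833148962
    43201 (n (n e 4833148964 41536 e) 4833149025 43201 (n e 4833214476 41536 e))) 4833214484 41536
    (n (n (n (n e 4833214497 43201 e) 4833214498 43201 e) 4833214500 41536 (n e 4833214561 43201 e))
    4833280012 41536 (n (n e 4833280020 41536 e) 4833280033 43201 (n e 4833280034 43201 e))))
    4833280036 41536 (n (n (n (n (n e 4833280097 43201 e) 4833345548 41536 e) 4833345556 41536 (n e
    4833345569 43201 e)) 4833345570 43201 (n (n e 4833345572 41536 e) 4833345633 43201 (n e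
    8589934601 11009 e))) 8589934602 10881 (n (n (n e 8589934604 10881 e) 8589934609 10880 (n e
    8590196745 11009 e)) 8590196746 10881 (n (n e 8590196748 10881 e) 8590196753 10880 (n e
    8606711817 11009 e))))) 8606711818 10881 (n (n (n (n (n (n e 8606711820 10881 e) 8606711825
    10880 e) 8606973961 11009 (n e 8606973962 10881 e)) 8606973964 10881 (n (n e 8606973969 10880 e)
    17179869194 27680 (n e 17179869202 27680 e))) 17179869204 44096 (n (n (n (n e 17179934730 27680
    e) 17179934738 27680 e) 17179934740 44096 (n e 17213423626 27680 e)) 17213423634 27680 (n (n e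
    17213423636 44096 e) 17213489162 27680 (n e 17213489170 27680 e)))) 17213489172 44096 (n (n (n
    (n (n e 34359738380 44608 e) 34359738388 44608 e) 34359738402 28192 (n e 34359738404 44608 e))
    34359869452 44608 (n (n e 34359869460 44608 e) 34359869474 28192 (n e 34359869476 44608 e)))
    34360786956 44608 (n (n (n e 34360786964 44608 e) 34360786978 28192 (n e 34360786980 44608 e))
    34360918028 44608 (n (n e 34360918036 44608 e) 34360918050 28192 (n e 34360918052 44608 e)))))))

def tabL111 : Tr := n tabL1110 4447010833 1026176 tabL1111

def tabL11 : Tr := n tabL110 4313972753 4736 tabL111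

def tabL1 : Tr := n tabL10 2718105610 1286688 tabL11

def tabL : Tr := n tabL0 553648278 41536 tabL1

def tabY0000 : Tr :=
  (n (n (n (n (n (n (n e 15 257 e) 23 16673 (n e 29 257 e)) 30 16673 (n (n e 46 33344 e) 53 33472 (n
    e 60 33344 e))) 79 257 (n (n (n e 87 16673 e) 93 257 (n e 117 33472 e)) 143 257 (n (n e 151
    16673 e) 158 16673 (n e 215 16673 e)))) 271 257 (n (n (n (n e 279 16673 e) 302 33344 (n e 309
    33472 e)) 335 257 (n (n e 343 16673 e) 399 257 (n e 407 16673 e))) 2094 33344 (n (n (n e 2101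
    33472 e) 2108 33344 (n e 2165 33472 e)) 2222 33344 (n (n e 2350 33344 e) 2357 33472 (n e 2421
    33472 e))))) 2478 33344 (n (n (n (n (n e 65615 132 e) 65623 16673 (n e 65639 132 e)) 65653 33412
    (n (n e 65743 257 e) 65751 16673 (n e 65767 132 e))) 65838 33344 (n (n (n e 65871 132 e) 65895
    132 (n e 65959 132 e)) 66023 132 (n (n e 67637 33412 e) 67687 132 (n e 67701 33412 e)))) 67815
    132 (n (n (n (n e 67886 33344 e) 67893 33412 (n e 67943 132 e)) 67957 33412 (n (n e 68007 132 e)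
    68071 132 (n e 131151 261 e))) 131159 261 (n (n (n e 131165 261 e) 131175 261 (n e 131189 261
    e)) 131230 16673 (n (n e 131303 261 e) 131407 261 e))))) 131431 261 (n (n (n (n (n (n e 133237
    261 e) 133294 33344 (n e 133351 261 e)) 196687 132 (n (n e 196695 261 e) 196711 132 (n e 196725
    33412 e))) 196943 132 (n (n (n e 196967 261 e) 198773 261 (n e 262287 257 e)) 262295 16422 (n (n
    e 262311 16422 e) 262359 16422 (n e 262375 16422 e)))) 262453 33472 (n (n (n (n e 262503 16422
    e) 262551 16422 (n e 262567 16422 e)) 262631 16422 (n (n e 264238 33318 e) 264359 16422 (n e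
    264366 33318 e))) 264423 16422 (n (n (n e 264494 33318 e) 264615 16422 (n e 264679 16422 e))
    328039 132 (n (n e 328103 16422 e) 330030 33318 (n e 330037 33472 e))))) 330151 16422 (n (n (n
    (n (n e 393447 261 e) 395438 33318 (n e 395495 261 e)) 1048669 257 (n (n e 1048719 16680 e)
    1048727 16680 (n e 1048734 16680 e))) 1048743 16680 (n (n (n e 1048791 16673 e) 1048807 16680 (n
    e 1048983 16680 e)) 1048999 16680 (n (n e 1050741 33472 e) 1050855 16680 (n e 1114319 16680
    e)))) 1114327 16680 (n (n (n (n e 1114343 16680 e) 1179741 261 (n e 1179806 16680 e)) 1310863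
    16680 (n (n e 1310871 16422 e) 1310887 16422 (n e 1310935 16422 e))) 1310951 16422 (n (n (n e
    1311127 16422 e) 1311143 16680 (n e 1312999 16422 e)) 2097165 4736 (n (n e 2097166 606465 e)
    2097173 4736 e))))))

def tabY0001 : Tr :=
  (n (n (n (n (n (n (n e 2097196 33344 e) 2097229 257 (n e 2097237 4736 e)) 2097253 4736 (n (n e
    2097294 606465 e) 2097421 257 (n e 2097422 606465 e))) 2097429 4736 (n (n (n e 2097445 4736 e)
    2097509 4736 (n e 2099244 33344 e)) 2099301 4736 (n (n e 2099493 4736 e) 2099500 33344 (n e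
    2099557 4736 e)))) 2162773 4740 (n (n (n (n e 2162789 4740 e) 2162957 4740 (n e 2162981 4740 e))
    2163045 4740 (n (n e 2163110 4740 e) 2164780 33344 (n e 2164837 4740 e))) 2164902 4740 (n (n (n
    e 2165029 4736 e) 2165030 4740 (n e 2165036 33344 e)) 2165093 4740 (n (n e 2165158 4740 e)
    2228301 261 (n e 2228309 261 e))))) 2228366 606465 (n (n (n (n (n e 2228374 16673 e) 2228390
    606469 (n e 2230438 606469 e)) 2359309 4736 (n (n e 2359310 606465 e) 2359317 4736 (n e 2359333
    4736 e))) 2359340 33344 (n (n (n e 2359373 257 e) 2359381 4736 (n e 2359397 4736 e)) 2359438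
    606465 (n (n e 2359565 257 e) 2359573 4736 (n e 2359589 4736 e)))) 2359653 4736 (n (n (n (n e
    2361388 33344 e) 2361445 4736 (n e 2361637 4736 e)) 2361644 33344 (n (n e 2361701 4736 e)
    2424917 4740 (n e 2424933 4740 e))) 2425101 257 (n (n (n e 2425125 4736 e) 2425189 4740 (n e
    2425254 4740 e)) 2426924 33344 (n (n e 2426981 4740 e) 2427046 4740 e))))) 2427173 4736 (n (n (n
    (n (n (n e 2427174 4740 e) 2427180 33344 (n e 2427237 4740 e)) 2427302 4740 (n (n e 2490445 261
    e) 2490453 261 (n e 2490510 606465 e))) 2490518 16673 (n (n (n e 2490534 606469 e) 2492582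
    606469 (n e 3145741 4736 e)) 3145749 4736 (n (n e 3145765 4736 e) 3145772 33344 (n e 3145805 257
    e)))) 3145813 4736 (n (n (n (n e 3145829 4736 e) 3145870 16680 (n e 3147820 33344 e)) 3147877
    4736 (n (n e 3276877 261 e) 3276885 261 (n e 3276901 261 e))) 3276942 16680 (n (n (n e 3276950
    16680 e) 3276966 16680 (n e 3407885 4736 e)) 3407893 4736 (n (n e 3407909 4736 e) 3407916 33344
    (n e 3407949 257 e))))) 3407957 4736 (n (n (n (n (n e 3407973 4736 e) 3408014 16680 (n e 3409964
    33344 e)) 3410021 4736 (n (n e 3539021 261 e) 3539029 261 (n e 3539045 261 e))) 3539086 16680 (n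
    (n (n e 3539094 16680 e) 3539110 16680 (n e 4194318 21536 e)) 4194325 655649 (n (n e 4194326
    21536 e) 4194342 21536 (n e 4194356 87104 e)))) 4194389 655649 (n (n (n (n e 4194574 21536 e)
    4194582 21536 (n e 4194598 21536 e)) 4194645 655649 (n (n e 4194726 21536 e) 4196404 87104 (n e
    4196518 21536 e))) 4196646 21536 (n (n (n e 4196660 87104 e) 4196774 21536 (n e 4259854 21536
    e)) 4259861 655649 (n (n e 4259862 21536 e) 4259878 21536 e))))))

def tabY000 : Tr := n tabY0000 2097189 4736 tabY0001

def tabY0010 : Tr :=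
  (n (n (n (n (n (n (n e 4259925 655649 e) 4260110 21536 (n e 4260118 16673 e)) 4260134 21536 (n (n
    e 4260262 21536 e) 4261940 87104 (n e 4262054 21536 e))) 4262182 21536 (n (n (n e 4262196 87104
    e) 4262310 21536 (n e 4325390 21536 e)) 4325398 21536 (n (n e 4325414 21536 e) 4325428 87104 (n
    e 4325461 261 e)))) 4327476 87104 (n (n (n (n e 4390926 21536 e) 4390934 21536 (n e 4390950
    21536 e)) 4390964 87104 (n (n e 4390997 261 e) 4393012 87104 (n e 4456533 21542 e))) 4456549
    21542 (n (n (n e 4456726 21542 e) 4456742 21542 (n e 4456805 21542 e)) 4456870 21542 (n (n e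
    4458548 21542 e) 4458597 21542 (n e 4458662 21542 e))))) 4458790 21542 (n (n (n (n (n e 4458804
    21542 e) 4458853 21542 (n e 4458918 21542 e)) 4522069 21542 (n (n e 4522085 21542 e) 4522262
    16673 (n e 4522278 21536 e))) 4522341 21542 (n (n (n e 4522406 21542 e) 4524084 33472 (n e
    4524133 21542 e)) 4524198 21542 (n (n e 4524326 21542 e) 4524340 33472 (n e 4524389 21542 e))))
    4524454 21542 (n (n (n (n e 5242957 655656 e) 5242965 655656 (n e 5242981 655656 e)) 5308493
    655656 (n (n e 5308501 655656 e) 5308517 655656 (n e 5374029 655656 e))) 5374037 655656 (n (n (n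
    e 5374053 655656 e) 5439565 655656 (n e 5439573 655656 e)) 5439589 655656 (n (n e 5505109 655656
    e) 5505125 655656 e))))) 5507173 655656 (n (n (n (n (n (n e 5570645 655656 e) 5570661 655656 (n
    e 5572709 655656 e)) 8388685 267 (n (n e 8388693 267 e) 8388709 267 (n e 8519757 267 e)))
    8519765 267 (n (n (n e 8519781 267 e) 9437261 267 (n e 9437269 267 e)) 9437285 267 (n (n e
    9568333 267 e) 9568341 267 (n e 9568357 267 e)))) 16777395 81996 (n (n (n (n e 16777447 32844 e)
    16777487 32844 (n e 16777495 32844 e)) 16777511 32844 (n (n e 16777525 32844 e) 16777575 32844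
    (n e 16777615 32844 e))) 16777639 32844 (n (n (n e 16777703 32844 e) 16779310 33356 (n e
    16779321 640 e)) 16779324 33356 (n (n e 16779371 33356 e) 16779385 640 (n e 16779435 33356
    e))))) 16779438 33356 (n (n (n (n (n e 16779443 81996 e) 16779495 32844 (n e 16779499 33356 e))
    16779507 81996 (n (n e 16779566 33356 e) 16779623 32844 (n e 16779687 32844 e))) 16779694 33356
    (n (n (n e 16779751 32844 e) 16843111 132 (n e 16908519 261 e)) 16910443 33356 (n (n e 16910451
    81996 e) 16910453 33472 (n e 16910510 33344 e)))) 16910567 261 (n (n (n (n e 16910571 33356 e)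
    16910579 81996 (n e 16975989 33412 e)) 17039539 16422 (n (n e 17039669 32844 e) 17041454 33318
    (n e 17041582 33356 e))) 17107246 33356 (n (n (n e 17172654 33318 e) 18874382 606465 (n e
    18874417 4736 e)) 18874510 606465 (n (n e 18874638 606465 e) 18876460 33356 e))))))

def tabY0011 : Tr :=
  (n (n (n (n (n (n (n e 18940182 4740 e) 18942260 4740 (n e 19005582 606465 e)) 19005590 16673 (n
    (n e 19005606 606469 e) 19007654 606469 (n e 19136526 606465 e))) 19136561 4736 (n (n (n e
    19136654 606465 e) 19138604 33356 (n e 19202326 4740 e)) 19204404 4740 (n (n e 19267726 606465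
    e) 19267734 16673 (n e 19267750 606469 e)))) 19269798 606469 (n (n (n (n e 19923086 16680 e)
    19925036 33356 (n e 20054158 16680 e)) 20054166 16680 (n (n e 20054182 16680 e) 20185230 16680
    (n e 20187180 33356 e))) 20316302 16680 (n (n (n e 20316310 16680 e) 20316326 16680 (n e
    20971790 21580 e)) 20971798 21580 (n (n e 20971814 21580 e) 20973617 87116 (n e 20973620 87116
    e))))) 20973681 87116 (n (n (n (n (n e 20973876 87116 e) 21037326 21580 (n e 21037334 21580 e))
    21037350 21536 (n (n e 21039153 87116 e) 21039156 87116 (n e 21039217 87116 e))) 21039412 87116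
    (n (n (n e 21104689 87116 e) 21104692 87104 (n e 21104753 87116 e)) 21170225 87116 (n (n e
    21170228 87104 e) 21170289 87116 (n e 21233942 21542 e)))) 21233958 21580 (n (n (n (n e 21235764
    87116 e) 21236006 21580 (n e 21236020 21542 e)) 21299478 21542 (n (n e 21299494 21580 e)
    21301300 87116 (n e 21301542 21580 e))) 21301556 21542 (n (n (n e 33554539 65741 e) 33554703
    32973 (n e 33554711 32973 e)) 33554727 32973 (n (n e 33554734 32973 e) 33554767 32973 e)))))
    33554775 32973 (n (n (n (n (n (n e 33554791 32973 e) 33554855 32973 (n e 33556533 33485 e))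
    33556538 16928 (n (n e 33556540 33485 e) 33556587 65741 (n e 33556595 33485 e))) 33556597 33485
    (n (n (n e 33556711 32973 e) 33556715 65741 (n e 33556789 33485 e)) 33556839 32973 (n (n e
    33556853 33485 e) 33556903 32973 (n e 33556967 32973 e)))) 33620075 132 (n (n (n (n e 33620270
    32973 e) 33622069 33412 (n e 33622133 33485 e)) 33622325 33412 (n (n e 33816999 16422 e)
    33818926 32973 (n e 33884469 33485 e))) 34605163 65741 (n (n (n e 34605173 33485 e) 34605227
    65741 (n e 34605235 33485 e)) 34605287 16680 (n (n e 34605291 65741 e) 34670709 33412 (n e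
    34867431 16422 e))))) 35651853 4813 (n (n (n (n (n e 35651854 32973 e) 35651861 4813 (n e
    35651877 4813 e)) 35653674 70349 (n (n e 35653676 70349 e) 35653802 70349 (n e 35653932 70349
    e))) 35717389 4740 (n (n (n e 35717413 4813 e) 35719212 70349 (n e 35719461 4813 e)) 35719468
    70349 (n (n e 35913997 4813 e) 35914005 4813 (n e 35914021 4736 e)))) 35915818 70349 (n (n (n (n
    e 35915820 70349 e) 35915946 70349 (n e 35916076 70349 e)) 35979533 4740 (n (n e 35979557 4813
    e) 35981356 70349 (n e 35981605 4813 e))) 35981612 70349 (n (n (n e 36702250 70349 e) 36702252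
    33344 (n e 36702309 4813 e)) 36702313 70349 (n (n e 36702378 70349 e) 36964394 70349 e))))))

def tabY001 : Tr := n tabY0010 18876716 33356 tabY0011

def tabY00 : Tr := n tabY000 4259892 87104 tabY001

def tabY0100 : Tr :=
  (n (n (n (n (n (n (n e 36964453 4736 e) 36964457 70349 (n e 36964522 70349 e)) 37748757 655649 (n
    (n e 37748778 21536 e) 37748821 655649 (n e 37750836 33485 e))) 37814293 655649 (n (n (n e
    37814314 21536 e) 37814357 655649 (n e 37816372 33485 e)) 37879893 261 (n (n e 37881908 33485 e)
    37945429 261 (n e 37947444 33485 e)))) 38011149 21542 (n (n (n (n e 38076685 21542 e) 38797389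
    257 (n e 38797397 655649 e)) 38797413 655656 (n (n e 38799461 655656 e) 38862925 257 (n e
    38862933 655649 e))) 38862949 655656 (n (n (n e 38864997 655656 e) 38928461 261 (n e 38928469
    261 e)) 38928485 261 (n (n e 38993997 261 e) 38994005 261 (n e 38994021 261 e))))) 50331919
    32973 (n (n (n (n (n e 50331927 32844 e) 50331943 32844 (n e 50331991 32844 e)) 50332007 32844
    (n (n e 50332047 32973 e) 50332071 32844 (n e 50333753 33485 e))) 50333754 33356 (n (n (n e
    50333756 33356 e) 50333803 65741 (n e 50333817 33485 e)) 50333875 33485 (n (n e 50334055 32844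
    e) 50334119 32973 (n e 50464875 65741 e)))) 50464883 33485 (n (n (n (n e 51382443 33356 e)
    51382451 81996 (n e 52429070 32973 e)) 52430890 33356 (n (n e 52430892 33356 e) 52431018 33356
    (n e 52431148 33356 e))) 52693034 70349 (n (n (n e 52693036 33356 e) 52693162 33356 (n e
    53479466 33356 e)) 53479468 33356 (n (n e 53479594 33356 e) 53741610 33356 e))))) 53741612 33356
    (n (n (n (n (n (n e 53741738 33356 e) 54528049 87116 (n e 54528052 33485 e)) 54528113 33485 (n
    (n e 54593585 33485 e) 54593588 33485 (n e 54593649 33485 e))) 54659121 33485 (n (n (n e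
    54659124 33485 e) 54659185 33485 (n e 54724657 33485 e)) 54724660 33485 (n (n e 54724721 33485
    e) 134217739 7936 (n e 134217742 7937 e)))) 134217747 7936 (n (n (n (n e 134217753 640 e)
    134217756 7937 (n e 134217763 7936 e)) 134217777 7936 (n (n e 134217827 7936 e) 134217867 7937
    (n e 134217870 7937 e))) 134217875 7969 (n (n (n e 134217891 7936 e) 134217955 7936 (n e
    134217998 7937 e)) 134218126 7937 (n (n e 134219825 1016448 e) 134219875 7936 (n e 134219889
    1016448 e))))) 134219939 7936 (n (n (n (n (n e 134220003 7936 e) 134283534 1015940 (n e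
    134283542 1015940 e)) 134283558 1015940 (n (n e 134285361 1016452 e) 134285364 1016452 (n e
    134285425 1016452 e))) 134285620 1016452 (n (n (n e 134348899 7941 e) 134348939 7941 (n e
    134348947 7941 e)) 134348963 7941 (n (n e 134349027 7941 e) 134350897 7941 (n e 134350947 7941
    e)))) 134350961 1016448 (n (n (n (n e 134351075 7941 e) 134416433 1016452 (n e 134416497 1016452
    e)) 134479886 7937 (n (n e 134479921 7936 e) 134480011 16422 (n e 134480014 7937 e))) 134480019
    16422 (n (n (n e 134480035 16422 e) 134545678 7937 (n e 134545686 1015940 e)) 134545702 1015940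
    (n (n e 134547508 1016452 e) 134547750 1015940 e))))))

def tabY0101 : Tr :=
  (n (n (n (n (n (n (n e 135266443 7976 e) 135266446 16680 (n e 135266451 7976 e)) 135266467 7976 (n
    (n e 135397515 7941 e) 135397523 7976 (n e 135397539 7976 e))) 135528587 16422 (n (n (n e
    135528590 16680 e) 135528595 16422 (n e 135528611 16422 e)) 136314889 4736 (n (n e 136314892
    7937 e) 136314897 4736 (n e 136314913 4736 e)))) 136380692 4740 (n (n (n (n e 136577033 4736 e)
    136577036 7937 (n e 136577041 4736 e)) 136577057 4736 (n (n e 136642836 4740 e) 137363465 4736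
    (n e 137363468 7937 e))) 137363473 4736 (n (n (n e 137363489 4736 e) 137625609 4736 (n e
    137625612 7937 e)) 137625617 4736 (n (n e 137625633 4736 e) 138412042 663328 (n e 138412049
    663329 e))))) 138412050 663328 (n (n (n (n (n e 138412052 663329 e) 138412066 21536 (n e
    138412308 663329 e)) 138477578 663328 (n (n e 138477585 663329 e) 138477586 663328 (n e
    138477588 663329 e))) 138477602 663328 (n (n (n e 138477844 663329 e) 138674452 21542 (n e
    138739988 21542 e)) 150994955 7936 (n (n e 150994958 7937 e) 150994963 7936 (n e 150994969 7937
    e)))) 150994972 7937 (n (n (n (n e 150994979 7936 e) 150994993 7936 (n e 150995043 7936 e))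
    150995083 7937 (n (n e 150995086 7937 e) 150995091 7969 (n e 150995107 7936 e))) 150995171 7936
    (n (n (n e 150995214 7937 e) 150995342 7937 (n e 150997041 1016448 e)) 150997091 7936 (n (n e
    150997105 1016448 e) 150997155 7936 e))))) 150997219 7936 (n (n (n (n (n (n e 151060750 1015940
    e) 151060758 1015940 (n e 151060774 1015940 e)) 151062577 1016452 (n (n e 151062580 1016452 e)
    151062641 1016452 (n e 151062836 1016452 e))) 151126115 7941 (n (n (n e 151126155 7941 e)
    151126163 7941 (n e 151126179 7941 e)) 151126243 7941 (n (n e 151128113 7941 e) 151128163 7941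
    (n e 151128177 1016448 e)))) 151128291 7941 (n (n (n (n e 151193649 1016452 e) 151193713 1016452
    (n e 151257102 7937 e)) 151257137 7936 (n (n e 151257227 16422 e) 151257230 7937 (n e 151257235
    16422 e))) 151257251 16422 (n (n (n e 151322894 7937 e) 151322902 1015940 (n e 151322918 1015940
    e)) 151324724 1016452 (n (n e 151324966 1015940 e) 151324980 1016452 (n e 152043659 7976 e)))))
    152043662 16680 (n (n (n (n (n e 152043667 7976 e) 152043683 7976 (n e 152174731 7941 e))
    152174739 7976 (n (n e 152174755 7976 e) 152305803 16422 (n e 152305806 16680 e))) 152305811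
    16422 (n (n (n e 152305827 16422 e) 153092105 4736 (n e 153092108 7937 e)) 153092113 4736 (n (n
    e 153092129 4736 e) 153157908 4740 (n e 153354249 4736 e)))) 153354252 7937 (n (n (n (n e
    153354257 4736 e) 153354273 4736 (n e 153420052 4740 e)) 154140681 4736 (n (n e 154140684 7937
    e) 154140689 4736 (n e 154140705 4736 e))) 154402825 4736 (n (n (n e 154402828 7937 e) 154402833
    4736 (n e 154402849 4736 e)) 155189258 663328 (n (n e 155189265 663329 e) 155189266 663328
    e))))))

def tabY010 : Tr := n tabY0100 134547764 1016452 tabY0101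

def tabY0110 : Tr :=
  (n (n (n (n (n (n (n e 155189282 21536 e) 155189524 663329 (n e 155254794 663328 e)) 155254801
    663329 (n (n e 155254802 663328 e) 155254804 663329 (n e 155254818 663328 e))) 155255060 663329
    (n (n (n e 155451668 21542 e) 155517204 21542 (n e 167772171 7936 e)) 167772179 7936 (n (n e
    167772185 7937 e) 167772186 7937 (n e 167772188 7937 e)))) 167772195 7936 (n (n (n (n e
    167772235 7937 e) 167772243 7936 (n e 167772259 7936 e)) 167772323 7936 (n (n e 167772430 32973
    e) 167774257 7936 (n e 167774307 7936 e))) 167774321 33485 (n (n (n e 167774371 7936 e)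
    167837771 132 (n e 167837779 132 e)) 167837795 132 (n (n e 167837966 32973 e) 167837974 32973 (n
    e 167837990 32973 e))))) 167839793 1016452 (n (n (n (n (n e 167839796 33485 e) 167839857 1016452
    (n e 167840052 33485 e)) 168100110 32973 (n (n e 168100118 32973 e) 168100134 32973 (n e
    168101940 33485 e))) 168102196 33485 (n (n (n e 168820875 7937 e) 168820883 7969 (n e 168820899
    7976 e)) 168822947 7976 (n (n e 169083019 16422 e) 169083027 16422 (n e 169083043 16422 e))))
    169869321 7936 (n (n (n (n e 169869322 7937 e) 169869324 7937 (n e 169869329 7936 e)) 169869345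
    4736 (n (n e 169869580 7937 e) 170131465 7936 (n e 170131466 7937 e))) 170131468 7937 (n (n (n e
    170131473 7936 e) 170131489 7936 (n e 170131724 7937 e)) 170917897 4736 (n (n e 170917898 7937
    e) 170917900 7937 e))))) 170917905 4736 (n (n (n (n (n (n e 170917921 4736 e) 170918026 7937 (n
    e 171180041 4736 e)) 171180042 7937 (n (n e 171180044 7937 e) 171180049 4736 (n e 171180065 4736
    e))) 171180170 7937 (n (n (n e 171966474 21536 e) 171966481 663329 (n e 171966482 21536 e))
    171966484 663329 (n (n e 171966498 21536 e) 171966545 663329 (n e 172032010 21536 e))))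
    172032017 663329 (n (n (n (n e 172032018 21536 e) 172032020 663329 (n e 172032034 21536 e))
    172032081 663329 (n (n e 184549387 7936 e) 184549395 7936 (n e 184549401 7937 e))) 184549402
    7937 (n (n (n e 184549404 7937 e) 184549411 7936 (n e 184549451 7937 e)) 184549459 7936 (n (n e
    184549475 7936 e) 184549515 7936 (n e 184549523 7969 e))))) 184549539 7936 (n (n (n (n (n e
    184549646 32973 e) 184549774 32973 (n e 184551473 33485 e)) 184551523 7936 (n (n e 184551537
    33485 e) 184551587 7936 (n e 184614987 132 e))) 184614995 132 (n (n (n e 184615011 132 e)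
    184615182 32973 (n e 184615190 32973 e)) 184615206 32973 (n (n e 184617009 1016452 e) 184617012
    33485 (n e 184617073 1016452 e)))) 184617268 33485 (n (n (n (n e 184811659 16422 e) 184811667
    16422 (n e 184811683 16422 e)) 184877326 32973 (n (n e 184877334 32973 e) 184877350 32973 (n e
    184879156 33485 e))) 184879412 33485 (n (n (n e 185598091 7937 e) 185598099 7969 (n e 185598115
    7976 e)) 185600163 7976 (n (n e 185860235 16422 e) 185860243 16422 e))))))

def tabY0111 : Tr :=
  (n (n (n (n (n (n (n e 186646537 4736 e) 186646538 7937 (n e 186646540 7937 e)) 186646545 4736 (n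
    (n e 186646561 4736 e) 186646666 7937 (n e 186908681 4736 e))) 186908682 7937 (n (n (n e
    186908684 7937 e) 186908689 4736 (n e 186908705 4736 e)) 186908810 7937 (n (n e 187695113 4736
    e) 187695114 7937 (n e 187695116 7937 e)))) 187695121 4736 (n (n (n (n e 187695137 4736 e)
    187695242 7937 (n e 187957257 4736 e)) 187957258 7937 (n (n e 187957260 7937 e) 187957265 4736
    (n e 187957281 4736 e))) 187957386 7937 (n (n (n e 188743690 21536 e) 188743697 663329 (n e
    188743698 21536 e)) 188743700 663329 (n (n e 188743714 21536 e) 188743761 663329 (n e 188809226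
    21536 e))))) 188809233 663329 (n (n (n (n (n e 188809234 21536 e) 188809236 663329 (n e
    188809250 21536 e)) 188809297 663329 (n (n e 268435531 144 e) 268435539 144 (n e 268435555 144
    e))) 268501067 144 (n (n (n e 268501075 144 e) 268501091 144 (n e 272629770 21536 e)) 272629778
    21536 (n (n e 272629780 41024 e) 272629794 21536 (n e 272695306 21536 e)))) 272695314 21536 (n
    (n (n (n e 272695316 41024 e) 272695330 21536 (n e 301989963 144 e)) 301989971 144 (n (n e
    301989987 144 e) 302055499 144 (n e 302055507 144 e))) 302055523 144 (n (n (n e 306184202 21536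
    e) 306184210 21536 (n e 306184212 41024 e)) 306184226 21536 (n (n e 306249738 21536 e) 306249746
    21536 e))))) 306249748 41024 (n (n (n (n (n (n e 306249762 21536 e) 536870926 41536 (n e
    536870934 41536 e)) 536870940 41536 (n (n e 536870950 41536 e) 536870964 41536 (n e 536871078
    41536 e))) 536873126 41536 (n (n (n e 536936462 41536 e) 536936470 41536 (n e 536936486 41536
    e)) 536936500 41536 (n (n e 537001998 41536 e) 537002006 41536 (n e 537002012 41536 e))))
    537002022 41536 (n (n (n (n e 537002036 41536 e) 537002150 41536 (n e 537002254 41536 e))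
    537002278 41536 (n (n e 537004198 41536 e) 537067534 41536 (n e 537067542 41536 e))) 537067558
    41536 (n (n (n e 537067572 41536 e) 537067790 41536 (n e 537067814 41536 e)) 537133222 41536 (n
    (n e 537135270 41536 e) 537264294 41536 (n e 537266342 41536 e))))) 537919516 41536 (n (n (n (n
    (n e 538050588 41536 e) 538968076 41536 (n e 538968084 41536 e)) 538968100 41536 (n (n e
    539099148 41536 e) 539099156 41536 (n e 539099172 1118912 e))) 539230220 41536 (n (n (n e
    539230228 41536 e) 539230244 41536 (n e 539361292 41536 e)) 539361300 41536 (n (n e 539361316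
    1118912 e) 540016652 41536 (n e 540016660 41536 e)))) 540016676 41536 (n (n (n (n e 540147724
    41536 e) 540147732 41536 (n e 540147748 41536 e)) 540278796 41536 (n (n e 540278804 41536 e)
    540278820 41536 (n e 540409868 41536 e))) 540409876 41536 (n (n (n e 540409892 41536 e)
    541065236 41536 (n e 541130772 41536 e)) 541196308 41536 (n (n e 541261844 41536 e) 542113804
    41536 e))))))

def tabY011 : Tr := n tabY0110 185860259 16422 tabY0111

def tabY01 : Tr := n tabY010 155189268 663329 tabY011

def tabY0 : Tr := n tabY00 36964396 33344 tabY01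

def tabY1000 : Tr :=
  (n (n (n (n (n (n (n e 542113828 41536 e) 542179340 41536 (n e 542179348 41536 e)) 542179364 41536
    (n (n e 542244876 41536 e) 542244884 41536 (n e 542244900 41536 e))) 542310412 41536 (n (n (n e
    542310420 41536 e) 542310436 41536 (n e 545259532 41536 e)) 545259540 41536 (n (n e 545259556
    41536 e) 545390604 41536 (n e 545390612 41536 e)))) 545390628 41536 (n (n (n (n e 546308108
    41536 e) 546308116 41536 (n e 546308132 41536 e)) 546439180 41536 (n (n e 546439188 41536 e)
    546439204 41536 (n e 553648227 41548 e))) 553648267 41548 (n (n (n e 553648275 41548 e)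
    553648291 41548 (n e 553648294 41536 e)) 553648355 41548 (n (n e 553650225 41548 e) 553650275
    41548 (n e 553650342 41536 e))))) 553650403 41548 (n (n (n (n (n e 553779299 41548 e) 553779339
    41548 (n e 553779347 41548 e)) 553779363 41548 (n (n e 553779366 41536 e) 553779427 41548 (n e
    553781297 41548 e))) 553781347 41548 (n (n (n e 553781414 41536 e) 553781475 41548 (n e
    553910438 41510 e)) 553912486 41510 (n (n e 554041510 41510 e) 554043558 41510 (n e 554696843
    41548 e)))) 554827915 41548 (n (n (n (n e 570425419 1114317 e) 570425427 1114317 (n e 570425443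
    1114317 e)) 570490955 1114317 (n (n e 570490963 132 e) 570490979 1114317 (n e 570556491 1114317
    e))) 570556499 1114317 (n (n (n e 570556515 1114317 e) 570556686 32973 (n e 570556710 32973 e))
    570622027 132 (n (n e 570622035 132 e) 570622051 132 e))))) 570622222 32973 (n (n (n (n (n (n e
    570622246 32973 e) 571473995 1114317 (n e 571474003 1114317 e)) 571474019 1114317 (n (n e
    571539531 132 e) 571539539 132 (n e 571539555 132 e))) 571605067 1114317 (n (n (n e 571605075
    1114317 e) 571605091 1114317 (n e 571670603 132 e)) 571670611 132 (n (n e 571670627 132 e)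
    574619658 21536 (n e 574619666 21536 e)))) 574619668 41536 (n (n (n (n e 574619682 21536 e)
    574685194 21536 (n e 574685202 21536 e)) 574685204 41536 (n (n e 574685218 21536 e) 574750730
    21536 (n e 574750738 21536 e))) 574750740 41536 (n (n (n e 574750754 21536 e) 574816266 21536 (n
    e 574816274 21536 e)) 574816276 41536 (n (n e 574816290 21536 e) 575668234 21536 (n e 575668236
    41536 e))))) 575668242 21536 (n (n (n (n (n e 575668244 41536 e) 575668258 21536 (n e 575668260
    41536 e)) 575733770 21536 (n (n e 575733772 41536 e) 575733778 21536 (n e 575733780 41536 e)))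
    575733794 21536 (n (n (n e 575733796 41536 e) 575799306 21536 (n e 575799308 41536 e)) 575799314
    21536 (n (n e 575799316 41536 e) 575799330 21536 (n e 575799332 41536 e)))) 575864842 21536 (n
    (n (n (n e 575864844 41536 e) 575864850 21536 (n e 575864852 41536 e)) 575864866 21536 (n (n e
    575864868 41536 e) 587202659 1114317 (n e 587204707 1114317 e))) 587333731 1114317 (n (n (n e
    587335779 1114317 e) 1073741963 16434 (n e 1073741971 16434 e)) 1073741987 16434 (n (n e
    1074004107 16434 e) 1074004115 16434 e))))))

def tabY1001 : Tr :=
  (n (n (n (n (n (n (n e 1075838985 4736 e) 1075838988 42176 (n e 1075838993 4736 e)) 1075839009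
    4736 (n (n e 1076101129 4736 e) 1076101132 42176 (n e 1076101137 4736 e))) 1076101153 4736 (n (n
    (n e 1090519179 16434 e) 1090519187 16434 (n e 1090519203 16434 e)) 1090781323 16434 (n (n e
    1090781331 16434 e) 1090781347 16434 (n e 1092616201 4736 e)))) 1092616204 42176 (n (n (n (n e
    1092616209 4736 e) 1092616225 4736 (n e 1092878345 4736 e)) 1092878348 42176 (n (n e 1092878353
    4736 e) 1092878369 4736 (n e 1207959561 1025152 e))) 1207959564 42176 (n (n (n e 1207959569
    1025152 e) 1207959585 1025152 (n e 1208221705 1025152 e)) 1208221708 42176 (n (n e 1208221713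
    1025152 e) 1208221729 1025152 (n e 1224736777 1025152 e))))) 1224736780 42176 (n (n (n (n (n e
    1224736785 1025152 e) 1224736801 1025152 (n e 1224998921 1025152 e)) 1224998924 42176 (n (n e
    1224998929 1025152 e) 1224998945 1025152 (n e 2147483659 26400 e))) 2147483667 26400 (n (n (n e
    2147483669 26401 e) 2147483674 16928 (n e 2147483676 26401 e)) 2147483683 26400 (n (n e
    2147483690 26400 e) 2147483723 26400 (n e 2147483731 26400 e)))) 2147483733 26401 (n (n (n (n e
    2147483747 26400 e) 2147483811 26400 (n e 2147483925 26401 e)) 2147483989 26401 (n (n e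
    2147485738 1278496 e) 2147485795 26400 (n e 2147485859 26400 e))) 2147485866 1278496 (n (n (n e
    2147485923 26400 e) 2147549205 26401 (n e 2147549226 26400 e)) 2147549259 132 (n (n e 2147549267
    132 e) 2147549269 26401 e))))) 2147549283 132 (n (n (n (n (n (n e 2147549461 26401 e) 2147614795
    26373 (n e 2147614803 26373 e)) 2147614805 261 (n (n e 2147614819 26373 e) 2147680331 132 (n e
    2147680339 132 e))) 2147680341 261 (n (n (n e 2147680355 132 e) 2147746061 1277990 (n e
    2147746069 1277990 e)) 2147746085 1277990 (n (n e 2147747882 26400 e) 2147747884 1278502 (n e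
    2147748010 1278502 e)))) 2147748067 16422 (n (n (n (n e 2147748140 1278502 e) 2147811597 1277990
    (n e 2147811605 26401 e)) 2147811621 1277990 (n (n e 2147813420 1278502 e) 2147813669 1277990 (n
    e 2147813676 1278502 e))) 2148532299 26408 (n (n (n e 2148532307 26408 e) 2148532323 26408 (n e
    2148532325 26408 e)) 2148532387 26408 (n (n e 2148534314 1278496 e) 2148534371 26408 (n e
    2148534373 26408 e))))) 2148534435 26408 (n (n (n (n (n e 2148534442 26408 e) 2148534499 26408
    (n e 2148663371 26373 e)) 2148663379 26373 (n (n e 2148663395 26373 e) 2148796458 1278502 (n e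
    2148796521 1278502 e))) 2148796586 1278502 (n (n (n e 2149580809 616192 e) 2149580810 26400 (n e
    2149580812 616193 e)) 2149580817 616192 (n (n e 2149580833 616192 e) 2149581068 616193 (n e
    2149646604 4740 e)))) 2149842953 616192 (n (n (n (n e 2149842954 616193 e) 2149842956 616193 (n
    e 2149842961 616192 e)) 2149842977 616192 (n (n e 2149843212 616193 e) 2149845089 4736 (n e
    2149908748 616193 e))) 2150631521 4736 (n (n (n e 2150893665 26408 e) 2151677962 21536 (n e
    2151677970 21536 e)) 2151677972 26401 (n (n e 2151677986 21536 e) 2151743498 21536 e))))))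

def tabY100 : Tr := n tabY1000 1074004131 16434 tabY1001

def tabY1010 : Tr :=
  (n (n (n (n (n (n (n e 2151743508 26401 e) 2151743522 21536 (n e 2151809034 21536 e)) 2151809042
    21536 (n (n e 2151809044 26401 e) 2151809058 21536 (n e 2151874570 21536 e))) 2151874578 21536
    (n (n (n e 2151874580 26401 e) 2151874594 21536 (n e 2164260875 26400 e)) 2164260883 26400 (n (n
    e 2164260889 26401 e) 2164260890 26401 (n e 2164260892 26401 e)))) 2164260899 26400 (n (n (n (n
    e 2164260963 26400 e) 2164261003 26400 (n e 2164261011 26401 e)) 2164261027 26400 (n (n e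
    2164261141 32844 e) 2164262954 26400 (n e 2164263011 26400 e))) 2164263075 26400 (n (n (n e
    2164263082 33356 e) 2164326677 32844 (n e 2164392011 26369 e)) 2164392019 26401 (n (n e
    2164392035 26373 e) 2164394083 26373 (n e 2164457547 132 e))))) 2164457555 132 (n (n (n (n (n e
    2164457571 132 e) 2164523147 16422 (n e 2164523155 16422 e)) 2164523171 16422 (n (n e 2164523277
    32844 e) 2164523285 32844 (n e 2164523301 32844 e))) 2164525098 1278502 (n (n (n e 2164525100
    33356 e) 2164525226 1278502 (n e 2164525356 33356 e)) 2164588813 32844 (n (n e 2164588821 32844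
    e) 2164588837 32844 (n e 2164590636 33356 e)))) 2164590892 33356 (n (n (n (n e 2166358025 4736
    e) 2166358026 26400 (n e 2166358028 616193 e)) 2166358033 4736 (n (n e 2166358049 4736 e)
    2166358154 616193 (n e 2166358284 616193 e))) 2166620169 4736 (n (n (n e 2166620170 616193 e)
    2166620172 616193 (n e 2166620177 4736 e)) 2166620193 4736 (n (n e 2166620298 616193 e)
    2168455178 26400 e))))) 2168455185 26401 (n (n (n (n (n (n e 2168455186 26400 e) 2168455188
    26401 (n e 2168455202 21536 e)) 2168455444 26401 (n (n e 2168520714 26400 e) 2168520721 26401 (n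
    e 2168520722 26400 e))) 2168520724 26401 (n (n (n e 2168520738 26400 e) 2168520980 26401 (n e
    2168586250 21536 e)) 2168586257 26401 (n (n e 2168586258 21536 e) 2168586260 26401 (n e
    2168586274 21536 e)))) 2168586321 26401 (n (n (n (n e 2168651786 21536 e) 2168651793 26401 (n e
    2168651794 21536 e)) 2168651796 26401 (n (n e 2168651810 21536 e) 2168651857 26401 (n e
    2181038091 26400 e))) 2181038099 26400 (n (n (n e 2181038101 26401 e) 2181038106 16928 (n e
    2181038108 26401 e)) 2181038115 26400 (n (n e 2181038122 26400 e) 2181038155 26400 (n e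
    2181038163 26400 e))))) 2181038165 26401 (n (n (n (n (n e 2181038179 26400 e) 2181038243 26400
    (n e 2181038357 26401 e)) 2181038421 26401 (n (n e 2181040170 1278496 e) 2181040227 26400 (n e
    2181040291 26400 e))) 2181040298 1278496 (n (n (n e 2181040355 26400 e) 2181103637 26401 (n e
    2181103658 26400 e)) 2181103691 132 (n (n e 2181103699 132 e) 2181103701 26401 (n e 2181103715
    132 e)))) 2181103893 26401 (n (n (n (n e 2181169227 26373 e) 2181169235 26373 (n e 2181169237
    261 e)) 2181169251 26373 (n (n e 2181234763 132 e) 2181234771 132 (n e 2181234773 261 e)))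
    2181234787 132 (n (n (n e 2181300493 1277990 e) 2181300501 1277990 (n e 2181300517 1277990 e))
    2181302314 26400 (n (n e 2181302316 1278502 e) 2181302442 1278502 e))))))

def tabY1011 : Tr :=
  (n (n (n (n (n (n (n e 2181366029 1277990 e) 2181366037 26401 (n e 2181366053 1277990 e))
    2181367852 1278502 (n (n e 2181368101 1277990 e) 2181368108 1278502 (n e 2182086731 26408 e)))
    2182086739 26408 (n (n (n e 2182086755 26408 e) 2182086757 26408 (n e 2182086819 26408 e))
    2182088746 1278496 (n (n e 2182088803 26408 e) 2182088805 26408 (n e 2182088867 26408 e))))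
    2182088874 1278496 (n (n (n (n e 2182088931 26408 e) 2182217803 26373 (n e 2182217811 26373 e))
    2182217827 26373 (n (n e 2182350890 1278502 e) 2182350953 1278502 (n e 2182351018 1278502 e)))
    2182351075 16422 (n (n (n e 2183135241 616192 e) 2183135242 26400 (n e 2183135244 616193 e))
    2183135249 616192 (n (n e 2183135265 616192 e) 2183135500 616193 (n e 2183201036 4740 e)))))
    2183397385 616192 (n (n (n (n (n e 2183397386 616193 e) 2183397388 616193 (n e 2183397393 616192
    e)) 2183397409 616192 (n (n e 2183397644 616193 e) 2183463180 616193 (n e 2184185953 4736 e)))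
    2184448097 4736 (n (n (n e 2185232394 21536 e) 2185232402 21536 (n e 2185232404 26401 e))
    2185232418 21536 (n (n e 2185297930 21536 e) 2185297938 21536 (n e 2185297940 26401 e))))
    2185297954 21536 (n (n (n (n e 2185363466 21536 e) 2185363474 21536 (n e 2185363476 26401 e))
    2185363490 21536 (n (n e 2185429002 21536 e) 2185429010 21536 (n e 2185429012 26401 e)))
    2185429026 21536 (n (n (n e 2197815307 26400 e) 2197815315 26400 (n e 2197815321 26401 e))
    2197815322 16928 (n (n e 2197815324 26401 e) 2197815331 26400 e))))) 2197815371 26369 (n (n (n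
    (n (n (n e 2197815379 26400 e) 2197815385 26401 (n e 2197815395 26400 e)) 2197815435 26400 (n (n
    e 2197815443 26401 e) 2197815459 26400 (n e 2197815573 32844 e))) 2197815637 32844 (n (n (n e
    2197817443 26400 e) 2197817507 26400 (n e 2197817514 33356 e)) 2197880907 132 (n (n e 2197880915
    132 e) 2197880931 132 (n e 2197881109 32844 e)))) 2197946443 26369 (n (n (n (n e 2197946451
    26401 e) 2197946467 26373 (n e 2197948515 26373 e)) 2198011979 132 (n (n e 2198011987 132 e)
    2198012003 132 (n e 2198077579 16422 e))) 2198077587 16422 (n (n (n e 2198077603 16422 e)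
    2198077709 32844 (n e 2198077717 32844 e)) 2198077733 32844 (n (n e 2198079530 33356 e)
    2198079532 33356 (n e 2198079658 1278502 e))))) 2198079788 33356 (n (n (n (n (n e 2198143245
    32844 e) 2198143253 32844 (n e 2198143269 32844 e)) 2198145068 33356 (n (n e 2198145324 33356 e)
    2199912457 4736 (n e 2199912458 26400 e))) 2199912460 616193 (n (n (n e 2199912465 4736 e)
    2199912481 4736 (n e 2199912586 616193 e)) 2199912716 616193 (n (n e 2200174601 4736 e)
    2200174602 616193 (n e 2200174604 616193 e)))) 2200174609 4736 (n (n (n (n e 2200174625 4736 e)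
    2200174730 616193 (n e 2202009610 21536 e)) 2202009617 26401 (n (n e 2202009618 21536 e)
    2202009620 26401 (n e 2202009634 21536 e))) 2202009681 26401 (n (n (n e 2202075146 21536 e)
    2202075153 26401 (n e 2202075154 21536 e)) 2202075156 26401 (n (n e 2202075170 21536 e)
    2202075217 26401 e))))))

def tabY101 : Tr := n tabY1010 2181302572 1278502 tabY1011

def tabY10 : Tr := n tabY100 2151743506 21536 tabY101

def tabY1100 : Tr :=
  (n (n (n (n (n (n (n e 2202140689 26401 e) 2202140690 21536 (n e 2202140692 26401 e)) 2202140706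
    21536 (n (n e 2202140753 26401 e) 2202206218 21536 (n e 2202206225 26401 e))) 2202206226 21536
    (n (n (n e 2202206228 26401 e) 2202206242 21536 (n e 2202206289 26401 e)) 2281701386 26400 (n (n
    e 2281701393 7936 e) 2281766922 26400 (n e 2281766929 7936 e)))) 2281766930 26400 (n (n (n (n e
    2281766932 26401 e) 2281766946 26400 (n e 2281767188 26401 e)) 2281963529 7936 (n (n e
    2281963530 7937 e) 2281963532 7937 (n e 2281963537 7936 e))) 2281963553 7936 (n (n (n e
    2281963788 7937 e) 2282029065 7936 (n e 2282029066 26400 e)) 2282029068 7937 (n (n e 2282029073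
    7936 e) 2282029074 26400 (n e 2282029076 26401 e))))) 2282029089 7936 (n (n (n (n (n e
    2282029090 26400 e) 2282029324 7937 (n e 2282029332 26401 e)) 2298478602 26400 (n (n e
    2298478609 7936 e) 2298544138 26400 (n e 2298544145 7936 e))) 2298544146 26400 (n (n (n e
    2298544148 26401 e) 2298544162 26400 (n e 2298544404 26401 e)) 2298740745 7936 (n (n e
    2298740746 7937 e) 2298740748 7937 (n e 2298740753 7936 e)))) 2298740769 7936 (n (n (n (n e
    2298741004 7937 e) 2298806281 7936 (n e 2298806282 26400 e)) 2298806284 7937 (n (n e 2298806289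
    7936 e) 2298806290 26400 (n e 2298806292 26401 e))) 2298806305 7936 (n (n (n e 2298806306 26400
    e) 2298806540 7937 (n e 2298806548 26401 e)) 2315255818 26400 (n (n e 2315255825 7936 e)
    2315321354 26400 e))))) 2315321361 7936 (n (n (n (n (n (n e 2315321362 26400 e) 2315321364 26401
    (n e 2315321378 26400 e)) 2315321620 26401 (n (n e 2315517961 7936 e) 2315517962 7937 (n e
    2315517964 7937 e))) 2315517969 7936 (n (n (n e 2315517985 7936 e) 2315518220 7937 (n e
    2315583497 7936 e)) 2315583498 26400 (n (n e 2315583500 7937 e) 2315583505 7936 (n e 2315583506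
    26400 e)))) 2315583508 26401 (n (n (n (n e 2315583521 7936 e) 2315583522 26400 (n e 2315583756
    7937 e)) 2315583764 26401 (n (n e 2332033034 26400 e) 2332033041 7936 (n e 2332098570 26400 e)))
    2332098577 7936 (n (n (n e 2332098578 26400 e) 2332098580 26401 (n e 2332098594 26400 e))
    2332098836 26401 (n (n e 2332295177 7936 e) 2332295178 7937 (n e 2332295180 7937 e)))))
    2332295185 7936 (n (n (n (n (n e 2332295201 7936 e) 2332295436 7937 (n e 2332360713 7936 e))
    2332360714 26400 (n (n e 2332360716 7937 e) 2332360721 7936 (n e 2332360722 26400 e)))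
    2332360724 26401 (n (n (n e 2332360737 7936 e) 2332360738 26400 (n e 2332360972 7937 e))
    2332360980 26401 (n (n e 2415919114 1286176 e) 2415919122 1286176 (n e 2415919124 41024 e))))
    2415919138 1286176 (n (n (n (n e 2415984650 1286176 e) 2415984658 1286176 (n e 2415984660 41024
    e)) 2415984674 1286176 (n (n e 2449473546 1286176 e) 2449473554 1286176 (n e 2449473556 41024
    e))) 2449473570 1286176 (n (n (n e 2449539082 1286176 e) 2449539090 1286176 (n e 2449539092
    41024 e)) 2449539106 1286176 (n (n e 2684354570 1286688 e) 2684354578 1286688 e))))))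

def tabY1101 : Tr :=
  (n (n (n (n (n (n (n e 2684354594 1286688 e) 2684420106 1286688 (n e 2684420114 1286688 e))
    2684420116 41536 (n (n e 2684420130 1286688 e) 2684485642 26400 (n e 2684485650 1286688 e)))
    2684485652 41536 (n (n (n e 2684485666 26400 e) 2684551178 26400 (n e 2684551186 1286688 e))
    2684551188 41536 (n (n e 2684551202 26400 e) 2717909002 1286688 (n e 2717909010 1286688 e))))
    2717909012 41536 (n (n (n (n e 2717909026 1286688 e) 2717974538 1286688 (n e 2717974546 1286688
    e)) 2717974548 41536 (n (n e 2717974562 1286688 e) 2718040074 26400 (n e 2718040082 1286688 e)))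
    2718040084 41536 (n (n (n e 2718040098 26400 e) 2718105610 26400 (n e 2718105618 1286688 e))
    2718105620 41536 (n (n e 2718105634 26400 e) 4294967309 43200 (n e 4294967317 43200 e)))))
    4294967324 43200 (n (n (n (n (n e 4294967333 43200 e) 4294967340 33344 (n e 4294967373 257 e))
    4294967381 43200 (n (n e 4294967397 43200 e) 4294969445 43200 (n e 4295032909 43140 e)))
    4295032917 43140 (n (n (n e 4295032933 43140 e) 4295098396 43200 (n e 4295098445 261 e))
    4295098453 261 (n (n e 4295098469 261 e) 4295163981 43140 (n e 4295163989 43140 e)))) 4295164005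
    43140 (n (n (n (n e 4295229453 43200 e) 4295229461 43200 (n e 4295229477 43200 e)) 4295229484
    33344 (n (n e 4295229517 257 e) 4295229525 43200 (n e 4295229541 43200 e))) 4295231589 43200 (n
    (n (n e 4295295053 257 e) 4295295061 43140 (n e 4295295077 43140 e)) 4295297125 43140 (n (n e
    4295360589 261 e) 4295360597 261 e))))) 4295360613 261 (n (n (n (n (n (n e 4295426125 261 e)
    4295426133 261 (n e 4295426149 261 e)) 4296015885 43200 (n (n e 4296015893 43200 e) 4296015900
    43200 (n e 4296015909 43200 e))) 4296015916 33344 (n (n (n e 4296015949 257 e) 4296015957 43200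
    (n e 4296015973 43200 e)) 4296016149 43200 (n (n e 4296016165 43200 e) 4296018021 43200 (n e
    4296081485 43200 e)))) 4296081493 43200 (n (n (n (n e 4296081509 43200 e) 4296146972 43200 (n e
    4296147021 261 e)) 4296147029 261 (n (n e 4296147045 261 e) 4296212557 261 (n e 4296212565 261
    e))) 4296212581 261 (n (n (n e 4296278029 43200 e) 4296278037 43200 (n e 4296278053 43200 e))
    4296278060 33344 (n (n e 4296278093 257 e) 4296278101 43200 (n e 4296278117 43200 e)))))
    4296278293 43200 (n (n (n (n (n e 4296278309 43200 e) 4296280165 43200 (n e 4296343629 257 e))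
    4296343637 43140 (n (n e 4296343653 43140 e) 4296345701 43140 (n e 4296409165 261 e)))
    4296409173 261 (n (n (n e 4296409189 261 e) 4296474701 261 (n e 4296474709 261 e)) 4296474725
    261 (n (n e 4297064460 43200 e) 4297195532 43200 (n e 4297195540 43200 e)))) 4297195556 43200 (n
    (n (n (n e 4297326604 43200 e) 4297457676 43200 (n e 4297457684 43200 e)) 4297457700 43200 (n (n
    e 4298113036 43200 e) 4298244108 43200 (n e 4298244116 43200 e))) 4298244132 43200 (n (n (n e
    4298375180 43200 e) 4298506252 43200 (n e 4298506260 43200 e)) 4298506276 43200 (n (n e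
    4299161612 1332288 e) 4299161620 1332288 e))))))

def tabY110 : Tr := n tabY1100 2684354580 41536 tabY1101

def tabY1110 : Tr :=
  (n (n (n (n (n (n (n e 4299227148 1332288 e) 4299227156 1332288 (n e 4299227172 1332288 e))
    4299292684 1332288 (n (n e 4299292692 1332288 e) 4299292708 1332288 (n e 4299358220 1332288 e)))
    4299358228 1332288 (n (n (n e 4299358244 1332288 e) 4300210188 1332288 (n e 4300210196 1332288
    e)) 4300210212 1332288 (n (n e 4300275724 1332288 e) 4300275732 1332288 (n e 4300275748 1332288
    e)))) 4300341260 1332288 (n (n (n (n e 4300341268 1332288 e) 4300341284 1332288 (n e 4300406796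
    1332288 e)) 4300406804 1332288 (n (n e 4300406820 1332288 e) 4303355916 1332800 (n e 4303355924
    1332800 e))) 4303355940 1332800 (n (n (n e 4303486988 1332800 e) 4303486996 1332800 (n e
    4303487012 1332800 e)) 4304404492 1332800 (n (n e 4304404500 1332800 e) 4304404516 1332800 (n e
    4304535564 1332800 e))))) 4304535572 1332800 (n (n (n (n (n e 4304535588 1332800 e) 4311744651
    1327180 (n e 4311744659 1327180 e)) 4311744675 1327180 (n (n e 4311875723 1327180 e) 4311875731
    1327180 (n e 4311875747 1327180 e))) 4312006795 16422 (n (n (n e 4312006803 1327180 e)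
    4312006819 1327180 (n e 4312137867 16422 e)) 4312137875 16422 (n (n e 4312137891 16422 e)
    4312793227 1327180 (n e 4312793235 1327180 e)))) 4312793251 1327180 (n (n (n (n e 4312793365
    32844 e) 4312793381 32844 (n e 4312924299 1327180 e)) 4312924307 1327180 (n (n e 4312924323
    1327180 e) 4313055371 16422 (n e 4313055379 16422 e))) 4313055395 16422 (n (n (n e 4313055509
    32844 e) 4313055525 32844 (n e 4313186443 16422 e)) 4313186451 16422 (n (n e 4313186467 16422 e)
    4313841673 4736 e))))) 4313841676 43200 (n (n (n (n (n (n e 4313841681 4736 e) 4313841697 4736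
    (n e 4313972745 4736 e)) 4313972748 43200 (n (n e 4313972753 4736 e) 4313972756 43200 (n e
    4313972769 4736 e))) 4313972772 43200 (n (n (n e 4314103817 4736 e) 4314103820 43200 (n e
    4314103825 4736 e)) 4314103841 4736 (n (n e 4314234889 4736 e) 4314234892 43200 (n e 4314234897
    4736 e)))) 4314234900 43200 (n (n (n (n e 4314234913 4736 e) 4314234916 43200 (n e 4314890249
    4736 e)) 4314890252 43200 (n (n e 4314890257 4736 e) 4314890273 4736 (n e 4315021321 4736 e)))
    4315021324 43200 (n (n (n e 4315021329 4736 e) 4315021332 43200 (n e 4315021345 4736 e))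
    4315021348 43200 (n (n e 4315152393 4736 e) 4315152396 43200 (n e 4315152401 4736 e)))))
    4315152417 4736 (n (n (n (n (n e 4315283465 4736 e) 4315283468 43200 (n e 4315283473 4736 e))
    4315283476 43200 (n (n e 4315283489 4736 e) 4315283492 43200 (n e 4328521803 43213 e)))
    4328521811 43213 (n (n (n e 4328521827 43213 e) 4328521829 43213 (n e 4328521891 43213 e))
    4328523875 43213 (n (n e 4328523877 43213 e) 4328523939 43213 (n e 4328524003 43213 e))))
    4328587365 43140 (n (n (n (n e 4328589413 43140 e) 4329570379 43213 (n e 4329570387 43213 e))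
    4329570403 43213 (n (n e 4329570405 43213 e) 4329570467 43213 (n e 4329572451 43213 e)))
    4329572453 43213 (n (n (n e 4329572515 43213 e) 4329572579 43213 (n e 4329635941 43140 e))
    4329637989 43140 (n (n e 4345299107 1327180 e) 4345301155 1327180 e))))))

def tabY1111 : Tr :=
  (n (n (n (n (n (n (n e 4346349731 1327180 e) 4429185033 1026176 (n e 4429185036 43200 e))
    4429185041 1026176 (n (n e 4429185057 1026176 e) 4429447177 1026176 (n e 4429447180 43200 e)))
    4429447185 1026176 (n (n (n e 4429447201 1026176 e) 4430233609 1026176 (n e 4430233612 43200 e))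
    4430233617 7936 (n (n e 4430233633 7936 e) 4430495753 1026176 (n e 4430495756 43200 e))))
    4430495761 7936 (n (n (n (n e 4430495777 7936 e) 4445962249 1026176 (n e 4445962252 43200 e))
    4445962257 1026176 (n (n e 4445962273 1026176 e) 4446224393 1026176 (n e 4446224396 43200 e)))
    4446224401 1026176 (n (n (n e 4446224417 1026176 e) 4447010825 1026176 (n e 4447010828 43200 e))
    4447010833 7936 (n (n e 4447010849 7936 e) 4447272969 1026176 (n e 4447272972 43200 e)))))
    4447272977 7936 (n (n (n (n (n e 4447272993 7936 e) 4831838220 41536 (n e 4831838228 41536 e))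
    4831838244 41536 (n (n e 4831903756 41536 e) 4831903764 41536 (n e 4831903780 41536 e)))
    4831969292 41536 (n (n (n e 4831969300 41536 e) 4831969316 41536 (n e 4832034828 41536 e))
    4832034836 41536 (n (n e 4832034852 41536 e) 4832100364 41536 (n e 4832100372 41536 e))))
    4832100388 41536 (n (n (n (n e 4832165900 41536 e) 4832165908 41536 (n e 4832165924 41536 e))
    4832231436 41536 (n (n e 4832231444 41536 e) 4832231460 41536 (n e 4832296972 41536 e)))
    4832296980 41536 (n (n (n e 4832296996 41536 e) 4832886796 41536 (n e 4832886804 41536 e))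
    4832886820 41536 (n (n e 4832952332 41536 e) 4832952340 41536 e))))) 4832952356 41536 (n (n (n
    (n (n (n e 4833017868 41536 e) 4833017876 41536 (n e 4833017892 41536 e)) 4833083404 41536 (n (n
    e 4833083412 41536 e) 4833083428 41536 (n e 4833148940 41536 e))) 4833148948 41536 (n (n (n e
    4833148964 41536 e) 4833214476 41536 (n e 4833214484 41536 e)) 4833214500 41536 (n (n e
    4833280012 41536 e) 4833280020 41536 (n e 4833280036 41536 e)))) 4833345548 41536 (n (n (n (n e
    4833345556 41536 e) 4833345572 41536 (n e 8589934601 10880 e)) 8589934604 43712 (n (n e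
    8589934609 10880 e) 8589934625 10880 (n e 8590196745 10880 e))) 8590196748 43712 (n (n (n e
    8590196753 10880 e) 8590196769 10880 (n e 8606711817 10880 e)) 8606711820 43712 (n (n e
    8606711825 10880 e) 8606711841 10880 (n e 8606973961 10880 e))))) 8606973964 43712 (n (n (n (n
    (n e 8606973969 10880 e) 8606973985 10880 (n e 17179869194 27680 e)) 17179869202 27680 (n (n e
    17179869204 44096 e) 17179869218 27680 (n e 17179934730 27680 e))) 17179934738 27680 (n (n (n e
    17179934740 44096 e) 17179934754 27680 (n e 17213423626 27680 e)) 17213423634 27680 (n (n e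
    17213423636 44096 e) 17213423650 27680 (n e 17213489162 27680 e)))) 17213489170 27680 (n (n (n
    (n e 17213489172 44096 e) 17213489186 27680 (n e 34359738380 44608 e)) 34359738388 44608 (n (n e
    34359738404 44608 e) 34359869452 44608 (n e 34359869460 44608 e))) 34359869476 44608 (n (n (n e
    34360786956 44608 e) 34360786964 44608 (n e 34360786980 44608 e)) 34360918028 44608 (n (n e
    34360918036 44608 e) 34360918052 44608 e))))))

def tabY111 : Tr := n tabY1110 4346347683 1327180 tabY1111

def tabY11 : Tr := n tabY110 4299161636 1332288 tabY111

def tabY1 : Tr := n tabY10 2202140682 21536 tabY11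

def tabY : Tr := n tabY0 542113812 41536 tabY1


theorem okTabL : okTab tabL 3 6 tabL = true := by decide +kernel
theorem okTabY : okTab tabY 7 4 tabY = true := by decide +kernel
theorem okZeroL : okZero tabL 3 6 = true := by decide +kernel
theorem okZeroY : okZero tabY 7 4 = true := by decide +kernel

end G3

namespace G3

theorem tb_eq (m i : ℕ) : tb m i = m.testBit i := by
  have h : tb m i = decide ((m >>> i) &&& 1 = 1) := by
    unfold tb
    rw [Bool.eq_iff_iff, Nat.beq_eq, decide_eq_true_eq]
    rfl
  rw [h, Nat.testBit, Nat.and_comm, Nat.one_and_eq_mod_two]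
  rcases Nat.mod_two_eq_zero_or_one (m >>> i) with h | h <;> simp [h]

theorem isz_iff (a : ℕ) : isz a = true ↔ a = 0 := by simp [isz]

theorem isz_eq (a : ℕ) : isz a = decide (a = 0) := by
  rw [Bool.eq_iff_iff, isz_iff]; simp
theorem nbeq_eq (a b : ℕ) : Nat.beq a b = decide (a = b) := by
  rw [Bool.eq_iff_iff]; simp
theorem nble_eq (a b : ℕ) : Nat.ble a b = decide (a ≤ b) := by
  rw [Bool.eq_iff_iff]; simp [Nat.ble_eq]

section absT

variable {n : ℕ} (A B : Fin n) (τ σ : Fin n → ℕ)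

/-- the set of codes of undone other nodes -/
noncomputable def TT : ℕ :=
  Nat.ofBits (n := 24) (fun c => decide (∃ j, j ≠ A ∧ j ≠ B ∧ 3 * σ j + τ j = c ∧ done c = false))

theorem TT_bit (hσ : ∀ j, σ j < 8) (hτ : ∀ j, τ j < 3) (c : ℕ) :
    (TT A B τ σ).testBit c = true ↔
      ∃ j, j ≠ A ∧ j ≠ B ∧ 3 * σ j + τ j = c ∧ done c = false := by
  unfold TT
  by_cases hc : c < 24
  · rw [Nat.testBit_ofBits_lt _ _ hc]; simp
  · rw [Nat.testBit_ofBits_ge _ _ (by omega)]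
    constructor
    · simp
    · rintro ⟨j, -, -, h, -⟩
      have := hσ j; have := hτ j; omega

/-- node `j` has code `c` -/
def R (c : ℕ) (j : Fin n) : Prop :=
  (c = 0 ∧ j = A) ∨ (c = 1 ∧ j = B) ∨ (2 ≤ c ∧ j ≠ A ∧ j ≠ B ∧ 3 * σ j + τ j = c)

variable {A B τ σ}

theorem R_of_present (hσ : ∀ j, σ j < 8) (hτ : ∀ j, τ j < 3) (h1 : ∀ j, 0 < σ j) {c : ℕ}
    (h : present (TT A B τ σ) c = true) : ∃ j, R A B τ σ c j := by
  simp only [present, isz_eq, nbeq_eq, tb_eq, Bool.or_eq_true, decide_eq_true_eq] at h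
  rcases h with (h | h) | h
  · exact ⟨A, Or.inl ⟨h, rfl⟩⟩
  · exact ⟨B, Or.inr (Or.inl ⟨h, rfl⟩)⟩
  · obtain ⟨j, hA, hB, hj, -⟩ := (TT_bit A B τ σ hσ hτ c).1 h
    have := h1 j
    exact ⟨j, Or.inr (Or.inr ⟨by omega, hA, hB, hj⟩)⟩

theorem R_sup (hτ : ∀ j, τ j < 3) {c : ℕ} {j : Fin n} (h : R A B τ σ c j) :
    sup (σ A) (σ B) c = σ j := by
  rcases h with ⟨rfl, rfl⟩ | ⟨rfl, rfl⟩ | ⟨h, -, -, h2⟩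
  · simp [sup, isz_eq]
  · simp [sup, isz_eq, nbeq_eq]
  · have e : Nat.div c 3 = c / 3 := rfl
    simp only [sup, isz_eq, nbeq_eq, e]
    have := hτ j
    rw [decide_eq_false (by omega), decide_eq_false (by omega)]
    simp only [cond_false]; omega

theorem R_inj (hAB : A ≠ B) {c c' : ℕ} {j : Fin n} (h : R A B τ σ c j) (h' : R A B τ σ c' j) :
    c = c' := by
  unfold R at h h'
  grind

theorem R_mod (hτ : ∀ j, τ j < 3) {c : ℕ} {j : Fin n} (h : R A B τ σ c j) (hc : 2 ≤ c) :
    Nat.mod c 3 = τ j ∧ j ≠ A ∧ j ≠ B := by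
  rcases h with ⟨rfl, rfl⟩ | ⟨rfl, rfl⟩ | ⟨h, h3, h4, h2⟩
  · omega
  · omega
  · refine ⟨?_, h3, h4⟩
    have e : Nat.mod c 3 = c % 3 := rfl
    have := hτ j
    omega

theorem setA_eq {c S : ℕ} {j : Fin n} (hAB : A ≠ B) (h : R A B τ σ c j) :
    Function.update σ j S A = setA (σ A) c S := by
  rcases h with ⟨rfl, rfl⟩ | ⟨rfl, rfl⟩ | ⟨h, h3, h4, h2⟩
  · simp [setA, isz_eq]
  · simp [setA, isz_eq, hAB]
  · rw [Function.update_of_ne h3.symm]; simp [setA, isz_eq, show c ≠ 0 by omega]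

theorem setB_eq {c S : ℕ} {j : Fin n} (hAB : A ≠ B) (h : R A B τ σ c j) :
    Function.update σ j S B = setB (σ B) c S := by
  rcases h with ⟨rfl, rfl⟩ | ⟨rfl, rfl⟩ | ⟨h, h3, h4, h2⟩
  · simp [setB, nbeq_eq, hAB.symm]
  · simp [setB, nbeq_eq]
  · rw [Function.update_of_ne h4.symm]; simp [setB, nbeq_eq, show c ≠ 1 by omega]

theorem addC_bit (T c k : ℕ) : (addC T c).testBit k = true ↔
    T.testBit k = true ∨ (k = c ∧ done c = false) := by
  cases h : done c
  · rw [addC, h]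
    change (T ||| 2 ^ c).testBit k = true ↔ _
    rw [Nat.testBit_or, Nat.testBit_two_pow]
    grind
  · rw [addC, h]; simp

theorem setT_eq {c S : ℕ} {j : Fin n} (hσ : ∀ j, σ j < 8) (hτ : ∀ j, τ j < 3) (hS : S < 8)
    (h : R A B τ σ c j) (hp : present (TT A B τ σ) c = true) :
    (TT A B τ (Function.update σ j S) = setT (TT A B τ σ) c S false ∨
     TT A B τ (Function.update σ j S) = setT (TT A B τ σ) c S true) ∧
    ((∀ j', j' ≠ j → j' ≠ A → j' ≠ B → 3 * σ j' + τ j' ≠ c) →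
      TT A B τ (Function.update σ j S) = setT (TT A B τ σ) c S false) := by
  have hσ' : ∀ k, Function.update σ j S k < 8 := by
    intro k; by_cases hk : k = j
    · subst hk; simpa using hS
    · rw [Function.update_of_ne hk]; exact hσ k
  have hb := TT_bit A B τ σ hσ hτ
  have hb' := TT_bit A B τ _ hσ' hτ
  by_cases hc : c ≤ 1
  · have e : ∀ b, setT (TT A B τ σ) c S b = TT A B τ σ := by
      intro b; simp [setT, nble_eq, hc]
    have : TT A B τ (Function.update σ j S) = TT A B τ σ := by
      have hj : j = A ∨ j = B := by
        rcases h with h | h | h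
        · exact Or.inl h.2
        · exact Or.inr h.2
        · omega
      apply Nat.eq_of_testBit_eq
      intro k
      rw [Bool.eq_iff_iff, hb, hb']
      apply exists_congr
      intro i
      constructor
      · rintro ⟨h1, h2, h3, h4⟩
        rw [Function.update_of_ne (by grind)] at h3
        exact ⟨h1, h2, h3, h4⟩
      · rintro ⟨h1, h2, h3, h4⟩
        refine ⟨h1, h2, ?_, h4⟩
        rw [Function.update_of_ne (by grind)]
        exact h3
    simp [e, this]
  · have hc2 : 2 ≤ c := by omega
    obtain ⟨hm, hA, hB⟩ := R_mod hτ h hc2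
    have hbit : (TT A B τ σ).testBit c = true := by
      simp only [present, isz_eq, nbeq_eq, tb_eq, Bool.or_eq_true, decide_eq_true_eq] at hp
      rcases hp with (h | h) | h
      · omega
      · omega
      · exact h
    have hcj : 3 * σ j + τ j = c := by
      rcases h with h | h | h
      · omega
      · omega
      · exact h.2.2.2
    have e1 : ∀ b k, (setT (TT A B τ σ) c S b).testBit k = true ↔
        ((TT A B τ σ).testBit k = true ∧ (b = true ∨ k ≠ c)) ∨
          (k = 3 * S + τ j ∧ done k = false) := by
      intro b k
      have : newc c S = 3 * S + τ j := by
        change 3 * S + Nat.mod c 3 = _; rw [hm]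
      simp only [setT, nble_eq, decide_eq_false hc, cond_false]
      rw [addC_bit, this]
      cases b
      · simp only [cond_false]
        change (TT A B τ σ ^^^ 2 ^ c).testBit k = true ∨ _ ↔ _
        rw [Nat.testBit_xor, Nat.testBit_two_pow]
        by_cases hk : c = k
        · subst hk; simp [hbit]; grind
        · simp [hk, Ne.symm hk]; grind
      · simp; grind
    have e2 : ∀ k, (TT A B τ (Function.update σ j S)).testBit k = true ↔
        (∃ i, i ≠ j ∧ i ≠ A ∧ i ≠ B ∧ 3 * σ i + τ i = k ∧ done k = false) ∨
          (k = 3 * S + τ j ∧ done k = false) := by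
      intro k
      rw [hb']
      constructor
      · rintro ⟨i, h1, h2, h3, h4⟩
        by_cases hi : i = j
        · subst hi; right; simp at h3; exact ⟨h3.symm, h4⟩
        · left; rw [Function.update_of_ne hi] at h3; exact ⟨i, hi, h1, h2, h3, h4⟩
      · rintro (⟨i, hi, h1, h2, h3, h4⟩ | ⟨h1, h2⟩)
        · exact ⟨i, h1, h2, by rw [Function.update_of_ne hi]; exact h3, h4⟩
        · exact ⟨j, hA, hB, by simp [h1], h2⟩
    have e3 : (∀ j', j' ≠ j → j' ≠ A → j' ≠ B → 3 * σ j' + τ j' ≠ c) →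
      TT A B τ (Function.update σ j S) = setT (TT A B τ σ) c S false := by
      intro hu
      apply Nat.eq_of_testBit_eq
      intro k
      rw [Bool.eq_iff_iff, e1, e2, hb]
      grind
    refine ⟨?_, e3⟩
    by_cases hu : ∀ j', j' ≠ j → j' ≠ A → j' ≠ B → 3 * σ j' + τ j' ≠ c
    · exact Or.inl (e3 hu)
    · right
      push Not at hu
      obtain ⟨j', h1, h2, h3, h4⟩ := hu
      apply Nat.eq_of_testBit_eq
      intro k
      rw [Bool.eq_iff_iff, e1, e2, hb]
      grind

end absT
end G3

namespace G3

section rows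
variable {n : ℕ}

theorem circ_row2 {a b : Fin n → Fin 3} {j j' : Fin n} (hj : j ≠ j')
    (h : ∀ k, k ≠ j → k ≠ j' → a k = b k) (h1 : a j' = b j) (h2 : a j = b j') (i : Fin 3) :
    ∑ k, circ a b i k = 0 := by
  have : ∑ k, circ a b i k = ∑ k ∈ ({j, j'} : Finset (Fin n)), circ a b i k := by
    symm
    apply Finset.sum_subset (Finset.subset_univ _)
    intro k _ hk
    simp only [Finset.mem_insert, Finset.mem_singleton, not_or] at hk
    exact circ_zero (h k hk.1 hk.2)
  rw [this, Finset.sum_pair hj]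
  simp [circ, h1, h2]

theorem circ_row3 {a b : Fin n → Fin 3} {j j' j'' : Fin n} (hj : j ≠ j') (hj' : j ≠ j'')
    (hj'' : j' ≠ j'') (h : ∀ k, k ≠ j → k ≠ j' → k ≠ j'' → a k = b k) (h1 : a j' = b j)
    (h2 : a j'' = b j') (h3 : a j = b j'') (i : Fin 3) : ∑ k, circ a b i k = 0 := by
  have : ∑ k, circ a b i k = ∑ k ∈ ({j, j', j''} : Finset (Fin n)), circ a b i k := by
    symm
    apply Finset.sum_subset (Finset.subset_univ _)
    intro k _ hk
    simp only [Finset.mem_insert, Finset.mem_singleton, not_or] at hk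
    exact circ_zero (h k hk.1 hk.2.1 hk.2.2)
  rw [this, Finset.sum_insert (by simp [hj, hj']), Finset.sum_pair hj'']
  simp [circ, h1, h2, h3]

end rows

section masks
variable {n : ℕ} {u : Fin 3 → ℝ} {v : Fin n → ℝ}

/-- support mask of column `j` -/
noncomputable def mask (π : Equiv.Perm (Fin 3)) (y : Matrix (Fin 3) (Fin n) ℝ) (j : Fin n) : ℕ :=
  Nat.ofBits (fun x : Fin 3 => decide (0 < y (π x) j))

variable {π : Equiv.Perm (Fin 3)} {y F : Matrix (Fin 3) (Fin n) ℝ}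

theorem mask_lt (j : Fin n) : mask π y j < 8 := Nat.ofBits_lt_two_pow _

theorem mask_bit (j : Fin n) (x : Fin 3) : (mask π y j).testBit x = true ↔ 0 < y (π x) j := by
  unfold mask
  rw [Nat.testBit_ofBits_lt _ _ x.2]; simp

theorem bits_ext {S S' : ℕ} (hS : S < 8) (hS' : S' < 8)
    (h : ∀ x : Fin 3, S.testBit x = true ↔ S'.testBit x = true) : S = S' := by
  have : ∀ S < 8, ∀ S' < 8, (∀ x : Fin 3, S.testBit x = true ↔ S'.testBit x = true) → S = S' := by
    decide
  exact this S hS S' hS' h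

theorem mask_eq {S : ℕ} (hS : S < 8) {j : Fin n}
    (h : ∀ x : Fin 3, 0 < y (π x) j ↔ S.testBit x = true) : mask π y j = S :=
  bits_ext (mask_lt j) hS (fun x => by rw [mask_bit, h])

theorem sum_perm (j : Fin n) : ∑ i, y i j = ∑ x, y (π x) j :=
  (Equiv.sum_comp π (fun i => y i j)).symm

theorem mask_pos (hy : y ∈ TP 3 n u v) (hv : ∀ j, 0 < v j) (j : Fin n) : 0 < mask π y j := by
  rcases Nat.eq_zero_or_pos (mask π y j) with h | h
  · exfalso
    have h1 : ∀ x, y (π x) j = 0 := by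
      intro x
      have := mask_bit (π := π) (y := y) j x
      rw [h] at this
      simp at this
      exact le_antisymm this (hy.1 _ _)
    have := hy.2.2 j
    rw [sum_perm (π := π), Finset.sum_eq_zero (fun x _ => h1 x)] at this
    exact (hv j).ne this
  · exact h

theorem whole (hy : y ∈ TP 3 n u v) (hv : ∀ j, 0 < v j) (j : Fin n) (x : Fin 3) :
    mask π y j = 2 ^ (x : ℕ) ↔ y (π x) j = v j := by
  have hs := hy.2.2 j
  rw [sum_perm (π := π), Fin.sum_univ_three] at hs
  have p0 := hy.1 (π 0) j
  have p1 := hy.1 (π 1) j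
  have p2 := hy.1 (π 2) j
  have hvj := hv j
  have key : ∀ S < 8, ∀ x : Fin 3, (S = 2 ^ (x : ℕ) ↔
    ∀ z : Fin 3, (S.testBit z = true ↔ z = x)) := by decide
  rw [key _ (mask_lt j)]
  simp only [mask_bit]
  constructor
  · intro h
    have h0 := h 0; have h1 := h 1; have h2 := h 2
    fin_cases x <;> simp at h0 h1 h2 ⊢ <;> linarith
  · intro h z
    fin_cases x <;> fin_cases z <;> simp at h ⊢ <;> linarith

theorem acyc (hy : y ∈ Set.extremePoints ℝ (TP 3 n u v)) {j j' : Fin n} (hj : j ≠ j')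
    {i i' : Fin 3} (hi : i ≠ i') (h1 : 0 < y i j) (h2 : 0 < y i' j) (h3 : 0 < y i j')
    (h4 : 0 < y i' j') : False := by
  set a : Fin n → Fin 3 := Function.update (Function.update (fun _ => 0) j i) j' i' with ha
  set b : Fin n → Fin 3 := Function.update (Function.update (fun _ => 0) j i') j' i with hb
  have aj : a j = i := by simp [ha, hj]
  have aj' : a j' = i' := by simp [ha]
  have bj : b j = i' := by simp [hb, hj]
  have bj' : b j' = i := by simp [hb]
  have hne : ∀ k, k ≠ j → k ≠ j' → a k = b k := by
    intro k h1 h2; simp [ha, hb, h1, h2]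
  have := indep hy (circ a b) (circ_row2 hj hne (by rw [aj', bj]) (by rw [aj, bj']))
    (circ_col a b) (by
      intro k l h0
      by_cases hl : l = j
      · subst hl
        have e1 : k ≠ i := fun h => by rw [h] at h0; exact h1.ne' h0
        have e2 : k ≠ i' := fun h => by rw [h] at h0; exact h2.ne' h0
        simp [circ, aj, bj, e1, e2]
      · by_cases hl' : l = j'
        · subst hl'
          have e1 : k ≠ i := fun h => by rw [h] at h0; exact h3.ne' h0
          have e2 : k ≠ i' := fun h => by rw [h] at h0; exact h4.ne' h0
          simp [circ, aj', bj', e1, e2]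
        · exact circ_zero (hne l hl hl'))
  have h5 := congrFun (congrFun this i') j
  simp [circ, aj, bj, hi.symm] at h5

theorem acyc_mask (hy : y ∈ Set.extremePoints ℝ (TP 3 n u v)) {j j' : Fin n} (hj : j ≠ j')
    {x z : Fin 3} (hx : x ≠ z) (h1 : (mask π y j).testBit x = true)
    (h2 : (mask π y j).testBit z = true) (h3 : (mask π y j').testBit x = true)
    (h4 : (mask π y j').testBit z = true) : False := by
  rw [mask_bit] at h1 h2 h3 h4
  exact acyc hy hj (fun h => hx (π.injective h)) h1 h2 h3 h4

theorem no_confl (hy : y ∈ Set.extremePoints ℝ (TP 3 n u v)) {j j' : Fin n} (hj : j ≠ j') :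
    confl (mask π y j) (mask π y j') = false := by
  have key : ∀ S < 8, ∀ S' < 8, confl S S' = true →
      ((S &&& S').testBit 0 = true ∧ (S &&& S').testBit 1 = true) ∨
      ((S &&& S').testBit 0 = true ∧ (S &&& S').testBit 2 = true) ∨
      ((S &&& S').testBit 1 = true ∧ (S &&& S').testBit 2 = true) := by
    decide
  cases h : confl (mask π y j) (mask π y j')
  · rfl
  · have h' := key _ (mask_lt j) _ (mask_lt j') h
    simp only [Nat.testBit_and, Bool.and_eq_true] at h'
    rcases h' with h | h | h
    · exact (acyc_mask hy hj (x := 0) (z := 1) (by decide) h.1.1 h.2.1 h.1.2 h.2.2).elim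
    · exact (acyc_mask hy hj (x := 0) (z := 2) (by decide) h.1.1 h.2.1 h.1.2 h.2.2).elim
    · exact (acyc_mask hy hj (x := 1) (z := 2) (by decide) h.1.1 h.2.1 h.1.2 h.2.2).elim

theorem sum_exc (hnd : NonDeg 3 n u v) (hv : ∀ j, 0 < v j)
    (hy : y ∈ Set.extremePoints ℝ (TP 3 n u v)) : ∑ j, exc (mask π y j) = 2 := by
  have h1 : ∑ j, (exc (mask π y j) + 1) = n + 2 := by
    have h2 := hnd y hy
    have h3 : (suppF 3 n y).card = ∑ j, ∑ i, if 0 < y i j then 1 else 0 := by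
      rw [suppF, Finset.card_filter, Fintype.sum_prod_type_right]
    rw [h3] at h2
    rw [show n + 2 = 3 + n - 1 by omega, ← h2]
    apply Finset.sum_congr rfl
    intro j _
    rw [← Equiv.sum_comp π]
    simp only [← mask_bit]
    have key : ∀ S < 8, 0 < S → exc S + 1 = ∑ x : Fin 3, if S.testBit x = true then 1 else 0 := by
      decide
    exact key _ (mask_lt j) (mask_pos hy.1 hv j)
  rw [Finset.sum_add_distrib] at h1
  simp at h1
  omega

theorem gE_le (hy : y ∈ TP 3 n u v) (hF : F ∈ TP 3 n u v) (hv : ∀ j, 0 < v j) {j : Fin n}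
    {x : Fin 3} (h : gE (mask π y j) (mask π F j) x = true) : F (π x) j ≤ y (π x) j := by
  simp only [gE, tb_eq, nbeq_eq, Bool.or_eq_true, Bool.not_eq_true', decide_eq_true_eq] at h
  rcases h with h | h
  · have : ¬ 0 < F (π x) j := by rw [← mask_bit]; simp [h]
    exact (not_lt.1 this).trans (hy.1 _ _)
  · have h2 := (whole hy hv j x).1 h
    rw [h2, ← hF.2.2 j]
    exact Finset.single_le_sum (f := fun i => F i j) (fun i _ => hF.1 i j) (Finset.mem_univ _)

theorem gS_lt (hy : y ∈ TP 3 n u v) (hF : F ∈ TP 3 n u v) (hv : ∀ j, 0 < v j) {j : Fin n}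
    {x : Fin 3} (h : gS (mask π y j) (mask π F j) x = true) : F (π x) j < y (π x) j := by
  simp only [gS, tb_eq, nbeq_eq, Bool.or_eq_true, Bool.and_eq_true, Bool.not_eq_true',
    decide_eq_true_eq, decide_eq_false_iff_not] at h
  rcases h with h | h
  · have : ¬ 0 < F (π x) j := by rw [← mask_bit]; simp [h.2]
    exact (not_lt.1 this).trans_lt ((mask_bit j x).1 h.1)
  · have h2 := (whole hy hv j x).1 h.1
    have h3 : ¬ F (π x) j = v j := fun h' => h.2 ((whole hF hv j x).2 h')
    rw [h2]
    refine lt_of_le_of_ne ?_ h3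
    rw [← hF.2.2 j]
    exact Finset.single_le_sum (f := fun i => F i j) (fun i _ => hF.1 i j) (Finset.mem_univ _)

theorem done_iff : ∀ S < 8, ∀ t < 3, (done (3 * S + t) = true ↔ S = 2 ^ t) := by decide

theorem isz_and {T M k : ℕ} (h : isz (Nat.land T M) = true) (hT : T.testBit k = true)
    (hM : M.testBit k = true) : False := by
  have h1 : T &&& M = 0 := (isz_iff _).1 h
  have : (T &&& M).testBit k = true := by rw [Nat.testBit_and, hT, hM]; rfl
  rw [h1] at this; simp at this

theorem feas (hy : y ∈ TP 3 n u v) (hF : F ∈ TP 3 n u v) (hv : ∀ j, 0 < v j) {A B : Fin n}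
    (hAB : A ≠ B) {τ : Fin n → ℕ} (hτ : ∀ j, τ j < 3)
    (hτF : ∀ j, j ≠ A → j ≠ B → mask π F j = 2 ^ τ j) :
    infeas (mask π F A) (mask π F B) (mask π y A) (mask π y B) (TT A B τ (mask π y)) = false := by
  have main : ∀ x : Fin 3, infeasX (mask π F A) (mask π F B) (mask π y A) (mask π y B)
      (TT A B τ (mask π y)) x = false := by
    intro x
    have hb := TT_bit A B τ (mask π y) (fun j => mask_lt j) hτ
    have hrow : ∑ j, y (π x) j = ∑ j, F (π x) j := by rw [hy.2.1, hF.2.1]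
    -- a weak inequality everywhere with a strict one is impossible
    have strict : ∀ y F : Matrix (Fin 3) (Fin n) ℝ, y ∈ TP 3 n u v → F ∈ TP 3 n u v →
        (∑ j, y (π x) j = ∑ j, F (π x) j) →
        (∀ j, j ≠ A → j ≠ B → F (π x) j ≤ y (π x) j) →
        gE (mask π y A) (mask π F A) x = true → gE (mask π y B) (mask π F B) x = true →
        (gS (mask π y A) (mask π F A) x = true ∨ gS (mask π y B) (mask π F B) x = true) →
        False := by
      intro y F hy hF hrow ho hA hB hS
      have hall : ∀ j, F (π x) j ≤ y (π x) j := by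
        intro j
        by_cases h1 : j = A
        · subst h1; exact gE_le hy hF hv hA
        · by_cases h2 : j = B
          · subst h2; exact gE_le hy hF hv hB
          · exact ho j h1 h2
      have : ∑ j, F (π x) j < ∑ j, y (π x) j := by
        apply Finset.sum_lt_sum (fun j _ => hall j)
        rcases hS with h | h
        · exact ⟨A, Finset.mem_univ _, gS_lt hy hF hv h⟩
        · exact ⟨B, Finset.mem_univ _, gS_lt hy hF hv h⟩
      linarith
    rw [Bool.eq_false_iff]
    intro h
    simp only [infeasX, Bool.or_eq_true, Bool.and_eq_true] at h
    rcases h with ⟨h1, h2, h3, h4⟩ | ⟨h1, h2, h3, h4⟩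
    · refine strict y F hy hF hrow ?_ h2 h3 h4
      intro j hA hB
      by_cases hx : τ j = x
      · have hw := hτF j hA hB
        rw [hx] at hw
        by_cases hd : done (3 * mask π y j + τ j) = true
        · have := (done_iff _ (mask_lt j) _ (hτ j)).1 hd
          rw [hx] at this
          rw [(whole hF hv j x).1 hw, (whole hy hv j x).1 this]
        · exfalso
          refine isz_and h1 ((hb _).2 ⟨j, hA, hB, rfl, by simpa using hd⟩) ?_
          have key : ∀ S < 8, 0 < S → ∀ x : Fin 3,
            (Nat.shiftLeft 2396744 x).testBit (3 * S + x) = true := by decide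
          rw [hx]
          exact key _ (mask_lt j) (mask_pos hy hv j) x
      · have : ¬ 0 < F (π x) j := by
          rw [← mask_bit, hτF j hA hB, Nat.testBit_two_pow]; simpa using hx
        exact (not_lt.1 this).trans (hy.1 _ _)
    · refine strict F y hF hy hrow.symm ?_ h2 h3 h4
      intro j hA hB
      by_cases hx : τ j = x
      · have hw := hτF j hA hB
        rw [hx] at hw
        rw [(whole hF hv j x).1 hw, ← hy.2.2 j]
        exact Finset.single_le_sum (f := fun i => y i j) (fun i _ => hy.1 i j) (Finset.mem_univ _)
      · by_cases hp : 0 < y (π x) j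
        · exfalso
          rw [← mask_bit] at hp
          have key : ∀ S < 8, ∀ x : Fin 3, ∀ t < 3, S.testBit x = true → t ≠ (x : ℕ) →
            (outMask x).testBit (3 * S + t) = true ∧ done (3 * S + t) = false := by decide
          have k := key _ (mask_lt j) x _ (hτ j) hp hx
          exact isz_and h1 ((hb _).2 ⟨j, hA, hB, rfl, k.2⟩) k.1
        · exact (not_lt.1 hp).trans (hF.1 _ _)
  simp only [infeas, Bool.or_eq_false_iff]
  exact ⟨main 0, main 1, main 2⟩

end masks
end G3

namespace G3

theorem lor_bits : ∀ S < 8, ∀ t : Fin 3, Nat.lor S (Nat.pow 2 t) < 8 ∧ ∀ i : Fin 3,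
    ((Nat.lor S (Nat.pow 2 t)).testBit i = true ↔ S.testBit i = true ∨ i = t) := by decide

theorem xor_bits : ∀ S < 8, ∀ x : Fin 3, S.testBit x = true → Nat.xor S (Nat.pow 2 x) < 8 ∧
    ∀ i : Fin 3, ((Nat.xor S (Nat.pow 2 x)).testBit i = true ↔ S.testBit i = true ∧ i ≠ x) := by
  decide

section step
variable {n : ℕ} {u : Fin 3 → ℝ} {v : Fin n → ℝ}
variable {π : Equiv.Perm (Fin 3)} {y F : Matrix (Fin 3) (Fin n) ℝ} {A B : Fin n} {τ : Fin n → ℕ}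

theorem mover {σ : Fin n → ℕ} (hAB : A ≠ B) (hσ : ∀ j, σ j < 8) (hτ : ∀ j, τ j < 3)
    {tab : Tr} {FA FB MA MB : ℕ} {pr sg : Bool} {c S : ℕ} {j : Fin n} (hR : R A B τ σ c j)
    (hp : present (TT A B τ σ) c = true) (hS : S < 8)
    (hu : sg = false → ∀ j', j' ≠ j → j' ≠ A → j' ≠ B → 3 * σ j' + τ j' ≠ c)
    (h : okMover tab FA FB (σ A) (σ B) MA MB (TT A B τ σ) pr c S sg = true) :
    okOut tab FA FB MA MB pr (Function.update σ j S A) (Function.update σ j S B)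
      (TT A B τ (Function.update σ j S)) = true := by
  rw [setA_eq hAB hR, setB_eq hAB hR]
  simp only [okMover, Bool.and_eq_true] at h
  obtain ⟨h1, h2⟩ := setT_eq hσ hτ hS hR hp
  cases sg
  · rw [h2 (hu rfl)]; exact h.1
  · rcases h1 with h1 | h1
    · rw [h1]; exact h.1
    · rw [h1]; simpa using h.2

theorem uniq (hy : y ∈ Set.extremePoints ℝ (TP 3 n u v)) (hτ : ∀ j, τ j < 3) {σ : Fin n → ℕ}
    (hv : ∀ j, 0 < v j) (hpos : ∀ j, 0 < σ j)
    (hsub : ∀ j (x : Fin 3), (σ j).testBit x = true → (mask π y j).testBit x = true) {j : Fin n}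
    (hj : σ j = mask π y j) (hns : single (mask π y j) = false) {c : ℕ} (hR : R A B τ σ c j) :
    ∀ j', j' ≠ j → j' ≠ A → j' ≠ B → 3 * σ j' + τ j' ≠ c := by
  intro j' h1 h2 h3 h4
  have h5 := hpos j'
  have h6 : 3 * σ j + τ j = c := by
    rcases hR with h | h | h
    · omega
    · omega
    · exact h.2.2.2
  have h7 : σ j' = σ j := by have := hτ j; have := hτ j'; omega
  have key : ∀ S < 8, 0 < S → single S = false →
      (S.testBit 0 = true ∧ S.testBit 1 = true) ∨
      (S.testBit 0 = true ∧ S.testBit 2 = true) ∨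
      (S.testBit 1 = true ∧ S.testBit 2 = true) := by
    decide
  have s0 := hsub j'
  rw [h7, hj] at s0
  rcases key _ (mask_lt j) (mask_pos hy.1 hv j) hns with h | h | h
  · exact acyc_mask hy h1.symm (x := 0) (z := 1) (by decide) h.1 h.2 (s0 0 h.1) (s0 1 h.2)
  · exact acyc_mask hy h1.symm (x := 0) (z := 2) (by decide) h.1 h.2 (s0 0 h.1) (s0 2 h.2)
  · exact acyc_mask hy h1.symm (x := 1) (z := 2) (by decide) h.1 h.2 (s0 1 h.1) (s0 2 h.2)

/-- the mover itself loses an edge -/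
theorem out0 (hy : y ∈ Set.extremePoints ℝ (TP 3 n u v)) (hv : ∀ j, 0 < v j) (hAB : A ≠ B)
    (hτ : ∀ j, τ j < 3) {tab : Tr} {FA FB MA MB c0 : ℕ} {pr : Bool} {j0 : Fin n} {s t : Fin 3}
    (hR : R A B τ (mask π y) c0 j0) (hp : present (TT A B τ (mask π y)) c0 = true)
    (hs : (mask π y j0).testBit s = true) {y' : Matrix (Fin 3) (Fin n) ℝ}
    (hy' : ∀ i j, (0 < y' (π i) j ↔ (0 < y (π i) j ∨ (i = t ∧ j = j0)) ∧ ¬ (i = s ∧ j = j0)))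
    (h : okMover tab FA FB (mask π y A) (mask π y B) MA MB (TT A B τ (mask π y)) pr c0
      (Nat.xor (Nat.lor (sup (mask π y A) (mask π y B) c0) (Nat.pow 2 t)) (Nat.pow 2 s))
      (single (sup (mask π y A) (mask π y B) c0)) = true) :
    okOut tab FA FB MA MB pr (mask π y' A) (mask π y' B) (TT A B τ (mask π y')) = true := by
  rw [R_sup hτ hR] at h
  obtain ⟨l1, l2⟩ := lor_bits _ (mask_lt (π := π) (y := y) j0) t
  obtain ⟨x1, x2⟩ := xor_bits _ l1 s ((l2 s).2 (Or.inl hs))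
  have e : mask π y' = Function.update (mask π y) j0
      (Nat.xor (Nat.lor (mask π y j0) (Nat.pow 2 t)) (Nat.pow 2 s)) := by
    funext j
    by_cases hj : j = j0
    · subst hj
      rw [Function.update_self]
      refine mask_eq x1 (fun i => ?_)
      rw [hy', x2, l2, mask_bit]; simp
    · rw [Function.update_of_ne hj]
      refine mask_eq (mask_lt j) (fun i => ?_)
      rw [hy', mask_bit]; simp [hj]
  rw [e]
  refine mover hAB (fun j => mask_lt j) hτ hR hp x1 ?_ h
  intro hsg
  exact uniq (π := π) hy hτ hv (mask_pos hy.1 hv) (fun _ _ h => h) rfl hsg hR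

/-- a compensating node loses an edge -/
theorem out1 (hy : y ∈ Set.extremePoints ℝ (TP 3 n u v)) (hv : ∀ j, 0 < v j) (hAB : A ≠ B)
    (hτ : ∀ j, τ j < 3) {tab : Tr} {FA FB MA MB c0 c : ℕ} {j0 g : Fin n} {x z t : Fin 3}
    (hR : R A B τ (mask π y) c0 j0) (hp : present (TT A B τ (mask π y)) c0 = true)
    (hRg : R A B τ (mask π y) c g) (hpg : present (TT A B τ (mask π y)) c = true) (hg : g ≠ j0)
    (hx : (mask π y g).testBit x = true) (hz : (mask π y g).testBit z = true) (hxz : x ≠ z)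
    {y' : Matrix (Fin 3) (Fin n) ℝ}
    (hy' : ∀ i j, (0 < y' (π i) j ↔ (0 < y (π i) j ∨ (i = t ∧ j = j0)) ∧ ¬ (i = x ∧ j = g)))
    (h : okComp tab FA FB (mask π y A) (mask π y B) MA MB (TT A B τ (mask π y)) c x c0
      (Nat.lor (sup (mask π y A) (mask π y B) c0) (Nat.pow 2 t))
      (single (sup (mask π y A) (mask π y B) c0)) = true) :
    okOut tab FA FB MA MB (prot MA MB c x) (mask π y' A) (mask π y' B)
      (TT A B τ (mask π y')) = true := by
  unfold okComp at h
  rw [R_sup hτ hR, R_sup hτ hRg] at h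
  obtain ⟨l1, l2⟩ := lor_bits _ (mask_lt (π := π) (y := y) j0) t
  obtain ⟨x1, x2⟩ := xor_bits _ (mask_lt (π := π) (y := y) g) x hx
  set Sg := Nat.xor (mask π y g) (Nat.pow 2 x) with hSg
  set σ := Function.update (mask π y) g Sg with hσ
  have σg : σ g = Sg := by simp [hσ]
  have σn : ∀ j, j ≠ g → σ j = mask π y j := fun j hj => by simp [hσ, hj]
  have e : mask π y' = Function.update σ j0 (Nat.lor (mask π y j0) (Nat.pow 2 t)) := by
    funext j
    by_cases hj : j = j0
    · subst hj
      rw [Function.update_self]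
      refine mask_eq l1 (fun i => ?_)
      rw [hy', l2, mask_bit]; simp [hg.symm]
    · rw [Function.update_of_ne hj]
      by_cases hjg : j = g
      · subst hjg
        rw [σg]
        refine mask_eq x1 (fun i => ?_)
        rw [hy', x2, mask_bit]; simp [hj]
      · rw [σn j hjg]
        refine mask_eq (mask_lt j) (fun i => ?_)
        rw [hy', mask_bit]; simp [hj, hjg]
  have nsg : single (mask π y g) = false := by
    have key : ∀ S < 8, ∀ x z : Fin 3, x ≠ z → S.testBit x = true → S.testBit z = true →
      single S = false := by decide
    exact key _ (mask_lt g) x z hxz hx hz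
  have hT : TT A B τ σ = setT (TT A B τ (mask π y)) c Sg false :=
    (setT_eq (fun j => mask_lt j) hτ x1 hRg hpg).2
      (uniq (π := π) hy hτ hv (mask_pos hy.1 hv) (fun _ _ h => h) rfl nsg hRg)
  rw [← hT, ← setA_eq hAB hRg, ← setB_eq hAB hRg] at h
  have hσ8 : ∀ j, σ j < 8 := by
    intro j; by_cases hj : j = g
    · rw [hj, σg]; exact x1
    · rw [σn j hj]; exact mask_lt j
  have hσsub : ∀ j (i : Fin 3), (σ j).testBit i = true → (mask π y j).testBit i = true := by
    intro j i hi
    by_cases hj : j = g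
    · rw [hj, σg, x2] at hi; rw [hj]; exact hi.1
    · rwa [σn j hj] at hi
  have hσpos : ∀ j, 0 < σ j := by
    intro j; by_cases hj : j = g
    · rw [hj, σg]
      rcases Nat.eq_zero_or_pos Sg with h | h
      · have := (x2 z).2 ⟨hz, hxz.symm⟩
        rw [h] at this; simp at this
      · exact h
    · rw [σn j hj]; exact mask_pos hy.1 hv j
  have hR' : R A B τ σ c0 j0 := by
    unfold R at hR ⊢
    rw [σn j0 hg.symm]; exact hR
  have hp' : present (TT A B τ σ) c0 = true := by
    simp only [present, isz_eq, nbeq_eq, tb_eq, Bool.or_eq_true, decide_eq_true_eq] at hp ⊢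
    rcases hp with h | h
    · exact Or.inl h
    · by_cases hc : c0 = 0 ∨ c0 = 1
      · exact Or.inl hc
      · right
        obtain ⟨-, -, -, -, hd⟩ := (TT_bit A B τ _ (fun j => mask_lt j) hτ _).1 h
        refine (TT_bit A B τ _ hσ8 hτ _).2 ⟨j0, ?_⟩
        rcases hR' with h | h | h
        · omega
        · omega
        · exact ⟨h.2.1, h.2.2.1, h.2.2.2, hd⟩
  rw [e]
  refine mover hAB hσ8 hτ hR' hp' l1 ?_ h
  intro hsg
  exact uniq (π := π) hy hτ hv hσpos hσsub (σn j0 hg.symm) hsg hR'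

end step
end G3

namespace G3

section step
variable {n : ℕ} {u : Fin 3 → ℝ} {v : Fin n → ℝ}
variable {π : Equiv.Perm (Fin 3)} {y F : Matrix (Fin 3) (Fin n) ℝ} {A B : Fin n} {τ : Fin n → ℕ}

theorem pick2 (hnd : NonDeg 3 n u v) (hy : y ∈ Set.extremePoints ℝ (TP 3 n u v))
    {j0 j1 : Fin n} {s t : Fin 3} (h01 : j0 ≠ j1)
    (hs : 0 < y (π s) j0) (ht : ¬ 0 < y (π t) j0)
    (h1 : 0 < y (π t) j1) (h2 : 0 < y (π s) j1) :
    ∃ y', AdjVert 3 n u v y y' ∧ ∃ g x, ((g = j0 ∧ x = s) ∨ (g = j1 ∧ x = t)) ∧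
      ∀ i j, (0 < y' (π i) j ↔ (0 < y (π i) j ∨ (i = t ∧ j = j0)) ∧ ¬ (i = x ∧ j = g)) := by
  have hst : s ≠ t := by rintro rfl; exact ht hs
  obtain ⟨z, hz, g, hg, h⟩ := pivot hnd hy
    (fun j => if j = j0 then π s else if j = j1 then π t else π 0)
    (fun j => if j = j0 then π t else if j = j1 then π s else π 0) j0
    (circ_row2 h01 (fun k a b => by simp [a, b]) (by simp [h01.symm]) (by simp [h01.symm]))
    (by simpa using hst)
    (by simpa using le_antisymm (not_lt.1 ht) (hy.1.1 _ _))
    (fun j hj => by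
      by_cases a : j = j0
      · subst a; simpa using hs
      · by_cases b : j = j1
        · subst b; simpa [a] using h1
        · simp [a, b] at hj)
    (fun j a hj => by
        by_cases b : j = j1
        · subst b; simpa [a] using h2
        · simp [a, b] at hj)
  refine ⟨z, hz, g, if g = j0 then s else t, ?_, ?_⟩
  · by_cases a : g = j0
    · simp [a]
    · by_cases b : g = j1
      · subst b; simp [a]
      · simp [a, b] at hg
  · intro i j
    rw [h]
    by_cases a : g = j0
    · simp [a]
    · by_cases b : g = j1
      · subst b; simp [a]
      · simp [a, b] at hg

theorem pick3 (hnd : NonDeg 3 n u v) (hy : y ∈ Set.extremePoints ℝ (TP 3 n u v))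
    {j0 j1 j2 : Fin n} {s t z : Fin 3} (h01 : j0 ≠ j1) (h02 : j0 ≠ j2) (h12 : j1 ≠ j2)
    (hs : 0 < y (π s) j0) (ht : ¬ 0 < y (π t) j0) (hzs : z ≠ s) (htz : t ≠ z)
    (h1 : 0 < y (π t) j1) (h2 : 0 < y (π z) j1) (h3 : 0 < y (π z) j2) (h4 : 0 < y (π s) j2) :
    ∃ y', AdjVert 3 n u v y y' ∧ ∃ g x,
      ((g = j0 ∧ x = s) ∨ (g = j1 ∧ x = t) ∨ (g = j2 ∧ x = z)) ∧
      ∀ i j, (0 < y' (π i) j ↔ (0 < y (π i) j ∨ (i = t ∧ j = j0)) ∧ ¬ (i = x ∧ j = g)) := by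
  have hst : s ≠ t := by rintro rfl; exact ht hs
  obtain ⟨w, hz, g, hg, h⟩ := pivot hnd hy
    (fun j => if j = j0 then π s else if j = j1 then π t else if j = j2 then π z else π 0)
    (fun j => if j = j0 then π t else if j = j1 then π z else if j = j2 then π s else π 0) j0
    (circ_row3 h01 h02 h12 (fun k a b c => by simp [a, b, c]) (by simp [h01.symm])
      (by simp [h01.symm, h02.symm, h12.symm]) (by simp [h02.symm, h12.symm]))
    (by simpa using hst)
    (by simpa using le_antisymm (not_lt.1 ht) (hy.1.1 _ _))
    (fun j hj => by
      by_cases a : j = j0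
      · subst a; simpa using hs
      · by_cases b : j = j1
        · subst b; simpa [a] using h1
        · by_cases c : j = j2
          · subst c; simpa [a, b] using h3
          · simp [a, b, c] at hj)
    (fun j a hj => by
        by_cases b : j = j1
        · subst b; simpa [a] using h2
        · by_cases c : j = j2
          · subst c; simpa [a, b] using h4
          · simp [a, b, c] at hj)
  refine ⟨w, hz, g, if g = j0 then s else if g = j1 then t else z, ?_, ?_⟩
  · by_cases a : g = j0
    · simp [a]
    · by_cases b : g = j1
      · subst b; simp [a]
      · by_cases c : g = j2
        · subst c; simp [a, b]
        · simp [a, b, c] at hg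
  · intro i j
    rw [h]
    by_cases a : g = j0
    · simp [a]
    · by_cases b : g = j1
      · subst b; simp [a]
      · by_cases c : g = j2
        · subst c; simp [a, b]
        · simp [a, b, c] at hg

theorem prot_eq (hτ : ∀ j, τ j < 3) (hAB : A ≠ B) {σ : Fin n → ℕ} {c : ℕ} {j : Fin n}
    (h : R A B τ σ c j)
    (MA MB x : ℕ) : prot MA MB c x = true ↔ (j = A ∧ MA.testBit x = true) ∨
      (j = B ∧ MB.testBit x = true) ∨ (j ≠ A ∧ j ≠ B ∧ τ j = x) := by
  have hh := h
  rcases h with ⟨rfl, rfl⟩ | ⟨rfl, rfl⟩ | ⟨h, h3, h4, h2⟩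
  · simp [prot, isz_eq, tb_eq, hAB]
  · simp [prot, isz_eq, nbeq_eq, tb_eq, hAB.symm]
  · have := (R_mod hτ hh h).1
    simp [prot, isz_eq, nbeq_eq, this, h3, h4, show c ≠ 0 by omega, show c ≠ 1 by omega]

theorem memA_eq {σ : Fin n → ℕ} (hAB : A ≠ B) {c : ℕ} {j : Fin n} (h : R A B τ σ c j) (M t : ℕ) :
    memA M c t = if j = A then Nat.lor M (Nat.pow 2 t) else M := by
  rcases h with ⟨rfl, rfl⟩ | ⟨rfl, rfl⟩ | ⟨h, h3, h4, h2⟩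
  · simp [memA, isz_eq]
  · simp [memA, isz_eq, hAB.symm]
  · simp [memA, isz_eq, h3, show c ≠ 0 by omega]

theorem memB_eq {σ : Fin n → ℕ} (hAB : A ≠ B) {c : ℕ} {j : Fin n} (h : R A B τ σ c j) (M t : ℕ) :
    memB M c t = if j = B then Nat.lor M (Nat.pow 2 t) else M := by
  rcases h with ⟨rfl, rfl⟩ | ⟨rfl, rfl⟩ | ⟨h, h3, h4, h2⟩
  · simp [memB, nbeq_eq, hAB]
  · simp [memB, nbeq_eq]
  · simp [memB, nbeq_eq, h4, show c ≠ 1 by omega]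

/-- What a good step achieves. -/
def Prog (tab : Tr) (u : Fin 3 → ℝ) (v : Fin n → ℝ) (π : Equiv.Perm (Fin 3)) (A B : Fin n)
    (τ : Fin n → ℕ) (F y : Matrix (Fin 3) (Fin n) ℝ) (MA MB : ℕ) : Prop :=
  ∃ y', AdjVert 3 n u v y y' ∧ ∃ (j0 : Fin n) (t : Fin 3) (MA' MB' : ℕ),
    MA' = (if j0 = A then Nat.lor MA (Nat.pow 2 t) else MA) ∧
    MB' = (if j0 = B then Nat.lor MB (Nat.pow 2 t) else MB) ∧
    ¬ 0 < y (π t) j0 ∧ 0 < F (π t) j0 ∧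
    good tab (mask π F A) (mask π F B) (mask π y' A) (mask π y' B) MA' MB'
      (TT A B τ (mask π y')) = true ∧
    MA' < 8 ∧ MB' < 8 ∧
    (∀ x : Fin 3, MA'.testBit x = true → 0 < y' (π x) A) ∧
    (∀ x : Fin 3, MB'.testBit x = true → 0 < y' (π x) B) ∧
    (∀ j, j ≠ A → j ≠ B → ∀ x, 0 < F (π x) j → 0 < y (π x) j ∨ (x = t ∧ j = j0) →
      0 < y' (π x) j)

theorem fin_bit (hτF : ∀ j, j ≠ A → j ≠ B → mask π F j = 2 ^ τ j) {j : Fin n} (hA : j ≠ A)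
    (hB : j ≠ B) (x : Fin 3) : 0 < F (π x) j ↔ τ j = x := by
  rw [← mask_bit (π := π), hτF j hA hB, Nat.testBit_two_pow]; simp

theorem step (hnd : NonDeg 3 n u v) (hv : ∀ j, 0 < v j)
    (hy : y ∈ Set.extremePoints ℝ (TP 3 n u v)) (hF : F ∈ TP 3 n u v) (hAB : A ≠ B)
    (hτ : ∀ j, τ j < 3) (hτF : ∀ j, j ≠ A → j ≠ B → mask π F j = 2 ^ τ j) {MA MB : ℕ}
    (hMA : MA < 8) (hMB : MB < 8)
    (hA : ∀ x : Fin 3, MA.testBit x = true → 0 < y (π x) A)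
    (hB : ∀ x : Fin 3, MB.testBit x = true → 0 < y (π x) B) {tab : Tr} {m : Mv}
    (h : okMove tab (mask π F A) (mask π F B) (mask π y A) (mask π y B) MA MB
      (TT A B τ (mask π y)) m = true) : Prog tab u v π A B τ F y MA MB := by
  obtain ⟨c0, s, t, c1, z, c2⟩ := m
  simp only [okMove, Bool.and_eq_true] at h
  obtain ⟨hval, hall⟩ := h
  simp only [valid, Bool.and_eq_true, Bool.not_eq_true', nbeq_eq, nble_eq, decide_eq_true_eq,
    decide_eq_false_iff_not, Bool.or_eq_true, tb_eq] at hval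
  obtain ⟨hp0, hp1, hc01, hs3, ht3, hz3, htz, hs, ht, hFt, h1t, h1z, hlast⟩ := hval
  lift s to Fin 3 using (show s < 3 by omega)
  lift t to Fin 3 using (show t < 3 by omega)
  lift z to Fin 3 using (show z < 3 by omega)
  have hσ : ∀ j, mask π y j < 8 := fun j => mask_lt j
  have hpos : ∀ j, 0 < mask π y j := mask_pos hy.1 hv
  obtain ⟨j0, r0⟩ := R_of_present hσ hτ hpos hp0
  obtain ⟨j1, r1⟩ := R_of_present hσ hτ hpos hp1
  rw [R_sup hτ r0] at hs ht
  rw [R_sup hτ r1] at h1t h1z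
  have h01 : j0 ≠ j1 := by rintro rfl; exact hc01 (R_inj hAB r0 r1)
  have hs' := (mask_bit _ _).1 hs
  have ht' : ¬ 0 < y (π t) j0 := by rw [← mask_bit (π := π)]; simp [ht]
  have hFt' : 0 < F (π t) j0 := by
    have hh := r0
    rcases r0 with ⟨rfl, rfl⟩ | ⟨rfl, rfl⟩ | ⟨h, h3, h4, h2⟩
    · rw [← mask_bit (π := π)]; simpa [isz_eq] using hFt
    · rw [← mask_bit (π := π)]; simpa [isz_eq] using hFt
    · rw [fin_bit hτF h3 h4, ← (R_mod hτ hh h).1]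
      simpa [isz_eq, show c0 ≠ 0 by omega, show c0 ≠ 1 by omega] using hFt
  have h1t' := (mask_bit _ _).1 h1t
  have h1z' := (mask_bit _ _).1 h1z
  have htz' : t ≠ z := fun e => htz (by rw [e])
  simp only [okAll, Bool.and_eq_true, nbeq_eq, Bool.or_eq_true, decide_eq_true_eq] at hall
  obtain ⟨q0, q1, q2⟩ := hall
  rw [memA_eq hAB r0, memB_eq hAB r0] at q0 q1 q2
  set MA' := (if j0 = A then Nat.lor MA (Nat.pow 2 t) else MA) with eMA
  set MB' := (if j0 = B then Nat.lor MB (Nat.pow 2 t) else MB) with eMB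
  have main : ∃ y', AdjVert 3 n u v y y' ∧ ∃ (g : Fin n) (x : Fin 3) (c : ℕ),
      R A B τ (mask π y) c g ∧ ¬ (x = t ∧ g = j0) ∧
      (∀ i j, (0 < y' (π i) j ↔ (0 < y (π i) j ∨ (i = t ∧ j = j0)) ∧ ¬ (i = x ∧ j = g))) ∧
      okOut tab (mask π F A) (mask π F B) MA' MB' (prot MA' MB' c x) (mask π y' A) (mask π y' B)
        (TT A B τ (mask π y')) = true := by
    have hst : s ≠ t := by rintro rfl; exact ht' hs'
    by_cases hzs : z = s
    · subst hzs
      obtain ⟨y', adj, g, x, hgx, hy'⟩ := pick2 hnd hy h01 hs' ht' h1t' h1z'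
      refine ⟨y', adj, g, x, ?_⟩
      rcases hgx with ⟨rfl, rfl⟩ | ⟨rfl, rfl⟩
      · exact ⟨c0, r0, by tauto, hy', out0 hy hv hAB hτ r0 hp0 hs hy' q0⟩
      · exact ⟨c1, r1, by tauto, hy',
          out1 hy hv hAB hτ r0 hp0 r1 hp1 h01.symm h1t h1z htz' hy' q1⟩
    · have hzs' : ¬ ((z : ℕ) = s) := fun e => hzs (Fin.ext e)
      have hl := hlast.resolve_left hzs'
      obtain ⟨hp2, hc02, hc12, h2z, h2s⟩ := hl
      have q2 := q2.resolve_left hzs'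
      obtain ⟨j2, r2⟩ := R_of_present hσ hτ hpos hp2
      rw [R_sup hτ r2] at h2z h2s
      have h02 : j0 ≠ j2 := by rintro rfl; exact hc02 (R_inj hAB r0 r2)
      have h12 : j1 ≠ j2 := by rintro rfl; exact hc12 (R_inj hAB r1 r2)
      obtain ⟨y', adj, g, x, hgx, hy'⟩ := pick3 hnd hy h01 h02 h12 hs' ht' hzs htz' h1t' h1z'
        ((mask_bit _ _).1 h2z) ((mask_bit _ _).1 h2s)
      refine ⟨y', adj, g, x, ?_⟩
      rcases hgx with ⟨rfl, rfl⟩ | ⟨rfl, rfl⟩ | ⟨rfl, rfl⟩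
      · exact ⟨c0, r0, by tauto, hy', out0 hy hv hAB hτ r0 hp0 hs hy' q0⟩
      · exact ⟨c1, r1, by tauto, hy',
          out1 hy hv hAB hτ r0 hp0 r1 hp1 h01.symm h1t h1z htz' hy' q1⟩
      · exact ⟨c2, r2, by tauto, hy',
          out1 hy hv hAB hτ r0 hp0 r2 hp2 h02.symm h2z h2s hzs hy' q2⟩
  obtain ⟨y', adj, g, x, c, rg, hne, hy', hok⟩ := main
  rw [okOut, feas adj.2.2.1.1 hF hv hAB hτ hτF] at hok
  simp only [Bool.false_or, Bool.and_eq_true, Bool.not_eq_true'] at hok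
  obtain ⟨hpr, hgood⟩ := hok
  have hpr' : ¬ _ := fun e => Bool.false_ne_true (hpr.symm.trans ((prot_eq hτ hAB rg MA' MB' x).2 e))
  refine ⟨y', adj, j0, t, MA', MB', eMA, eMB, ht', hFt', hgood, ?_, ?_, ?_, ?_, ?_⟩
  · rw [eMA]; split_ifs
    · exact (lor_bits _ hMA t).1
    · exact hMA
  · rw [eMB]; split_ifs
    · exact (lor_bits _ hMB t).1
    · exact hMB
  · intro k hk
    rw [hy']
    refine ⟨?_, ?_⟩
    · rw [eMA] at hk
      split_ifs at hk with e
      · rcases ((lor_bits _ hMA t).2 k).1 hk with hk | hk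
        · exact Or.inl (hA _ hk)
        · exact Or.inr ⟨hk, e.symm⟩
      · exact Or.inl (hA _ hk)
    · rintro ⟨rfl, rfl⟩
      exact hpr' (Or.inl ⟨rfl, hk⟩)
  · intro k hk
    rw [hy']
    refine ⟨?_, ?_⟩
    · rw [eMB] at hk
      split_ifs at hk with e
      · rcases ((lor_bits _ hMB t).2 k).1 hk with hk | hk
        · exact Or.inl (hB _ hk)
        · exact Or.inr ⟨hk, e.symm⟩
      · exact Or.inl (hB _ hk)
    · rintro ⟨rfl, rfl⟩
      exact hpr' (Or.inr (Or.inl ⟨rfl, hk⟩))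
  · intro j hjA hjB k hk hk'
    rw [hy']
    refine ⟨hk', ?_⟩
    rintro ⟨rfl, rfl⟩
    exact hpr' (Or.inr (Or.inr ⟨hjA, hjB, (fin_bit hτF hjA hjB _).1 hk⟩))

end step
end G3

namespace G3

theorem look_sound {tab : Tr} {FA FB k v : ℕ} : ∀ {t : Tr}, okTab tab FA FB t = true →
    look t k = some v → okEntry tab FA FB k v = true := by
  intro t
  induction t with
  | e => intro _ h; simp [look] at h
  | n l k' v' r ihl ihr =>
    intro h h'
    simp only [okTab, Bool.and_eq_true] at h
    simp only [look, nbeq_eq, nble_eq] at h'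
    by_cases e : k = k'
    · subst e; simp at h'; subst h'; exact h.1
    · simp only [e, decide_false, cond_false] at h'
      by_cases e2 : k ≤ k'
      · simp [e2] at h'; exact ihl h.2.1 h'
      · simp [e2] at h'; exact ihr h.2.2 h'

theorem land7 (k : ℕ) : Nat.land k 7 = k % 8 := Nat.and_two_pow_sub_one_eq_mod k 3

theorem shr_eq (k i : ℕ) : Nat.shiftRight k i = k / 2 ^ i := Nat.shiftRight_eq_div_pow k i

theorem look_key {tab : Tr} {FA FB pA pB MA MB T : ℕ} (hok : okTab tab FA FB tab = true)
    (hpA : pA < 8) (hpB : pB < 8) (hMA : MA < 8) (hMB : MB < 8)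
    (h : (look tab (key pA pB MA MB T)).isSome = true) :
    ∃ m, okMove tab FA FB pA pB MA MB T m = true := by
  obtain ⟨v, hv⟩ := Option.isSome_iff_exists.1 h
  have h1 := look_sound hok hv
  refine ⟨decMv v, ?_⟩
  have e : key pA pB MA MB T = pA + (8 * pB + (64 * MA + (512 * MB + 4096 * T))) := rfl
  rw [e, okEntry] at h1
  simp only [land7, shr_eq] at h1
  convert h1 using 1
  congr 1 <;> norm_num <;> omega

theorem safe_ok {FA FB pA pB T : ℕ} {m : Mv} (tab : Tr) (h : safeMv FA FB pA pB T m = true) :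
    okMove tab FA FB pA pB 0 0 T m = true := by
  simp only [safeMv, Bool.and_eq_true, Bool.not_eq_true', nble_eq, decide_eq_false_iff_not] at h
  obtain ⟨h0, hv, h1, h2⟩ := h
  have hA : memA 0 m.c0 m.t = 0 := by
    simp [memA, isz_eq, show m.c0 ≠ 0 by omega]
  have hB : memB 0 m.c0 m.t = 0 := by
    simp [memB, nbeq_eq, show m.c0 ≠ 1 by omega]
  have hp : prot 0 0 m.c0 m.s = false := by
    have hv' := hv
    simp only [valid, Bool.and_eq_true, Bool.not_eq_true', nbeq_eq, nble_eq, decide_eq_true_eq,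
      decide_eq_false_iff_not, Bool.or_eq_true, tb_eq] at hv'
    obtain ⟨hp0, hp1, hc01, hs3, ht3, hz3, htz, hs, ht, hFt, h1t, h1z, hlast⟩ := hv'
    have hst : m.t ≠ m.s := by intro e; rw [e, hs] at ht; exact absurd ht (by simp)
    simp only [isz_eq, show m.c0 ≠ 0 by omega, show m.c0 ≠ 1 by omega, decide_false, cond_false,
      decide_eq_true_eq] at hFt
    simp [prot, isz_eq, nbeq_eq, show m.c0 ≠ 0 by omega, show m.c0 ≠ 1 by omega, hFt, hst]
  have ho : ∀ a b T', okOut tab FA FB 0 0 false a b T' = true := by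
    intro a b T'; simp [okOut, good, isz_eq]
  have hm : ∀ a b T' c S sg, okMover tab FA FB a b 0 0 T' false c S sg = true := by
    intro a b T' c S sg; simp [okMover, ho]
  rw [okMove, hA, hB, hv, okAll, hp]
  simp only [Bool.true_and, hm, okComp, h1]
  simp only [Bool.or_eq_true] at h2 ⊢
  rcases h2 with h2 | h2
  · exact Or.inl h2
  · right
    simp only [Bool.not_eq_true'] at h2
    rw [h2, hm]

theorem present_mono {T T' c : ℕ} (hT : ∀ k, T.testBit k = true → T'.testBit k = true)
    (h : present T c = true) : present T' c = true := by
  simp only [present, Bool.or_eq_true, tb_eq] at h ⊢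
  rcases h with h | h
  · exact Or.inl h
  · exact Or.inr (hT _ h)

theorem safe_mono {T T' : ℕ} (hT : ∀ k, T.testBit k = true → T'.testBit k = true)
    {FA FB pA pB : ℕ} {m : Mv} (h : safeMv FA FB pA pB T m = true) :
    safeMv FA FB pA pB T' m = true := by
  have hm : ∀ c, present T c = true → present T' c = true := fun c => present_mono hT
  simp only [safeMv, valid, Bool.and_eq_true, Bool.or_eq_true] at h ⊢
  obtain ⟨h0, ⟨a, b, c1, c2, c3, c4, c5, c6, c7, c8, c9, c10, d⟩, h2⟩ := h
  refine ⟨h0, ⟨hm _ a, hm _ b, c1, c2, c3, c4, c5, c6, c7, c8, c9, c10, ?_⟩, h2⟩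
  rcases d with d | ⟨d, e⟩
  · exact Or.inl d
  · exact Or.inr ⟨hm _ d, e⟩

theorem safeC_ex {FA FB pA pB T c : ℕ} {cs : List ℕ} (h : safeC FA FB pA pB T cs c = true) :
    ∃ m, safeMv FA FB pA pB T m = true := by
  unfold safeC at h
  rw [List.any_eq_true] at h
  obtain ⟨s, -, h⟩ := h
  rw [Bool.and_eq_true] at h
  have h := h.2
  unfold safeST at h
  rw [List.any_eq_true] at h
  obtain ⟨c1, -, h⟩ := h
  rw [Bool.or_eq_true] at h
  rcases h with h | h
  · exact ⟨_, h⟩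
  · rw [Bool.and_eq_true, List.any_eq_true] at h
    obtain ⟨-, c2, -, h⟩ := h
    exact ⟨_, h⟩

/-- A state without memory can be continued. -/
def Cont (tab : Tr) (FA FB pA pB T : ℕ) : Prop :=
  (∃ m, safeMv FA FB pA pB T m = true) ∨ final FA FB pA pB T = true ∨
    (look tab (key pA pB 0 0 T)).isSome = true

theorem lorpow (T d k : ℕ) : (Nat.lor T (Nat.pow 2 d)).testBit k = true ↔
    T.testBit k = true ∨ k = d := by
  change (T ||| 2 ^ d).testBit k = true ↔ _
  rw [Nat.testBit_or, Nat.testBit_two_pow]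
  rw [Bool.or_eq_true, decide_eq_true_eq, @eq_comm _ d k]

theorem treeW_sound {tab : Tr} {FA FB pA pB T0 T' : ℕ} {cs : List ℕ}
    (hinf : infeas FA FB pA pB T' = false) : ∀ (ds : List ℕ) (T : ℕ),
    (∀ k, T.testBit k = true → T'.testBit k = true) →
    (∀ k, T'.testBit k = true → T.testBit k = true ∨ k ∈ ds) →
    treeW tab FA FB pA pB T0 cs ds T = true → Cont tab FA FB pA pB T' := by
  intro ds
  induction ds with
  | nil =>
    intro T h1 h2 h
    have e : T = T' := by
      apply Nat.eq_of_testBit_eq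
      intro k
      rw [Bool.eq_iff_iff]
      exact ⟨h1 k, fun hk => (h2 k hk).resolve_right (by simp)⟩
    subst e
    rw [treeW, hinf] at h
    simp only [Bool.false_or, Bool.or_eq_true] at h
    exact Or.inr h
  | cons d ds ih =>
    intro T h1 h2 h
    simp only [treeW, Bool.and_eq_true, Bool.or_eq_true] at h
    cases hd : T'.testBit d
    · refine ih T h1 ?_ h.2
      intro k hk
      rcases h2 k hk with a | a
      · exact Or.inl a
      · rcases List.mem_cons.1 a with a | a
        · subst a; rw [hd] at hk; exact absurd hk (by simp)
        · exact Or.inr a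
    · have h3 : ∀ k, (Nat.lor T (Nat.pow 2 d)).testBit k = true → T'.testBit k = true := by
        intro k hk
        rcases (lorpow T d k).1 hk with a | a
        · exact h1 k a
        · rw [a]; exact hd
      rcases h.1 with a | a
      · obtain ⟨m, hm⟩ := safeC_ex a
        exact Or.inl ⟨m, safe_mono h3 hm⟩
      · refine ih _ h3 ?_ a
        intro k hk
        rw [lorpow]
        rcases h2 k hk with a | a
        · exact Or.inl (Or.inl a)
        · rcases List.mem_cons.1 a with a | a
          · exact Or.inl (Or.inr a)
          · exact Or.inr a

theorem treeX_sound {tab : Tr} {FA FB pA pB T' : ℕ}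
    (hinf : infeas FA FB pA pB T' = false)
    (hcA : ∀ d, T'.testBit d = true → confl pA (Nat.div d 3) = false)
    (hcB : ∀ d, T'.testBit d = true → confl pB (Nat.div d 3) = false)
    (hcc : ∀ c d, c ≠ d → T'.testBit c = true → T'.testBit d = true →
      confl (Nat.div c 3) (Nat.div d 3) = false) : ∀ (ds cs : List ℕ) (T : ℕ),
    ds.Nodup → (∀ c ∈ cs, c ∉ ds) → (∀ c ∈ cs, T'.testBit c = true) →
    (∀ k, T.testBit k = true → T'.testBit k = true) →
    (∀ k, T'.testBit k = true → T.testBit k = true ∨ k ∈ ds ∨ k ∈ leafCodes) →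
    exc pA + exc pB + sumExc cs + sumExc (ds.filter (fun d => T'.testBit d)) = 2 →
    treeX tab FA FB pA pB ds cs T = true → Cont tab FA FB pA pB T' := by
  intro ds
  induction ds with
  | nil =>
    intro cs T _ _ _ h1 h2 h3 h
    have h3' : Nat.beq (Nat.add (Nat.add (exc pA) (exc pB)) (sumExc cs)) 2 = true := by
      rw [Nat.beq_eq]; simpa [sumExc] using h3
    rw [treeX, h3'] at h
    simp only [Bool.not_true, Bool.false_or, Bool.or_eq_true, List.any_eq_true] at h
    rcases h with ⟨c, _, h⟩ | h
    · obtain ⟨m, hm⟩ := safeC_ex h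
      exact Or.inl ⟨m, safe_mono h1 hm⟩
    · refine treeW_sound hinf _ _ h1 ?_ h
      intro k hk
      simpa using h2 k hk
  | cons d ds ih =>
    intro cs T hnd hdis hcs h1 h2 h3 h
    simp only [treeX, Bool.and_eq_true, Bool.or_eq_true] at h
    rw [List.nodup_cons] at hnd
    cases hd : T'.testBit d
    · refine ih cs T hnd.2 (fun c hc hc' => hdis c hc (List.mem_cons_of_mem _ hc')) hcs h1 ?_ ?_ h.2
      · intro k hk
        rcases h2 k hk with a | a | a
        · exact Or.inl a
        · rcases List.mem_cons.1 a with a | a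
          · subst a; rw [hd] at hk; exact absurd hk (by simp)
          · exact Or.inr (Or.inl a)
        · exact Or.inr (Or.inr a)
      · rw [List.filter_cons_of_neg (by simp [hd])] at h3
        exact h3
    · rw [hcA d hd, hcB d hd] at h
      have h4 : (cs.any fun c => confl (Nat.div c 3) (Nat.div d 3)) = false := by
        rw [List.any_eq_false]
        intro c hc
        rw [hcc c d (by rintro rfl; exact hdis c hc List.mem_cons_self) (hcs c hc) hd]
        simp
      rw [h4] at h
      simp only [Bool.false_eq_true, false_or] at h
      refine ih (d :: cs) _ hnd.2 ?_ ?_ ?_ ?_ ?_ h.1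
      · intro c hc
        rcases List.mem_cons.1 hc with rfl | hc
        · exact hnd.1
        · exact fun hc' => hdis c hc (List.mem_cons_of_mem _ hc')
      · intro c hc
        rcases List.mem_cons.1 hc with rfl | hc
        · exact hd
        · exact hcs c hc
      · intro k hk
        rcases (lorpow T d k).1 hk with a | a
        · exact h1 k a
        · rw [a]; exact hd
      · intro k hk
        rw [lorpow]
        rcases h2 k hk with a | a | a
        · exact Or.inl (Or.inl a)
        · rcases List.mem_cons.1 a with a | a
          · exact Or.inl (Or.inr a)
          · exact Or.inr (Or.inl a)
        · exact Or.inr (Or.inr a)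
      · rw [List.filter_cons_of_pos (by simp [hd])] at h3
        have e : ∀ l, sumExc (d :: l) = exc (Nat.div d 3) + sumExc l := fun l => rfl
        rw [e] at h3 ⊢
        omega

theorem sumExc_filter (p : ℕ → Bool) : ∀ l : List ℕ, sumExc (l.filter p) =
    (l.map (fun d => if p d then exc (Nat.div d 3) else 0)).sum := by
  intro l
  induction l with
  | nil => rfl
  | cons d l ih =>
    have e : ∀ l, sumExc (d :: l) = exc (Nat.div d 3) + sumExc l := fun l => rfl
    cases h : p d
    · rw [List.filter_cons_of_neg (by simp [h]), ih]; simp [h]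
    · rw [List.filter_cons_of_pos h, e, ih]; simp [h]

section zero
variable {n : ℕ} {u : Fin 3 → ℝ} {v : Fin n → ℝ}
variable {π : Equiv.Perm (Fin 3)} {y F : Matrix (Fin 3) (Fin n) ℝ} {A B : Fin n} {τ : Fin n → ℕ}

theorem zero_sum (hnd : NonDeg 3 n u v) (hv : ∀ j, 0 < v j)
    (hy : y ∈ Set.extremePoints ℝ (TP 3 n u v)) (hAB : A ≠ B) (hτ : ∀ j, τ j < 3) :
    exc (mask π y A) + exc (mask π y B) + sumExc [] +
      sumExc (mixedCodes.filter (fun d => (TT A B τ (mask π y)).testBit d)) = 2 := by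
  have hs := sum_exc (π := π) hnd hv hy
  have hb := TT_bit A B τ (mask π y) (fun j => mask_lt j) hτ
  have hnod : mixedCodes.Nodup := by decide
  rw [sumExc_filter, ← List.sum_toFinset _ hnod]
  have k1 : ∀ S < 8, ∀ t < 3, exc S =
      ∑ d ∈ mixedCodes.toFinset, if 3 * S + t = d then exc (Nat.div d 3) else 0 := by decide
  have k2 : ∀ S < 8, ∀ t < 3, 3 * S + t ∈ mixedCodes →
      done (3 * S + t) = false ∧ confl S S = true := by decide
  have k3 : ∀ d ∈ mixedCodes.toFinset,
      (∑ j ∈ (Finset.univ.erase A).erase B,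
        if 3 * mask π y j + τ j = d then exc (Nat.div d 3) else 0) =
      if (TT A B τ (mask π y)).testBit d then exc (Nat.div d 3) else 0 := by
    intro d hd
    rw [List.mem_toFinset] at hd
    split_ifs with hbit
    · obtain ⟨j, hA, hB, hj, hdn⟩ := (hb d).1 hbit
      rw [Finset.sum_eq_single j]
      · simp [hj]
      · intro j' _ hne
        rw [if_neg]
        intro e
        have e2 : mask π y j' = mask π y j := by have := hτ j; have := hτ j'; omega
        have c1 := no_confl (π := π) hy hne
        rw [e2, (k2 _ (mask_lt j) _ (hτ j) (hj ▸ hd)).2] at c1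
        exact absurd c1 (by simp)
      · intro h; simp [hA, hB] at h
    · apply Finset.sum_eq_zero
      intro j hj
      simp only [Finset.mem_erase, Finset.mem_univ, and_true] at hj
      rw [if_neg]
      intro e
      apply hbit
      rw [hb]
      exact ⟨j, hj.2, hj.1, e, e ▸ (k2 _ (mask_lt j) _ (hτ j) (e ▸ hd)).1⟩
  have k4 : ∑ j ∈ (Finset.univ.erase A).erase B, exc (mask π y j) =
      ∑ d ∈ mixedCodes.toFinset,
        if (TT A B τ (mask π y)).testBit d then exc (Nat.div d 3) else 0 := by
    rw [Finset.sum_congr rfl (fun j _ => k1 _ (mask_lt j) _ (hτ j)), Finset.sum_comm]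
    exact Finset.sum_congr rfl k3
  rw [← k4]
  have e1 := Finset.add_sum_erase Finset.univ (fun j => exc (mask π y j)) (Finset.mem_univ A)
  have e2 := Finset.add_sum_erase (Finset.univ.erase A) (fun j => exc (mask π y j))
    (Finset.mem_erase.2 ⟨hAB.symm, Finset.mem_univ B⟩)
  have e3 : sumExc [] = 0 := rfl
  omega

theorem zero_cont (hnd : NonDeg 3 n u v) (hv : ∀ j, 0 < v j)
    (hy : y ∈ Set.extremePoints ℝ (TP 3 n u v)) (hF : F ∈ TP 3 n u v) (hAB : A ≠ B)
    (hτ : ∀ j, τ j < 3) (hτF : ∀ j, j ≠ A → j ≠ B → mask π F j = 2 ^ τ j) {tab : Tr}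
    (hok : okZero tab (mask π F A) (mask π F B) = true) :
    Cont tab (mask π F A) (mask π F B) (mask π y A) (mask π y B) (TT A B τ (mask π y)) := by
  have hb := TT_bit A B τ (mask π y) (fun j => mask_lt j) hτ
  have hmem : ∀ S < 8, 0 < S → S ∈ [1, 2, 3, 4, 5, 6, 7] := by decide
  have hx : treeX tab (mask π F A) (mask π F B) (mask π y A) (mask π y B) mixedCodes [] 0 = true := by
    simp only [okZero, List.all_eq_true] at hok
    have h1 := hok _ (hmem _ (mask_lt (π := π) (y := y) A) (mask_pos hy.1 hv A)) _
      (hmem _ (mask_lt (π := π) (y := y) B) (mask_pos hy.1 hv B))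
    rw [no_confl hy hAB] at h1
    simpa using h1
  have hdiv : ∀ j, Nat.div (3 * mask π y j + τ j) 3 = mask π y j := by
    intro j
    change (3 * mask π y j + τ j) / 3 = _
    have := hτ j
    omega
  have k2 : ∀ S < 8, ∀ t < 3, 0 < S → done (3 * S + t) = false →
      3 * S + t ∈ mixedCodes ++ leafCodes := by
    have k3 : ∀ S < 8, ∀ t < 3, (isz S || (done (3 * S + t) ||
        (mixedCodes ++ leafCodes).contains (3 * S + t))) = true := by decide
    intro S hS t ht h0 hd
    have := k3 S hS t ht
    rw [hd, isz_eq, decide_eq_false (by omega)] at this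
    simpa only [Bool.false_or, List.contains_iff_mem] using this
  refine treeX_sound (feas hy.1 hF hv hAB hτ hτF) ?_ ?_ ?_ mixedCodes [] 0 (by decide) (by simp)
    (by simp) (by simp) ?_ (zero_sum hnd hv hy hAB hτ) hx
  · intro d hd
    obtain ⟨j, hA, hB, rfl, -⟩ := (hb d).1 hd
    rw [hdiv]; exact no_confl hy hA.symm
  · intro d hd
    obtain ⟨j, hA, hB, rfl, -⟩ := (hb d).1 hd
    rw [hdiv]; exact no_confl hy hB.symm
  · intro c d hcd hc hd
    obtain ⟨j, hA, hB, rfl, -⟩ := (hb d).1 hd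
    obtain ⟨j', hA', hB', rfl, -⟩ := (hb c).1 hc
    rw [hdiv, hdiv]
    exact no_confl hy (by rintro rfl; exact hcd rfl)
  · intro k hk
    obtain ⟨j, hA, hB, rfl, hd⟩ := (hb k).1 hk
    exact Or.inr (List.mem_append.1 (k2 _ (mask_lt j) _ (hτ j) (mask_pos hy.1 hv j) hd))

theorem cont (hnd : NonDeg 3 n u v) (hv : ∀ j, 0 < v j)
    (hy : y ∈ Set.extremePoints ℝ (TP 3 n u v)) (hF : F ∈ TP 3 n u v) (hAB : A ≠ B)
    (hτ : ∀ j, τ j < 3) (hτF : ∀ j, j ≠ A → j ≠ B → mask π F j = 2 ^ τ j) {tab : Tr}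
    (hok : okZero tab (mask π F A) (mask π F B) = true)
    (hok' : okTab tab (mask π F A) (mask π F B) tab = true) {MA MB : ℕ}
    (hMA : MA < 8) (hMB : MB < 8)
    (h : good tab (mask π F A) (mask π F B) (mask π y A) (mask π y B) MA MB
      (TT A B τ (mask π y)) = true) :
    final (mask π F A) (mask π F B) (mask π y A) (mask π y B) (TT A B τ (mask π y)) = true ∨
    ∃ m, okMove tab (mask π F A) (mask π F B) (mask π y A) (mask π y B) MA MB
      (TT A B τ (mask π y)) m = true := by
  simp only [good, Bool.or_eq_true, Bool.and_eq_true, isz_iff] at h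
  rcases h with ⟨rfl, rfl⟩ | h | h
  · rcases zero_cont hnd hv hy hF hAB hτ hτF hok with ⟨m, hm⟩ | h | h
    · exact Or.inr ⟨m, safe_ok tab hm⟩
    · exact Or.inl h
    · exact Or.inr (look_key hok' (mask_lt _) (mask_lt _) hMA hMB h)
  · exact Or.inl h
  · exact Or.inr (look_key hok' (mask_lt _) (mask_lt _) hMA hMB h)

end zero
end G3

namespace G3

section main
variable {n : ℕ} {u : Fin 3 → ℝ} {v : Fin n → ℝ}
variable {π : Equiv.Perm (Fin 3)} {y F : Matrix (Fin 3) (Fin n) ℝ} {A B : Fin n} {τ : Fin n → ℕ}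

theorem final_eq (hy : y ∈ Set.extremePoints ℝ (TP 3 n u v)) (hF : F ∈ TP 3 n u v)
    (hτ : ∀ j, τ j < 3) (hτF : ∀ j, j ≠ A → j ≠ B → mask π F j = 2 ^ τ j)
    (h : final (mask π F A) (mask π F B) (mask π y A) (mask π y B)
      (TT A B τ (mask π y)) = true) : y = F := by
  simp only [final, Bool.and_eq_true, isz_iff, Nat.beq_eq] at h
  obtain ⟨hT, hA, hB⟩ := h
  have hb := TT_bit A B τ (mask π y) (fun j => mask_lt j) hτ
  have hm : ∀ j, mask π y j = mask π F j := by
    intro j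
    by_cases eA : j = A
    · rw [eA, hA]
    · by_cases eB : j = B
      · rw [eB, hB]
      · rw [hτF j eA eB, ← done_iff _ (mask_lt j) _ (hτ j)]
        by_contra hd
        have := (hb (3 * mask π y j + τ j)).2 ⟨j, eA, eB, rfl, by simpa using hd⟩
        rw [hT] at this
        simp at this
  have hD := indep hy (F - y) (fun i => by
      simp only [Matrix.sub_apply, Finset.sum_sub_distrib]
      rw [hF.2.1, hy.1.2.1, sub_self])
    (fun j => by
      simp only [Matrix.sub_apply, Finset.sum_sub_distrib]
      rw [hF.2.2, hy.1.2.2, sub_self])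
    (fun i j h0 => by
      have h1 : ¬ 0 < F i j := by
        have := mask_bit (π := π) (y := F) j (π.symm i)
        rw [← hm, mask_bit] at this
        simp only [Equiv.apply_symm_apply] at this
        rw [← this, h0]; simp
      rw [Matrix.sub_apply, h0, le_antisymm (not_lt.1 h1) (hF.1 i j), sub_self])
  exact (sub_eq_zero.1 hD).symm

/-- target edges that are still not frozen -/
noncomputable def todo (u : Fin 3 → ℝ) (v : Fin n → ℝ) (π : Equiv.Perm (Fin 3)) (A B : Fin n)
    (F y : Matrix (Fin 3) (Fin n) ℝ) (MA MB : ℕ) : Finset (Fin 3 × Fin n) :=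
  Finset.univ.filter (fun p => 0 < F (π p.1) p.2 ∧ (¬ ∀ w ∈ TP 3 n u v, 0 < w (π p.1) p.2) ∧
    ¬ ((p.2 = A ∧ MA.testBit p.1 = true) ∨ (p.2 = B ∧ MB.testBit p.1 = true) ∨
      (p.2 ≠ A ∧ p.2 ≠ B ∧ 0 < y (π p.1) p.2)))

theorem walk (hnd : NonDeg 3 n u v) (hv : ∀ j, 0 < v j) (hF : F ∈ TP 3 n u v) (hAB : A ≠ B)
    (hτ : ∀ j, τ j < 3) (hτF : ∀ j, j ≠ A → j ≠ B → mask π F j = 2 ^ τ j) {tab : Tr}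
    (hok : okZero tab (mask π F A) (mask π F B) = true)
    (hok' : okTab tab (mask π F A) (mask π F B) tab = true) : ∀ (N : ℕ)
    (y : Matrix (Fin 3) (Fin n) ℝ) (MA MB : ℕ), y ∈ Set.extremePoints ℝ (TP 3 n u v) →
    MA < 8 → MB < 8 → (∀ x : Fin 3, MA.testBit x = true → 0 < y (π x) A) →
    (∀ x : Fin 3, MB.testBit x = true → 0 < y (π x) B) →
    good tab (mask π F A) (mask π F B) (mask π y A) (mask π y B) MA MB
      (TT A B τ (mask π y)) = true →
    (todo u v π A B F y MA MB).card ≤ N →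
    ∃ k ≤ N, ∃ w : ℕ → Matrix (Fin 3) (Fin n) ℝ, w 0 = y ∧ w k = F ∧
      ∀ i < k, AdjVert 3 n u v (w i) (w (i + 1)) := by
  intro N
  induction N with
  | zero =>
    intro y MA MB hy hMA hMB hA hB hg hc
    rcases cont hnd hv hy hF hAB hτ hτF hok hok' hMA hMB hg with h | ⟨m, h⟩
    · exact ⟨0, le_rfl, fun _ => y, rfl, final_eq hy hF hτ hτF h, by simp⟩
    · exfalso
      obtain ⟨y', adj, j0, t, MA', MB', eA, eB, h1, h2, -⟩ :=
        step hnd hv hy hF hAB hτ hτF hMA hMB hA hB h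
      have : (t, j0) ∈ todo u v π A B F y MA MB := by
        simp only [todo, Finset.mem_filter, Finset.mem_univ, true_and]
        refine ⟨h2, fun hh => h1 (hh y hy.1), ?_⟩
        rintro (⟨rfl, h3⟩ | ⟨rfl, h3⟩ | ⟨-, -, h3⟩)
        · exact h1 (hA _ h3)
        · exact h1 (hB _ h3)
        · exact h1 h3
      rw [Finset.card_eq_zero.1 (Nat.le_zero.1 hc)] at this
      simp at this
  | succ N ih =>
    intro y MA MB hy hMA hMB hA hB hg hc
    rcases cont hnd hv hy hF hAB hτ hτF hok hok' hMA hMB hg with h | ⟨m, h⟩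
    · exact ⟨0, Nat.zero_le _, fun _ => y, rfl, final_eq hy hF hτ hτF h, by simp⟩
    · obtain ⟨y', adj, j0, t, MA', MB', eA, eB, h1, h2, hg', hMA', hMB', hA', hB', hkeep⟩ :=
        step hnd hv hy hF hAB hτ hτF hMA hMB hA hB h
      have hmem : (t, j0) ∈ todo u v π A B F y MA MB := by
        simp only [todo, Finset.mem_filter, Finset.mem_univ, true_and]
        refine ⟨h2, fun hh => h1 (hh y hy.1), ?_⟩
        rintro (⟨rfl, h3⟩ | ⟨rfl, h3⟩ | ⟨-, -, h3⟩)
        · exact h1 (hA _ h3)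
        · exact h1 (hB _ h3)
        · exact h1 h3
      have hlt : (todo u v π A B F y' MA' MB').card < (todo u v π A B F y MA MB).card := by
        apply Finset.card_lt_card
        rw [Finset.ssubset_iff_of_subset]
        · refine ⟨_, hmem, ?_⟩
          intro hh
          simp only [todo, Finset.mem_filter, Finset.mem_univ, true_and] at hh
          apply hh.2.2
          by_cases a : j0 = A
          · left; refine ⟨a, ?_⟩
            rw [eA, if_pos a]
            exact ((lor_bits _ hMA t).2 t).2 (Or.inr rfl)
          · by_cases b : j0 = B
            · right; left; refine ⟨b, ?_⟩
              rw [eB, if_pos b]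
              exact ((lor_bits _ hMB t).2 t).2 (Or.inr rfl)
            · right; right
              exact ⟨a, b, hkeep j0 a b t h2 (Or.inr ⟨rfl, rfl⟩)⟩
        · rintro ⟨x, j⟩ hp
          simp only [todo, Finset.mem_filter, Finset.mem_univ, true_and] at hp ⊢
          refine ⟨hp.1, hp.2.1, fun hh => hp.2.2 ?_⟩
          rcases hh with ⟨e, hb⟩ | ⟨e, hb⟩ | ⟨a, b, hb⟩
          · left; refine ⟨e, ?_⟩
            rw [eA]; split_ifs
            · exact ((lor_bits _ hMA t).2 x).2 (Or.inl hb)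
            · exact hb
          · right; left; refine ⟨e, ?_⟩
            rw [eB]; split_ifs
            · exact ((lor_bits _ hMB t).2 x).2 (Or.inl hb)
            · exact hb
          · right; right
            exact ⟨a, b, hkeep j a b x hp.1 (Or.inl hb)⟩
      obtain ⟨k, hk, w, w0, wk, hw⟩ := ih y' MA' MB' adj.2.2.1 hMA' hMB' hA' hB' hg' (by omega)
      refine ⟨k + 1, by omega, fun i => Nat.casesOn i y w, rfl, wk, ?_⟩
      intro i hi
      cases i with
      | zero => change AdjVert 3 n u v y (w 0); rw [w0]; exact adj
      | succ i => exact hw i (by omega)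

theorem todo_card (hnd : NonDeg 3 n u v) (hF : F ∈ Set.extremePoints ℝ (TP 3 n u v)) (MA MB : ℕ) :
    (todo u v π A B F y MA MB).card ≤ n + 2 - criticalCount 3 n u v := by
  have h1 := hnd F hF
  unfold criticalCount
  set C := Finset.univ.filter (fun p : Fin 3 × Fin n => ∀ y ∈ TP 3 n u v, 0 < y p.1 p.2) with hC
  have hsub : C ⊆ suppF 3 n F := by
    intro p hp
    simp only [hC, suppF, Finset.mem_filter, Finset.mem_univ, true_and] at hp ⊢
    exact hp F hF.1
  have h2 : (suppF 3 n F \ C).card = n + 2 - C.card := by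
    rw [Finset.card_sdiff_of_subset hsub, h1]; omega
  rw [← h2]
  apply Finset.card_le_card_of_injOn (fun p => (π p.1, p.2))
  · rintro p hp
    simp only [todo, Finset.coe_filter, Finset.mem_univ, true_and, Set.mem_ofPred_eq] at hp
    simp only [Finset.coe_sdiff, Set.mem_sdiff, Finset.mem_coe, hC, suppF, Finset.mem_filter,
      Finset.mem_univ, true_and]
    exact ⟨hp.1, hp.2.1⟩
  · rintro ⟨a, b⟩ _ ⟨c, d⟩ _ h
    simpa using h

theorem fromAB (hnd : NonDeg 3 n u v) (hv : ∀ j, 0 < v j)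
    (hy : y ∈ Set.extremePoints ℝ (TP 3 n u v)) (hF : F ∈ Set.extremePoints ℝ (TP 3 n u v))
    (hAB : A ≠ B) {tab : Tr}
    (hok : okZero tab (mask π F A) (mask π F B) = true)
    (hok' : okTab tab (mask π F A) (mask π F B) tab = true)
    (hex : exc (mask π F A) + exc (mask π F B) = 2) :
    ∃ k ≤ n + 2 - criticalCount 3 n u v, ∃ w : ℕ → Matrix (Fin 3) (Fin n) ℝ, w 0 = y ∧ w k = F ∧
      ∀ i < k, AdjVert 3 n u v (w i) (w (i + 1)) := by
  have key : ∀ S < 8, 0 < S → exc S = 0 → ∃ t < 3, S = 2 ^ t := by decide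
  have hz : ∀ j, j ≠ A → j ≠ B → exc (mask π F j) = 0 := by
    intro j hA hB
    have hs := sum_exc (π := π) hnd hv hF
    have e1 := Finset.add_sum_erase Finset.univ (fun j => exc (mask π F j)) (Finset.mem_univ A)
    have e2 := Finset.add_sum_erase (Finset.univ.erase A) (fun j => exc (mask π F j))
      (Finset.mem_erase.2 ⟨hAB.symm, Finset.mem_univ B⟩)
    have e3 := Finset.single_le_sum (f := fun j => exc (mask π F j)) (fun _ _ => Nat.zero_le _)
      (Finset.mem_erase.2 ⟨hB, Finset.mem_erase.2 ⟨hA, Finset.mem_univ j⟩⟩)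
    omega
  have hex2 : ∀ j, ∃ t < 3, j ≠ A → j ≠ B → mask π F j = 2 ^ t := by
    intro j
    by_cases hA : j = A
    · exact ⟨0, by omega, fun h => absurd hA h⟩
    · by_cases hB : j = B
      · exact ⟨0, by omega, fun _ h => absurd hB h⟩
      · obtain ⟨t, ht, h⟩ := key _ (mask_lt (π := π) (y := F) j) (mask_pos hF.1 hv j) (hz j hA hB)
        exact ⟨t, ht, fun _ _ => h⟩
  choose τ hτ hτF using hex2
  exact walk hnd hv hF.1 hAB hτ hτF hok hok' _ y 0 0 hy (by omega) (by omega) (by simp) (by simp)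
    (by simp [good, isz_eq]) (todo_card hnd hF 0 0)

theorem mask_conj (π : Equiv.Perm (Fin 3)) (j : Fin n) {S : ℕ} (hS : S < 8)
    (h : ∀ x : Fin 3, (mask 1 F j).testBit (π x) = S.testBit x) : mask π F j = S := by
  apply mask_eq hS
  intro x
  rw [← h x, mask_bit]; rfl

theorem final_thm (hn : 0 < n) (hnd : NonDeg 3 n u v) (hv : ∀ j, 0 < v j)
    (hy : y ∈ Set.extremePoints ℝ (TP 3 n u v)) (hF : F ∈ Set.extremePoints ℝ (TP 3 n u v)) :
    ∃ k ≤ n + 2 - criticalCount 3 n u v, ∃ w : ℕ → Matrix (Fin 3) (Fin n) ℝ, w 0 = y ∧ w k = F ∧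
      ∀ i < k, AdjVert 3 n u v (w i) (w (i + 1)) := by
  by_cases hn1 : n = 1
  · subst hn1
    have e : y = F := by
      ext i j
      have h1 := hy.1.2.1 i
      have h2 := hF.1.2.1 i
      rw [Fin.sum_univ_one] at h1 h2
      rw [Subsingleton.elim j 0, h1, h2]
    exact ⟨0, Nat.zero_le _, fun _ => y, rfl, e, by simp⟩
  have hs := sum_exc (π := 1) hnd hv hF
  by_cases h7 : ∃ j, exc (mask 1 F j) = 2
  · obtain ⟨A, hA⟩ := h7
    obtain ⟨B, hB⟩ : ∃ B, B ≠ A := by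
      have : Nontrivial (Fin n) := Fin.nontrivial_iff_two_le.2 (by omega)
      exact exists_ne A
    have e1 := Finset.add_sum_erase Finset.univ (fun j => exc (mask 1 F j)) (Finset.mem_univ A)
    have e3 := Finset.single_le_sum (f := fun j => exc (mask 1 F j)) (fun _ _ => Nat.zero_le _)
      (Finset.mem_erase.2 ⟨hB, Finset.mem_univ B⟩)
    have hB0 : exc (mask 1 F B) = 0 := by omega
    have key : ∀ S < 8, exc S = 2 → S = 7 := by decide
    have key2 : ∀ S < 8, 0 < S → exc S = 0 → ∃ π : Equiv.Perm (Fin 3),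
        (∀ x : Fin 3, S.testBit (π x) = Nat.testBit 4 x) := by decide
    have key3 : ∀ x y : Fin 3, Nat.testBit 7 x = Nat.testBit 7 y := by decide
    have hA7 := key _ (mask_lt A) hA
    obtain ⟨π, hπ⟩ := key2 _ (mask_lt B) (mask_pos hF.1 hv B) hB0
    have mA : mask π F A = 7 := mask_conj π A (by omega) (fun x => by rw [hA7]; exact key3 _ _)
    have mB : mask π F B = 4 := mask_conj π B (by omega) hπ
    refine fromAB (π := π) (tab := tabY) hnd hv hy hF hB.symm ?_ ?_ ?_
    · rw [mA, mB]; exact okZeroY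
    · rw [mA, mB]; exact okTabY
    · rw [mA, mB]; decide
  · have key : ∀ S < 8, exc S ≤ 2 := by decide
    have hle : ∀ j, exc (mask 1 F j) ≤ 1 := by
      intro j
      have := key _ (mask_lt (π := 1) (y := F) j)
      have : exc (mask 1 F j) ≠ 2 := fun e => h7 ⟨j, e⟩
      omega
    obtain ⟨A, hA⟩ : ∃ A, exc (mask 1 F A) ≠ 0 := by
      by_contra hh
      push Not at hh
      rw [Finset.sum_eq_zero (fun j _ => hh j)] at hs
      omega
    have e1 := Finset.add_sum_erase Finset.univ (fun j => exc (mask 1 F j)) (Finset.mem_univ A)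
    obtain ⟨B, hBA, hB⟩ : ∃ B, B ≠ A ∧ exc (mask 1 F B) ≠ 0 := by
      by_contra hh
      push Not at hh
      rw [Finset.sum_eq_zero (s := Finset.univ.erase A)
        (fun j hj => hh j (Finset.ne_of_mem_erase hj))] at e1
      have := hle A
      omega
    have hA1 : exc (mask 1 F A) = 1 := by have := hle A; omega
    have hB1 : exc (mask 1 F B) = 1 := by have := hle B; omega
    have key2 : ∀ S < 8, ∀ S' < 8,
        (Nat.beq (exc S) 1 && (Nat.beq (exc S') 1 && !confl S S')) = true →
        ∃ π : Equiv.Perm (Fin 3), ∀ x : Fin 3, (S.testBit (π x) == Nat.testBit 3 x &&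
          S'.testBit (π x) == Nat.testBit 6 x) = true := by decide
    obtain ⟨π, hπ0⟩ := key2 _ (mask_lt A) _ (mask_lt B)
      (by rw [hA1, hB1, no_confl hF hBA.symm]; rfl)
    have hπ : ∀ x : Fin 3, (mask 1 F A).testBit (π x) = Nat.testBit 3 x := fun x => by
      have := hπ0 x
      rw [Bool.and_eq_true, beq_iff_eq] at this
      exact this.1
    have hπ' : ∀ x : Fin 3, (mask 1 F B).testBit (π x) = Nat.testBit 6 x := fun x => by
      have := hπ0 x
      rw [Bool.and_eq_true, beq_iff_eq, beq_iff_eq] at this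
      exact this.2
    have mA : mask π F A = 3 := mask_conj π A (by omega) hπ
    have mB : mask π F B = 6 := mask_conj π B (by omega) hπ'
    refine fromAB (π := π) (tab := tabL) hnd hv hy hF hBA.symm ?_ ?_ ?_
    · rw [mA, mB]; exact okZeroL
    · rw [mA, mB]; exact okTabL
    · rw [mA, mB]; decide

end main
end G3

/-- a non-degenerate 3×n transportation polytope with k critical edges has
graph diameter at most n + 2 − k, the Hirsch bound. -/
theorem stmt_17 (n : ℕ) (hn : 0 < n) (u : Fin 3 → ℝ) (v : Fin n → ℝ)
    (hu : ∀ i, 0 < u i) (hv : ∀ j, 0 < v j) (huv : ∑ i, u i = ∑ j, v j)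
    (hnd : NonDeg 3 n u v)
    (O F : Matrix (Fin 3) (Fin n) ℝ)
    (hO : O ∈ Set.extremePoints ℝ (TP 3 n u v))
    (hF : F ∈ Set.extremePoints ℝ (TP 3 n u v)) :
    ∃ k ≤ n + 2 - criticalCount 3 n u v, ∃ w : ℕ → Matrix (Fin 3) (Fin n) ℝ,
      w 0 = O ∧ w k = F ∧ ∀ i < k, AdjVert 3 n u v (w i) (w (i + 1)) := by
  exact G3.final_thm hn hnd hv hO hF
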